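/- Let α, β, γ be partitions such that a_{dα,dβ}^{dγ} = 1 for every positive integer d (where dα denotes the partition obtained by multiplying every part of α by d). Then for every triple of partitions (λ, μ, ν), the sequence d ↦ a_{λ+dα, μ+dβ}^{ν+dγ} is eventually constant as d → ∞. -/

import Mathlib

open scoped BigOperators
open scoped Classical

/-- A partition: a finitely supported antitone sequence of natural numbers
(the parts, indexed from 0). -/
def IsPartitionFun (f : ℕ →₀ ℕ) : Prop := ∀ ⦃i j : ℕ⦄, i ≤ j → f j ≤ f i

def Partition' : Type := {f : ℕ →₀ ℕ // IsPartitionFun f}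

namespace Partition'

/-- The size `|λ|` of a partition. -/
def size (l : Partition') : ℕ := l.1.sum fun _ v => v

/-- The number of (nonzero) parts of a partition. -/
def plength (l : Partition') : ℕ := l.1.support.card

noncomputable instance : Add Partition' :=
  ⟨fun l m => ⟨l.1 + m.1, fun i j h => by
    simp only [Finsupp.add_apply]
    exact add_le_add (l.2 h) (m.2 h)⟩⟩

noncomputable instance : SMul ℕ Partition' :=
  ⟨fun d l => ⟨d • l.1, fun i j h => by
    simp only [Finsupp.smul_apply, smul_eq_mul]
    exact Nat.mul_le_mul_left d (l.2 h)⟩⟩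

/-- The one-row partition `(m)`. For `m = 0` this is the empty partition. -/
noncomputable def row (m : ℕ) : Partition' :=
  ⟨Finsupp.single 0 m, by
    intro i j h
    simp only [Finsupp.single_apply]
    split_ifs <;> omega⟩

/-- The two-row partition `(a, b)` (with `b ≤ a`). -/
noncomputable def twoRow (a b : ℕ) (hba : b ≤ a) : Partition' :=
  ⟨Finsupp.single 0 a + Finsupp.single 1 b, by
    intro i j h
    simp only [Finsupp.add_apply, Finsupp.single_apply]
    split_ifs <;> omega⟩

/-- `youngCount n a g` is the number of fixed points of the permutation `g` acting on the
set of functions `Fin n → Fin n` whose fibre over `i` has exactly `a i` elements; i.e. the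
value at `g` of the permutation character of `S_n` acting on cosets of the Young subgroup
attached to the composition `a`. It is `0` if some `a i` is negative. -/
noncomputable def youngCount (n : ℕ) (a : Fin n → ℤ) (g : Equiv.Perm (Fin n)) : ℤ :=
  if ∀ i, 0 ≤ a i then
    (Nat.card {f : Fin n → Fin n //
      f ∘ g = f ∧ ∀ i : Fin n, Nat.card {x : Fin n // f x = i} = (a i).toNat} : ℤ)
  else 0

/-- The irreducible character of the symmetric group `S_n` attached to a partition `l`
of `n`, given by the Jacobi–Trudi determinantal formula
`χ_l = det (h_{l_i - i + j})` expanded over permutations, where `h`-products are the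
permutation characters of Young subgroups. (When `size l ≠ n` this is not used.) -/
noncomputable def irrChar (n : ℕ) (l : Partition') (g : Equiv.Perm (Fin n)) : ℤ :=
  ∑ σ : Equiv.Perm (Fin n), (Equiv.Perm.sign σ : ℤ) *
    youngCount n (fun i => (l.1 i : ℤ) + ((σ i : ℕ) : ℤ) - (i : ℤ)) g

/-- The Kronecker coefficient `g_{λ,μ,ν}`: the multiplicity of the irreducible `S_n`-module
`M_ν` in `M_λ ⊗ M_μ` (for `|λ| = |μ| = |ν| = n`), computed as the scalar product of
characters `(1/n!) ∑_{g ∈ S_n} χ_λ(g) χ_μ(g) χ_ν(g)`; it is `0` if the sizes differ. -/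
noncomputable def kron (l m nu : Partition') : ℕ :=
  if size l = size nu ∧ size m = size nu then
    ((∑ g : Equiv.Perm (Fin (size nu)),
        irrChar (size nu) l g * irrChar (size nu) m g * irrChar (size nu) nu g) /
      (Nat.factorial (size nu) : ℤ)).toNat
  else 0

/-- The standard embedding `S_a × S_b ↪ S_{a+b}`. -/
def sumEmb {a b : ℕ} (g : Equiv.Perm (Fin a)) (h : Equiv.Perm (Fin b)) :
    Equiv.Perm (Fin (a + b)) :=
  (Equiv.permCongr finSumFinEquiv) (Equiv.sumCongr g h)

/-- The Littlewood–Richardson coefficient `c_{λ,μ}^ν`: the multiplicity of `M_ν` in the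
induction of `M_λ ⊠ M_μ` from `S_{|λ|} × S_{|μ|}` to `S_{|λ|+|μ|}`, computed by
Frobenius reciprocity as a scalar product of characters; it is `0` unless
`|ν| = |λ| + |μ|`. -/
noncomputable def lr (l m nu : Partition') : ℕ :=
  if size nu = size l + size m then
    ((∑ g : Equiv.Perm (Fin (size l)), ∑ h : Equiv.Perm (Fin (size m)),
        irrChar (size l) l g * irrChar (size m) m h *
          irrChar (size l + size m) nu (sumEmb g h)) /
      ((Nat.factorial (size l) : ℤ) * (Nat.factorial (size m) : ℤ))).toNat
  else 0

/-- The Aguiar coefficient `a_{λ,μ}^ν`, defined by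
`a_{λ,μ}^ν = Σ_{α,β,δ,η,ρ,τ} c_{α,β}^λ c_{η,ρ}^μ g_{β,η,δ} c_{α,δ}^τ c_{τ,ρ}^ν`. -/
noncomputable def aguiar (l m nu : Partition') : ℕ :=
  ∑ᶠ (α : Partition') (β : Partition') (δ : Partition') (η : Partition')
    (ρ : Partition') (τ : Partition'),
    lr α β l * lr η ρ m * kron β η δ * lr α δ τ * lr τ ρ nu

end Partition'

namespace Agu
open MvPolynomial

/-- the shifted weight `κ i + σ i - i`. -/
def shf {n : ℕ} (κ : Fin n → ℤ) (σ : Equiv.Perm (Fin n)) : Fin n → ℤ :=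
  fun i => κ i + ((σ i : ℕ) : ℤ) - (i : ℤ)

/-- alternating sum. -/
noncomputable def alt {n : ℕ} {K : Type*} [CommRing K] (κ : Fin n → ℤ) (φ : (Fin n → ℤ) → K) : K :=
  ∑ σ : Equiv.Perm (Fin n), ((Equiv.Perm.sign σ : ℤ) : K) * φ (shf κ σ)

/-- coefficient with integer exponents -/
noncomputable def cf {n : ℕ} {K : Type*} [CommRing K] (g : MvPolynomial (Fin n) K)
    (a : Fin n → ℤ) : K :=
  if ∀ i, 0 ≤ a i then g.coeff (Finsupp.equivFunOnFinite.symm fun i => (a i).toNat) else 0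

noncomputable def vd (n : ℕ) (K : Type*) [CommRing K] : MvPolynomial (Fin n) K :=
  (Matrix.vandermonde (fun i : Fin n => (X i : MvPolynomial (Fin n) K))).det

noncomputable def dl {n : ℕ} (κ : Fin n → ℕ) : Fin n →₀ ℕ :=
  Finsupp.equivFunOnFinite.symm fun i => κ i + (n - 1 - (i : ℕ))

noncomputable def pex {n : ℕ} (σ : Equiv.Perm (Fin n)) : Fin n →₀ ℕ :=
  Finsupp.equivFunOnFinite.symm fun i => (σ i : ℕ)

lemma vd_eq (n : ℕ) (K : Type*) [CommRing K] :
    vd n K = ∑ σ : Equiv.Perm (Fin n), monomial (pex σ) ((Equiv.Perm.sign σ : ℤ) : K) := by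
  unfold vd
  rw [Matrix.det_apply', ← Equiv.sum_comp (Equiv.inv _)]
  refine Finset.sum_congr rfl fun σ _ => ?_
  have : ∏ i, Matrix.vandermonde (fun i : Fin n => (X i : MvPolynomial (Fin n) K))
      ((σ⁻¹ : Equiv.Perm (Fin n)) i) i = ∏ i, X i ^ (σ i : ℕ) := by
    rw [← Equiv.prod_comp σ]
    simp [Matrix.vandermonde_apply]
  simp only [Equiv.inv_apply]
  rw [this, monomial_eq, Finsupp.prod_fintype _ _ (by simp)]
  simp [pex]

lemma coeff_vd_mul {n : ℕ} {K : Type*} [CommRing K] (κ : Fin n → ℕ) (g : MvPolynomial (Fin n) K) :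
    (vd n K * g).coeff (dl κ) =
      ((Equiv.Perm.sign (Fin.revPerm : Equiv.Perm (Fin n)) : ℤ) : K) *
        alt (fun i => (κ i : ℤ)) (cf g) := by
  rw [vd_eq, Finset.sum_mul, coeff_sum, alt, Finset.mul_sum,
    ← Equiv.sum_comp (Equiv.mulLeft (Fin.revPerm : Equiv.Perm (Fin n)))]
  refine Finset.sum_congr rfl fun σ _ => ?_
  rw [coeff_monomial_mul', Equiv.coe_mulLeft, Equiv.Perm.sign_mul]
  have key : ∀ i : Fin n, ((pex (Fin.revPerm * σ)) i : ℤ) = n - 1 - (σ i : ℕ) := by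
    intro i
    have := (σ i).2
    simp [pex, Fin.val_rev]
    omega
  have key2 : ∀ i : Fin n, ((dl κ) i : ℤ) = κ i + (n - 1 - (i : ℕ)) := by
    intro i
    have := i.2
    simp [dl]
    omega
  have hle : pex (Fin.revPerm * σ) ≤ dl κ ↔ ∀ i, 0 ≤ shf (fun i => (κ i : ℤ)) σ i := by
    rw [Finsupp.le_def]
    refine forall_congr' fun i => ?_
    have h1 := key i; have h2 := key2 i
    simp only [shf]; omega
  unfold cf
  simp only [hle]
  split_ifs with h
  · have : dl κ - pex (Fin.revPerm * σ) =
        Finsupp.equivFunOnFinite.symm fun i => (shf (fun i => (κ i : ℤ)) σ i).toNat := by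
      ext i
      have h1 := key i; have h2 := key2 i
      have h3 := h i
      simp only [Finsupp.tsub_apply, Finsupp.equivFunOnFinite_symm_apply_apply, shf] at *
      omega
    rw [this]; push_cast; ring
  · simp

/-- Euler derivation -/
noncomputable def th {n : ℕ} {K : Type*} [CommRing K] (k : Fin n) :
    Derivation K (MvPolynomial (Fin n) K) (MvPolynomial (Fin n) K) :=
  (X k : MvPolynomial (Fin n) K) • pderiv k

lemma th_apply {n : ℕ} {K : Type*} [CommRing K] (k : Fin n) (p : MvPolynomial (Fin n) K) :
    th k p = X k * pderiv k p := rfl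

lemma coeff_th {n : ℕ} {K : Type*} [CommRing K] (k : Fin n) (p : MvPolynomial (Fin n) K)
    (m : Fin n →₀ ℕ) : (th k p).coeff m = (m k : K) * p.coeff m := by
  induction p using MvPolynomial.induction_on' with
  | monomial u a =>
    rw [th_apply, X_mul_pderiv_monomial]
    rw [coeff_smul, coeff_monomial, nsmul_eq_mul]
    split_ifs with h
    · rw [h]
    · simp
  | add p q hp hq => rw [map_add, coeff_add, hp, hq, coeff_add]; ring

lemma leib_prod {ι : Type*} {R A : Type*} [CommRing R] [CommRing A] [Algebra R A]
    (D : Derivation R A A) (s : Finset ι) (f : ι → A) :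
    D (∏ i ∈ s, f i) = ∑ i ∈ s, (∏ j ∈ s.erase i, f j) * D (f i) := by
  induction s using Finset.induction_on with
  | empty => simp
  | insert a s ha ih =>
    rw [Finset.prod_insert ha, Derivation.leibniz, ih, Finset.sum_insert ha,
      Finset.erase_insert ha, smul_eq_mul, smul_eq_mul, add_comm, Finset.mul_sum]
    congr 1
    refine Finset.sum_congr rfl fun i hi => ?_
    have : a ≠ i := fun h => ha (h ▸ hi)
    rw [Finset.erase_insert_of_ne this, Finset.prod_insert (by simp [ha]), mul_assoc]

/-- The key identity for the cross terms. -/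
lemma cross {n : ℕ} {K : Type*} [CommRing K] (g : MvPolynomial (Fin n) K)
    (T : Fin n → Fin n → MvPolynomial (Fin n) K)
    (hT : ∀ i j, i < j → (X i - X j) * T i j = X j * (th i g - th j g)) :
    ∑ k, th k (vd n K) * th k g =
      vd n K * ∑ i, ∑ j ∈ Finset.Ioi i, (T i j + th i g) := by
  unfold vd
  rw [Matrix.det_vandermonde, Finset.prod_sigma', Finset.sum_sigma', Finset.mul_sum]
  simp_rw [leib_prod, Finset.sum_mul]
  rw [Finset.sum_comm]
  refine Finset.sum_congr rfl fun x hx => ?_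
  rw [← Finset.prod_erase_mul _ _ hx]
  obtain ⟨i, j⟩ := x
  simp only [Finset.mem_sigma, Finset.mem_univ, Finset.mem_Ioi, true_and] at hx
  simp_rw [mul_assoc]
  rw [← Finset.mul_sum]
  refine congr_arg₂ (· * ·) (by congr!) ?_
  have : ∀ k, th k (X j - X i : MvPolynomial (Fin n) K) =
      (if k = j then X j else 0) - (if k = i then X i else 0) := by
    intro k
    rw [map_sub, th_apply, th_apply, pderiv_X, pderiv_X]
    simp only [Pi.single_apply]
    congr 1
    · by_cases h : k = j
      · subst h; simp
      · rw [if_neg h, if_neg (fun h' => h h'.symm)]; simp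
    · by_cases h : k = i
      · subst h; simp
      · rw [if_neg h, if_neg (fun h' => h h'.symm)]; simp
  simp_rw [this, sub_mul, ite_mul, zero_mul]
  rw [Finset.sum_sub_distrib]
  simp only [Finset.sum_ite_eq', Finset.mem_univ, if_true]
  have := hT i j hx
  linear_combination this

end Agu

namespace Agu
open MvPolynomial

lemma sum_lt_pairs {n : ℕ} {M : Type*} [CommRing M] (a : Fin n → M) :
    ∑ i, ∑ j ∈ Finset.Ioi i, (a i + a j) = ((n : M) - 1) * ∑ k, a k := by
  have h1 : ∑ i, ∑ j ∈ Finset.Ioi i, (a i + a j) =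
      ∑ i, ∑ j, (if i < j then a i else 0) + ∑ i, ∑ j, (if i < j then a j else 0) := by
    rw [← Finset.sum_add_distrib]
    refine Finset.sum_congr rfl fun i _ => ?_
    rw [← Finset.sum_add_distrib, ← Finset.sum_filter_add_sum_filter_not Finset.univ (fun j => i < j)]
    rw [Finset.sum_add_distrib (s := Finset.filter (fun j => ¬ i < j) Finset.univ),
      Finset.sum_eq_zero (s := Finset.filter (fun j => ¬ i < j) Finset.univ),
      Finset.sum_eq_zero (s := Finset.filter (fun j => ¬ i < j) Finset.univ)]
    · rw [add_zero, add_zero]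
      refine Finset.sum_congr (by ext; simp) fun j hj => ?_
      simp at hj
      simp [hj]
    · intro j hj; simp at hj; simp [hj]
    · intro j hj; simp at hj; simp [hj]
  rw [h1, Finset.sum_comm (f := fun i j => if i < j then a j else 0), ← Finset.sum_add_distrib,
    Finset.mul_sum]
  refine Finset.sum_congr rfl fun i _ => ?_
  rw [← Finset.sum_add_distrib]
  have : ∀ j : Fin n, ((if i < j then a i else 0) + if j < i then a i else 0) =
      a i - if i = j then a i else 0 := by
    intro j
    rcases lt_trichotomy i j with h | h | h
    · simp [h, h.not_gt, h.ne]
    · simp [h]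
    · simp [h, h.not_gt, h.ne']
  simp_rw [this]
  rw [Finset.sum_sub_distrib]
  simp
  ring

/-- the second-order operator -/
noncomputable def Th {n : ℕ} {K : Type*} [CommRing K] (p : MvPolynomial (Fin n) K) :
    MvPolynomial (Fin n) K := ∑ k, th k (th k p) - C ((n : K) - 1) * ∑ k, th k p

def cas {n : ℕ} (κ : Fin n → ℕ) : ℤ := ∑ i, ((κ i : ℤ) ^ 2 + κ i * (n - 1 - 2 * (i : ℤ)))

lemma coeff_Th {n : ℕ} {K : Type*} [CommRing K] (p : MvPolynomial (Fin n) K) (m : Fin n →₀ ℕ) :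
    (Th p).coeff m = (∑ k, ((m k : K) ^ 2 - ((n : K) - 1) * m k)) * p.coeff m := by
  unfold Th
  rw [coeff_sub, coeff_C_mul, coeff_sum, coeff_sum, Finset.sum_mul, Finset.mul_sum,
    ← Finset.sum_sub_distrib]
  refine Finset.sum_congr rfl fun k _ => ?_
  rw [coeff_th, coeff_th]; ring

lemma Th_vd (n : ℕ) (K : Type*) [CommRing K] :
    Th (vd n K) = C (∑ k : Fin n, (((k : ℕ) : K) ^ 2 - ((n : K) - 1) * ((k : ℕ) : K))) * vd n K := by
  ext m
  rw [coeff_Th, coeff_C_mul, vd_eq, coeff_sum, Finset.mul_sum, Finset.mul_sum]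
  refine Finset.sum_congr rfl fun σ _ => ?_
  rw [coeff_monomial]
  split_ifs with h
  · subst h
    congr 1
    rw [← Equiv.sum_comp σ (fun k : Fin n => (((k : ℕ) : K) ^ 2 - ((n : K) - 1) * ((k : ℕ) : K)))]
    rfl
  · simp

lemma alt_cas {n : ℕ} {K : Type*} [CommRing K] (g gC : MvPolynomial (Fin n) K)
    (T : Fin n → Fin n → MvPolynomial (Fin n) K)
    (hT : ∀ i j, i < j → (X i - X j) * T i j = X j * (th i g - th j g))
    (hC : gC = ∑ k, th k (th k g) + ∑ i, ∑ j ∈ Finset.Ioi i, (th i g - th j g + 2 * T i j))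
    (κ : Fin n → ℕ) :
    alt (fun i => (κ i : ℤ)) (cf gC) = (cas κ : K) * alt (fun i => (κ i : ℤ)) (cf g) := by
  have h1 : Th (vd n K * g) = Th (vd n K) * g + vd n K * gC := by
    have hc := cross g T hT
    have hl : ∀ k, th k (th k (vd n K * g)) = th k (th k (vd n K)) * g +
        2 * (th k (vd n K) * th k g) + vd n K * th k (th k g) := by
      intro k
      simp only [Derivation.leibniz, smul_eq_mul, map_add]; ring
    have hp := sum_lt_pairs (fun k => th k g)
    have hs : ∑ i, ∑ j ∈ Finset.Ioi i, (th i g - th j g + 2 * T i j) =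
        2 * (∑ i, ∑ j ∈ Finset.Ioi i, (T i j + th i g)) -
          ∑ i, ∑ j ∈ Finset.Ioi i, (th i g + th j g) := by
      simp_rw [Finset.mul_sum]
      rw [← Finset.sum_sub_distrib]
      refine Finset.sum_congr rfl fun i _ => ?_
      rw [← Finset.sum_sub_distrib]
      refine Finset.sum_congr rfl fun j _ => ?_
      ring
    have hl2 : ∀ k, th k (vd n K * g) = th k (vd n K) * g + vd n K * th k g := by
      intro k
      simp only [Derivation.leibniz, smul_eq_mul]; ring
    unfold Th
    simp_rw [hl, hl2]
    rw [Finset.sum_add_distrib, Finset.sum_add_distrib, Finset.sum_add_distrib,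
      ← Finset.sum_mul, ← Finset.mul_sum, ← Finset.mul_sum, ← Finset.mul_sum, ← Finset.sum_mul, hc,
      hC, hs, hp]
    simp only [map_sub, map_natCast, map_one]
    ring
  have h2 := congr_arg (coeff (dl κ)) h1
  rw [coeff_Th, Th_vd, coeff_add, mul_assoc, coeff_C_mul, coeff_vd_mul, coeff_vd_mul] at h2
  set s : K := ((Equiv.Perm.sign (Fin.revPerm : Equiv.Perm (Fin n)) : ℤ) : K) with hs
  have hss : s * s = 1 := by
    rw [hs, ← Int.cast_mul, ← Units.val_mul, Int.units_mul_self]; simp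
  have h3 : ∑ k, (((dl κ) k : K) ^ 2 - ((n : K) - 1) * (dl κ) k) = (cas κ : K) +
      ∑ k : Fin n, (((k : ℕ) : K) ^ 2 - ((n : K) - 1) * ((k : ℕ) : K)) := by
    unfold cas
    push_cast
    rw [← Finset.sum_add_distrib]
    refine Finset.sum_congr rfl fun i _ => ?_
    have : (((dl κ) i : ℕ) : K) = κ i + (n - 1 - (i : ℕ)) := by
      have := i.2
      have h : (dl κ) i + 1 + i = κ i + n := by simp [dl]; omega
      have := congr_arg (Nat.cast : ℕ → K) h
      push_cast at this
      linear_combination this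
    rw [this]; ring
  rw [h3] at h2
  linear_combination (-s) * h2 + ((cas κ : K) * alt (fun i => (κ i : ℤ)) (cf g) -
    alt (fun i => (κ i : ℤ)) (cf gC)) * hss

lemma abel_eq (d y : ℕ → ℤ) (n : ℕ) : ∑ i ∈ Finset.range (n + 1), d i * y i =
    (∑ i ∈ Finset.range (n + 1), d i) * y n +
      ∑ k ∈ Finset.range n, (∑ i ∈ Finset.range (k + 1), d i) * (y k - y (k + 1)) := by
  induction n with
  | zero => simp
  | succ n ih =>
    rw [Finset.sum_range_succ, ih, Finset.sum_range_succ _ (n + 1),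
      Finset.sum_range_succ (fun k => (∑ i ∈ Finset.range (k + 1), d i) * (y k - y (k + 1)))]
    ring

lemma abel_pos (d y : ℕ → ℤ) (n : ℕ) (hD : ∀ k ≤ n, 0 ≤ ∑ i ∈ Finset.range k, d i)
    (h0 : ∑ i ∈ Finset.range n, d i = 0) (hy : ∀ i, i + 1 < n → y (i + 1) < y i)
    (hne : ∃ i < n, d i ≠ 0) : 0 < ∑ i ∈ Finset.range n, d i * y i := by
  obtain ⟨i, hi, hd⟩ := hne
  obtain ⟨n, rfl⟩ : ∃ m, n = m + 1 := ⟨n - 1, by omega⟩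
  rw [abel_eq, h0, zero_mul, zero_add]
  apply Finset.sum_pos'
  · intro k hk
    simp at hk
    exact mul_nonneg (hD _ (by omega)) (by have := hy k (by omega); omega)
  · by_contra! hcon
    have hz : ∀ k ≤ n + 1, ∑ i ∈ Finset.range k, d i = 0 := by
      intro k hk
      rcases Nat.eq_zero_or_pos k with rfl | hk0
      · simp
      by_cases hkn : k = n + 1
      · rw [hkn, h0]
      obtain ⟨k, rfl⟩ : ∃ m, k = m + 1 := ⟨k - 1, by omega⟩
      have h1 := hcon k (by simp; omega)
      have h2 := hD (k + 1) hk
      have h3 := hy k (by omega)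
      by_contra h4
      have : 0 < ∑ i ∈ Finset.range (k + 1), d i := lt_of_le_of_ne h2 (Ne.symm h4)
      have := mul_pos this (by omega : 0 < y k - y (k + 1))
      omega
    have a := hz i (by omega)
    have b := hz (i + 1) (by omega)
    rw [Finset.sum_range_succ] at b
    omega

/-- extend by zero -/
def ez {n : ℕ} (d : Fin n → ℤ) : ℕ → ℤ := fun i => if h : i < n then d ⟨i, h⟩ else 0

lemma ez_val {n : ℕ} (d : Fin n → ℤ) (i : Fin n) : ez d i = d i := by simp [ez]

lemma sum_ez {n : ℕ} (d : Fin n → ℤ) : ∑ i ∈ Finset.range n, ez d i = ∑ i, d i := by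
  rw [← Fin.sum_univ_eq_sum_range]; simp [ez_val]

/-- dominance (weak) : all partial sums of `d` nonnegative, total zero. -/
def Dom {n : ℕ} (d : Fin n → ℤ) : Prop :=
  (∀ k ≤ n, 0 ≤ ∑ i ∈ Finset.range k, ez d i) ∧ ∑ i, d i = 0

lemma Dom.pos {n : ℕ} {d y : Fin n → ℤ} (h : Dom d) (hd : d ≠ 0) (hy : StrictAnti y) :
    0 < ∑ i, d i * y i := by
  have := abel_pos (ez d) (ez y) n h.1 (by rw [sum_ez, h.2]) (by
    intro i hi
    have := hy (show (⟨i, by omega⟩ : Fin n) < ⟨i + 1, hi⟩ by simp)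
    simp [ez, hi, show i < n by omega, this]) (by
    by_contra! hc
    exact hd (funext fun i => by rw [← ez_val d, hc i i.2]; rfl))
  rw [← Fin.sum_univ_eq_sum_range] at this
  simpa [ez_val] using this

lemma ez_add {n : ℕ} (d e : Fin n → ℤ) (i : ℕ) : ez (d + e) i = ez d i + ez e i := by
  unfold ez; split_ifs <;> simp

lemma Dom.add {n : ℕ} {d e : Fin n → ℤ} (h : Dom d) (h' : Dom e) : Dom (d + e) := by
  refine ⟨fun k hk => ?_, ?_⟩
  · simp_rw [ez_add]; rw [Finset.sum_add_distrib]; exact add_nonneg (h.1 k hk) (h'.1 k hk)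
  · simp [Finset.sum_add_distrib, h.2, h'.2]

lemma Dom.root {n : ℕ} {i j : Fin n} (hij : i < j) : Dom (Pi.single i 1 - Pi.single j 1 : Fin n → ℤ) := by
  have e : ∀ t : ℕ, ez (Pi.single i 1 - Pi.single j 1 : Fin n → ℤ) t =
      (if t = i then 1 else 0) - (if t = j then 1 else 0) := by
    intro t
    unfold ez
    split_ifs with h1 h2 h3 h3 h3 h3 h3 <;> simp_all [Pi.single_apply, Fin.ext_iff]
  refine ⟨fun k hk => ?_, by simp⟩
  simp_rw [e]
  rw [Finset.sum_sub_distrib]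
  simp only [Finset.sum_ite_eq', Finset.mem_range]
  have : (i : ℕ) < j := hij
  split_ifs <;> omega

lemma Dom.perm {n : ℕ} (σ : Equiv.Perm (Fin n)) : Dom (fun i => ((σ i : ℕ) : ℤ) - (i : ℤ)) := by
  refine ⟨fun k hk => ?_, ?_⟩
  · have h1 : ∑ i ∈ Finset.range k, ez (fun i : Fin n => ((σ i : ℕ) : ℤ) - (i : ℤ)) i =
        ∑ i ∈ Finset.univ.filter (fun i : Fin n => (i : ℕ) < k), (((σ i : ℕ) : ℤ) - (i : ℤ)) := by
      rw [← Finset.sum_subset (s₁ := (Finset.univ.filter (fun i : Fin n => (i : ℕ) < k)).map Fin.valEmbedding)]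
      · simp [ez_val]
      · intro x; simp; intro a _ ; omega
      · intro x hx hx'
        simp at hx hx'
        exact absurd rfl (hx' ⟨x, by omega⟩ hx)
    rw [h1]
    set A := Finset.univ.filter (fun i : Fin n => (i : ℕ) < k)
    rw [Finset.sum_sub_distrib, sub_nonneg]
    have h2 : ∑ i ∈ A, ((σ i : ℕ) : ℤ) = ∑ i ∈ A.map σ.toEmbedding, ((i : ℕ) : ℤ) := by simp
    rw [h2]
    set B := A.map σ.toEmbedding
    have hc : (A \ B).card = (B \ A).card := by
      apply Finset.card_sdiff_comm; simp [B]
    rw [← Finset.sum_inter_add_sum_sdiff A B, ← Finset.sum_inter_add_sum_sdiff B A, Finset.inter_comm B A]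
    have l1 : ∑ i ∈ A \ B, ((i : ℕ) : ℤ) ≤ (A \ B).card • (k : ℤ) := by
      apply Finset.sum_le_card_nsmul
      intro x hx; simp [A] at hx; omega
    have l2 : (B \ A).card • (k : ℤ) ≤ ∑ i ∈ B \ A, ((i : ℕ) : ℤ) := by
      apply Finset.card_nsmul_le_sum
      intro x hx; simp [A] at hx; omega
    rw [hc] at l1
    omega
  · rw [Finset.sum_sub_distrib, Equiv.sum_comp σ (fun i => ((i : ℕ) : ℤ)), sub_self]

end Agu

namespace Agu
open MvPolynomial

section HW
variable {n : ℕ} {K : Type*} [Field K] [CharZero K] {V : Type*} [AddCommGroup V] [Module K V]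

/-- `gl_n` relations -/
def IsGl (E : Fin n → Fin n → Module.End K V) : Prop :=
  ∀ i j k l, E i j * E k l - E k l * E i j = (if j = k then E i l else 0) - (if l = i then E k j else 0)

/-- the diagonal operators are killed by `∏_{k<M} (x-k)`. -/
def IsDiag (E : Fin n → Fin n → Module.End K V) (M : ℕ) : Prop :=
  ∀ i, Polynomial.aeval (E i i) (∏ k ∈ Finset.range M, (Polynomial.X - Polynomial.C (k : K))) = 0

lemma exists_hom (f : Fin n → Module.End K V) (hf : ∀ i j, f i * f j = f j * f i) :
    ∃ φ : MvPolynomial (Fin n) K →ₐ[K] Module.End K V, ∀ i, φ (X i) = f i := by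
  have hc : ∀ a ∈ Set.range f, ∀ b ∈ Set.range f, a * b = b * a := by
    rintro _ ⟨i, rfl⟩ _ ⟨j, rfl⟩; exact hf i j
  letI := Algebra.adjoinCommRingOfComm K hc
  let ψ : MvPolynomial (Fin n) K →ₐ[K] Algebra.adjoin K (Set.range f) :=
    MvPolynomial.aeval (fun i => ⟨f i, Algebra.subset_adjoin ⟨i, rfl⟩⟩)
  refine ⟨(Algebra.adjoin K (Set.range f)).val.comp ψ, fun i => ?_⟩
  simp [ψ]

structure IsProjs (E : Fin n → Fin n → Module.End K V) (B : Finset (Fin n →₀ ℕ))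
    (π : (Fin n →₀ ℕ) → Module.End K V) : Prop where
  sum : ∑ m ∈ B, π m = 1
  out : ∀ m, m ∉ B → π m = 0
  left : ∀ i m, E i i * π m = (m i : K) • π m
  right : ∀ i m, π m * E i i = (m i : K) • π m

lemma exists_projs (E : Fin n → Fin n → Module.End K V) (hE : IsGl E) (M : ℕ) (hM : IsDiag E M) :
    ∃ B π, IsProjs E B π := by
  obtain ⟨φ, hφ⟩ := exists_hom (fun i => E i i) (fun i j => by
    have := hE i i j j
    by_cases h : i = j
    · subst h; rfl
    · simp [h, Ne.symm h] at this; exact sub_eq_zero.1 this)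
  have hinj : Set.InjOn (fun k : ℕ => (k : K)) (Finset.range M) := fun a _ b _ h => by simpa using h
  let L : ℕ → Polynomial K := fun k => Lagrange.basis (Finset.range M) (fun k : ℕ => (k : K)) k
  by_cases hM0 : M = 0
  · -- then either V trivial or n = 0
    by_cases hn : n = 0
    · subst hn
      refine ⟨{0}, fun m => 1, by simp, fun m hm => (hm (by simp [Subsingleton.elim m 0])).elim,
        fun i => i.elim0, fun i => i.elim0⟩
    · have : (1 : Module.End K V) = 0 := by
        have := hM ⟨0, by omega⟩
        simpa [hM0] using this
      refine ⟨∅, fun _ => 0, by simp [this], by simp, by simp, by simp⟩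
  have hLs : ∑ k ∈ Finset.range M, L k = 1 := Lagrange.sum_basis hinj (by simpa using hM0)
  have hLm : ∀ k ∈ Finset.range M, ∃ c : Polynomial K, (Polynomial.X - Polynomial.C (k : K)) * L k =
      c * ∏ k ∈ Finset.range M, (Polynomial.X - Polynomial.C (k : K)) := by
    intro k hk
    refine ⟨∏ j ∈ (Finset.range M).erase k, Polynomial.C ((k : K) - j)⁻¹, ?_⟩
    simp only [L, Lagrange.basis, Lagrange.basisDivisor]
    rw [← Finset.mul_prod_erase _ _ hk, Finset.prod_mul_distrib]
    ring
  let g : (Fin n →₀ ℕ) → MvPolynomial (Fin n) K := fun m => ∏ i, Polynomial.aeval (X i) (L (m i))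
  let B : Finset (Fin n →₀ ℕ) :=
    (Fintype.piFinset fun _ : Fin n => Finset.range M).map (Finsupp.equivFunOnFinite.symm.toEmbedding)
  have hB : ∀ m, m ∈ B ↔ ∀ i, m i ∈ Finset.range M := by
    intro m
    simp only [B, Finset.mem_map_equiv, Fintype.mem_piFinset, Equiv.symm_symm]
    rfl
  have key : ∀ m ∈ B, ∀ i, φ ((X i - C (m i : K)) * g m) = 0 := by
    intro m hm i
    simp only [g]
    rw [← Finset.mul_prod_erase _ _ (Finset.mem_univ i), ← mul_assoc]
    have h1 : (X i - C (m i : K)) * Polynomial.aeval (X i) (L (m i)) =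
        Polynomial.aeval (X i : MvPolynomial (Fin n) K)
          ((Polynomial.X - Polynomial.C (m i : K)) * L (m i)) := by
      simp [algebraMap_eq]
    obtain ⟨c, hc⟩ := hLm (m i) ((hB m).1 hm i)
    rw [h1, hc, map_mul (Polynomial.aeval _), map_mul, map_mul, ← Polynomial.aeval_algHom_apply,
      ← Polynomial.aeval_algHom_apply, hφ, hM i]
    simp
  refine ⟨B, fun m => if m ∈ B then φ (g m) else 0, ?_, ?_, ?_, ?_⟩
  · rw [Finset.sum_congr rfl (fun m hm => if_pos hm), ← map_sum]
    have : ∑ m ∈ B, g m = 1 := by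
      simp only [B, Finset.sum_map, g]
      simp only [Equiv.coe_toEmbedding, Finsupp.equivFunOnFinite_symm_apply_apply]
      rw [← Finset.prod_univ_sum (fun _ : Fin n => Finset.range M)
        (fun i k => Polynomial.aeval (X i : MvPolynomial (Fin n) K) (L k))]
      simp_rw [← map_sum, hLs]
      simp
    rw [this, map_one]
  · intro m hm; simp [hm]
  · intro i m
    by_cases hm : m ∈ B
    · simp only [hm, if_true]
      have := key m hm i
      rw [sub_mul, map_sub, map_mul, hφ, C_mul', map_smul] at this
      exact sub_eq_zero.1 this
    · simp [hm]
  · intro i m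
    by_cases hm : m ∈ B
    · simp only [hm, if_true]
      have := key m hm i
      rw [sub_mul, mul_comm, map_sub, map_mul, hφ, C_mul', map_smul] at this
      exact sub_eq_zero.1 this
    · simp [hm]

variable {E : Fin n → Fin n → Module.End K V} {B : Finset (Fin n →₀ ℕ)}
  {π : (Fin n →₀ ℕ) → Module.End K V}

lemma IsProjs.mul_ne (h : IsProjs E B π) {m m' : Fin n →₀ ℕ} (hm : m ≠ m') : π m * π m' = 0 := by
  obtain ⟨i, hi⟩ : ∃ i, m i ≠ m' i := by
    by_contra! hc; exact hm (Finsupp.ext hc)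
  have h1 : (m i : K) • (π m * π m') = (m' i : K) • (π m * π m') := by
    rw [← smul_mul_assoc, ← h.right i m, mul_assoc, h.left, mul_smul_comm]
  by_contra h0
  exact hi (by exact_mod_cast smul_left_injective K h0 h1)

lemma IsProjs.mul_self (h : IsProjs E B π) (m : Fin n →₀ ℕ) : π m * π m = π m := by
  by_cases hm : m ∈ B
  · conv_rhs => rw [← mul_one (π m), ← h.sum, Finset.mul_sum]
    rw [Finset.sum_eq_single m (fun b _ hb => h.mul_ne hb.symm) (fun h => (h hm).elim)]
  · rw [h.out m hm, mul_zero]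

lemma IsProjs.apply_wt (h : IsProjs E B π) {v : V} {c : Fin n → K} (hv : ∀ i, E i i v = c i • v)
    (m : Fin n →₀ ℕ) (hm : ∃ i, c i ≠ m i) : π m v = 0 := by
  obtain ⟨i, hi⟩ := hm
  have h1 : π m (E i i v) = (m i : K) • π m v := by
    rw [← Module.End.mul_apply, h.right]; rfl
  rw [hv, map_smul] at h1
  by_contra h0
  exact hi (smul_left_injective K h0 h1)

lemma IsProjs.apply_self (h : IsProjs E B π) {v : V} {m : Fin n →₀ ℕ}
    (hv : ∀ i, E i i v = (m i : K) • v) : π m v = v := by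
  have h1 : ∑ m' ∈ B, π m' v = v := by
    rw [← LinearMap.sum_apply, h.sum]; rfl
  have h2 : ∀ m', m' ≠ m → π m' v = 0 := fun m' hm => h.apply_wt hv m' (by
    by_contra! hc; exact hm (Finsupp.ext fun i => by exact_mod_cast (hc i).symm))
  by_cases hm : m ∈ B
  · rwa [Finset.sum_eq_single m (fun b _ hb => h2 b hb) (fun h => (h hm).elim)] at h1
  · rw [Finset.sum_eq_zero (fun b hb => h2 b (by rintro rfl; exact hm hb))] at h1
    rw [← h1, map_zero]

/-- a vector with a weight that is not natural is zero -/
lemma IsProjs.eq_zero (h : IsProjs E B π) {v : V} {c : Fin n → K} (hv : ∀ i, E i i v = c i • v)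
    (hc : ∀ m : Fin n →₀ ℕ, ∃ i, c i ≠ m i) : v = 0 := by
  have h1 : ∑ m' ∈ B, π m' v = v := by
    rw [← LinearMap.sum_apply, h.sum]; rfl
  rw [← h1]
  exact Finset.sum_eq_zero fun m _ => h.apply_wt hv m (hc m)

lemma IsProjs.wt (h : IsProjs E B π) (m : Fin n →₀ ℕ) (v : V) (i : Fin n) :
    E i i (π m v) = (m i : K) • π m v := by
  rw [← Module.End.mul_apply, h.left]; rfl

lemma gl_diag (hE : IsGl E) (k i j : Fin n) :
    E k k * E i j = E i j * E k k + ((if k = i then (1 : K) else 0) - if k = j then 1 else 0) • E i j := by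
  have := hE k k i j
  rw [sub_eq_iff_eq_add'] at this
  rw [this]
  congr 1
  by_cases h1 : k = i <;> by_cases h2 : k = j
  · subst h1; subst h2; simp
  · subst h1; simp [h2, Ne.symm h2]
  · subst h2; simp [h1]
  · simp [h1, h2, Ne.symm h2]

lemma gl_wt (hE : IsGl E) {v : V} {c : Fin n → K} (hv : ∀ i, E i i v = c i • v) (i j k : Fin n) :
    E k k (E i j v) = (c k + ((if k = i then (1 : K) else 0) - if k = j then 1 else 0)) • E i j v := by
  rw [← Module.End.mul_apply, gl_diag hE, LinearMap.add_apply, Module.End.mul_apply, hv, map_smul,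
    add_smul, LinearMap.smul_apply]

/-- off-block vanishing -/
lemma IsProjs.shift (h : IsProjs E B π) (hE : IsGl E) (i j : Fin n) {m m' : Fin n →₀ ℕ}
    (hm : m + Finsupp.single i 1 ≠ m' + Finsupp.single j 1) : π m' * E i j * π m = 0 := by
  ext v
  refine h.apply_wt (gl_wt hE (fun k => h.wt m v k) i j) m' ?_
  by_contra! hc
  refine hm (Finsupp.ext fun k => ?_)
  have := hc k
  simp only [Finsupp.add_apply, Finsupp.single_apply]
  have h2 : ((m k + (if i = k then 1 else 0) : ℕ) : K) = ((m' k + (if j = k then 1 else 0) : ℕ) : K) := by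
    push_cast
    simp only [eq_comm (b := k)]
    linear_combination this
  exact_mod_cast h2

end HW
end Agu

namespace Agu
open MvPolynomial

section HW
variable {n : ℕ} {K : Type*} [Field K] [CharZero K] {V : Type*} [AddCommGroup V] [Module K V]
variable {E : Fin n → Fin n → Module.End K V} {B : Finset (Fin n →₀ ℕ)}
  {π : (Fin n →₀ ℕ) → Module.End K V}

/-- Casimir -/
def casi (E : Fin n → Fin n → Module.End K V) : Module.End K V := ∑ i, ∑ j, E i j * E j i

lemma casi_eq (hE : IsGl E) : casi E = ∑ i, E i i * E i i +
    ∑ i, ∑ j ∈ Finset.Ioi i, (E i i - E j j + (2 : K) • (E j i * E i j)) := by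
  have h2 : ∀ i j, i < j → E i i - E j j + (2 : K) • (E j i * E i j) = E i j * E j i + E j i * E i j := by
    intro i j hij
    have := hE i j j i
    simp at this
    rw [two_smul, ← this]; abel
  have h3 : ∑ i, ∑ j ∈ Finset.Ioi i, (E i i - E j j + (2 : K) • (E j i * E i j)) =
      ∑ i, ∑ j, ((if i < j then E i j * E j i else 0) + (if i < j then E j i * E i j else 0)) := by
    refine Finset.sum_congr rfl fun i _ => ?_
    rw [← Finset.sum_filter_add_sum_filter_not Finset.univ (fun j => i < j),
      Finset.sum_eq_zero (s := Finset.filter (fun j => ¬ i < j) Finset.univ)]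
    · rw [add_zero]
      refine Finset.sum_congr (by ext; simp) fun j hj => ?_
      simp at hj
      rw [h2 i j hj]
      simp [hj]
    · intro j hj; simp at hj; simp [hj.not_gt]
  rw [h3]
  simp_rw [Finset.sum_add_distrib]
  rw [Finset.sum_comm (f := fun i j => if i < j then E j i * E i j else 0)]
  rw [← Finset.sum_add_distrib, ← Finset.sum_add_distrib]
  unfold casi
  refine Finset.sum_congr rfl fun i _ => ?_
  have : E i i * E i i = ∑ j, if i = j then E i j * E j i else 0 := by simp
  rw [this, ← Finset.sum_add_distrib, ← Finset.sum_add_distrib]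
  refine Finset.sum_congr rfl fun j _ => ?_
  rcases lt_trichotomy i j with h | h | h
  · simp [h, h.not_gt, h.ne]
  · simp [h]
  · simp [h, h.not_gt, h.ne']

lemma casi_comm (hE : IsGl E) (k l : Fin n) : casi E * E k l = E k l * casi E := by
  symm
  rw [← sub_eq_zero]
  unfold casi
  simp_rw [Finset.mul_sum, Finset.sum_mul]
  have h1 : ∀ i j, E k l * (E i j * E j i) - E i j * E j i * E k l =
      (((if l = i then E k j else 0) - (if j = k then E i l else 0)) * E j i) +
       E i j * ((if l = j then E k i else 0) - (if i = k then E j l else 0)) := by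
    intro i j
    rw [← hE k l i j, ← hE k l j i]; noncomm_ring
  simp_rw [← Finset.sum_sub_distrib]
  simp_rw [h1, mul_sub, sub_mul, Finset.sum_add_distrib, Finset.sum_sub_distrib, ite_mul, mul_ite,
    zero_mul, mul_zero]
  rw [Finset.sum_comm (f := fun i j => if l = i then E k j * E j i else 0)]
  rw [Finset.sum_comm (f := fun i j => if i = k then E i j * E j l else 0)]
  simp

variable [FiniteDimensional K V]

/-- trace character -/
noncomputable def ch (B : Finset (Fin n →₀ ℕ)) (π : (Fin n →₀ ℕ) → Module.End K V)
    (P : Module.End K V) : MvPolynomial (Fin n) K :=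
  ∑ m ∈ B, monomial m (LinearMap.trace K V (P * π m))

lemma IsProjs.coeff_ch (h : IsProjs E B π) (P : Module.End K V) (m : Fin n →₀ ℕ) :
    (ch B π P).coeff m = LinearMap.trace K V (P * π m) := by
  unfold ch
  rw [coeff_sum]
  simp_rw [coeff_monomial]
  rw [Finset.sum_ite_eq']
  split_ifs with hm
  · rfl
  · rw [h.out m hm, mul_zero, map_zero]

lemma ch_add (P Q : Module.End K V) : ch B π (P + Q) = ch B π P + ch B π Q := by
  simp [ch, add_mul, Finset.sum_add_distrib]

lemma ch_sub (P Q : Module.End K V) : ch B π (P - Q) = ch B π P - ch B π Q := by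
  simp [ch, sub_mul, Finset.sum_sub_distrib]

lemma ch_smul (c : K) (P : Module.End K V) : ch B π (c • P) = C c * ch B π P := by
  simp [ch, Finset.mul_sum, C_mul_monomial]

lemma ch_sum {ι : Type*} (s : Finset ι) (f : ι → Module.End K V) :
    ch B π (∑ i ∈ s, f i) = ∑ i ∈ s, ch B π (f i) := by
  induction s using Finset.induction_on with
  | empty => simp [ch]
  | insert a s ha ih => rw [Finset.sum_insert ha, ch_add, ih, Finset.sum_insert ha]

lemma IsProjs.th_ch (h : IsProjs E B π) (P : Module.End K V) (i : Fin n) :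
    th i (ch B π P) = ch B π (P * E i i) := by
  ext m
  rw [coeff_th, h.coeff_ch, h.coeff_ch, mul_assoc, h.left, mul_smul_comm, map_smul, smul_eq_mul]

lemma IsProjs.comm (h : IsProjs E B π) (P : Module.End K V) (hP : ∀ i, P * E i i = E i i * P)
    (m : Fin n →₀ ℕ) : P * π m = π m * P := by
  have h1 : ∀ m m', m ≠ m' → π m' * P * π m = 0 := by
    intro m m' hm
    ext v
    refine h.apply_wt (v := P (π m v)) (c := fun i => (m i : K)) ?_ m' ?_
    · intro i
      rw [← Module.End.mul_apply, ← hP, Module.End.mul_apply, h.wt, map_smul]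
    · by_contra! hc
      exact hm (Finsupp.ext fun i => by exact_mod_cast hc i)
  by_cases hm : m ∈ B
  · have e1 : P * π m = π m * P * π m := by
      conv_lhs => rw [← one_mul (P * π m), ← h.sum, Finset.sum_mul]
      rw [Finset.sum_eq_single m (fun b _ hb => by rw [← mul_assoc, h1 m b hb.symm])
        (fun h => (h hm).elim), mul_assoc]
    have e2 : π m * P = π m * P * π m := by
      conv_lhs => rw [← mul_one (π m * P), ← h.sum, Finset.mul_sum]
      rw [Finset.sum_eq_single m (fun b _ hb => by rw [h1 b m hb]) (fun h => (h hm).elim)]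
    rw [e1, ← e2]
  · rw [h.out m hm, mul_zero, zero_mul]

lemma IsProjs.swap (h : IsProjs E B π) (hE : IsGl E) (P : Module.End K V)
    (hP : ∀ i j, P * E i j = E i j * P) (i j : Fin n) :
    X i * ch B π (P * (E j i * E i j)) = X j * ch B π (P * (E i j * E j i)) := by
  have hmon : ∀ (i : Fin n) (m : Fin n →₀ ℕ) (c : K),
      X i * monomial m c = monomial (m + Finsupp.single i 1) c := by
    intro i m c
    rw [X, monomial_mul, one_mul, add_comm]
  have hl : X i * ch B π (P * (E j i * E i j)) = ∑ m ∈ B, ∑ m' ∈ B,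
      monomial (m + Finsupp.single i 1) (LinearMap.trace K V (P * E j i * (π m' * E i j * π m))) := by
    unfold ch
    rw [Finset.mul_sum]
    refine Finset.sum_congr rfl fun m _ => ?_
    rw [hmon, ← map_sum, ← map_sum, ← Finset.mul_sum, ← Finset.sum_mul, ← Finset.sum_mul, h.sum,
      one_mul]
    simp only [mul_assoc]
  have hr : X j * ch B π (P * (E i j * E j i)) = ∑ m' ∈ B, ∑ m ∈ B,
      monomial (m' + Finsupp.single j 1) (LinearMap.trace K V (P * E i j * π m * E j i * π m')) := by
    unfold ch
    rw [Finset.mul_sum]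
    refine Finset.sum_congr rfl fun m _ => ?_
    rw [hmon, ← map_sum, ← map_sum, ← Finset.sum_mul, ← Finset.sum_mul, ← Finset.mul_sum, h.sum,
      mul_one]
    simp only [mul_assoc]
  rw [hl, hr, Finset.sum_comm]
  refine Finset.sum_congr rfl fun m' _ => Finset.sum_congr rfl fun m _ => ?_
  have ht : LinearMap.trace K V (P * E i j * π m * E j i * π m') =
      LinearMap.trace K V (P * E j i * (π m' * E i j * π m)) := by
    have e1 : P * E i j * π m * E j i * π m' = (E i j * π m) * (P * E j i * π m') := by
      rw [hP i j, mul_assoc (E i j) P, h.comm P (fun i => hP i i)]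
      simp only [mul_assoc]
    rw [e1, LinearMap.trace_mul_comm]
    simp only [mul_assoc]
  rw [ht]
  by_cases hm : m + Finsupp.single i 1 = m' + Finsupp.single j 1
  · rw [hm]
  · rw [h.shift hE i j hm]; simp

lemma IsProjs.alt_casi (h : IsProjs E B π) (hE : IsGl E) (P : Module.End K V)
    (hP : ∀ i j, P * E i j = E i j * P) (κ : Fin n → ℕ) :
    alt (fun i => (κ i : ℤ)) (cf (ch B π (P * casi E))) =
      (cas κ : K) * alt (fun i => (κ i : ℤ)) (cf (ch B π P)) := by
  refine alt_cas _ _ (fun i j => ch B π (P * (E j i * E i j))) ?_ ?_ κ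
  · intro i j hij
    rw [sub_mul, h.swap hE P hP i j, ← mul_sub, ← ch_sub, h.th_ch, h.th_ch, ← ch_sub]
    congr 2
    rw [← mul_sub, ← mul_sub]
    congr 1
    have := hE i j j i
    simpa using this
  · rw [casi_eq hE, mul_add, ch_add, Finset.mul_sum, ch_sum, Finset.mul_sum, ch_sum]
    congr 1
    · refine Finset.sum_congr rfl fun i _ => ?_
      rw [h.th_ch, h.th_ch, mul_assoc]
    · refine Finset.sum_congr rfl fun i _ => ?_
      rw [Finset.mul_sum, ch_sum]
      refine Finset.sum_congr rfl fun j _ => ?_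
      rw [h.th_ch, h.th_ch, mul_add, mul_sub, ch_add, ch_sub, mul_smul_comm, ch_smul,
        show (C (2 : K) : MvPolynomial (Fin n) K) = 2 from map_ofNat C 2]

end HW
end Agu

namespace Agu
open MvPolynomial

section HW
variable {n : ℕ} {K : Type*} [Field K] [CharZero K] {V : Type*} [AddCommGroup V] [Module K V]

/-- weight space -/
def WS (E : Fin n → Fin n → Module.End K V) (a : Fin n → ℤ) : Submodule K V where
  carrier := {v | ∀ i, E i i v = ((a i : ℤ) : K) • v}
  add_mem' := fun hu hv i => by rw [map_add, hu i, hv i, smul_add]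
  zero_mem' := fun i => by simp
  smul_mem' := fun c v hv i => by rw [map_smul, hv i, smul_comm]

/-- highest weight space -/
def HW (E : Fin n → Fin n → Module.End K V) (a : Fin n → ℤ) : Submodule K V where
  carrier := {v | (∀ i, E i i v = ((a i : ℤ) : K) • v) ∧ ∀ i j, i < j → E i j v = 0}
  add_mem' := fun hu hv => ⟨fun i => by rw [map_add, hu.1 i, hv.1 i, smul_add],
    fun i j h => by rw [map_add, hu.2 i j h, hv.2 i j h, add_zero]⟩
  zero_mem' := ⟨fun i => by simp, fun i j _ => by simp⟩
  smul_mem' := fun c v hv => ⟨fun i => by rw [map_smul, hv.1 i, smul_comm],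
    fun i j h => by rw [map_smul, hv.2 i j h, smul_zero]⟩

variable {E : Fin n → Fin n → Module.End K V} {B : Finset (Fin n →₀ ℕ)}
  {π : (Fin n →₀ ℕ) → Module.End K V}

lemma cas_eq (κ : Fin n → ℕ) : cas κ = ∑ i, (κ i : ℤ) ^ 2 +
    ∑ i, ∑ j ∈ Finset.Ioi i, ((κ i : ℤ) - κ j) := by
  have h1 := sum_lt_pairs (fun i => (κ i : ℤ))
  have h2 : ∑ i : Fin n, ∑ j ∈ Finset.Ioi i, (κ j : ℤ) = ∑ j : Fin n, (j : ℤ) * κ j := by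
    rw [Finset.sum_comm' (t' := Finset.univ) (s' := fun j => Finset.Iio j) (by simp)]
    simp
  have h3 : ∑ i, ∑ j ∈ Finset.Ioi i, ((κ i : ℤ) - κ j) =
      ∑ i, ∑ j ∈ Finset.Ioi i, ((κ i : ℤ) + κ j) - 2 * ∑ i : Fin n, ∑ j ∈ Finset.Ioi i, (κ j : ℤ) := by
    rw [Finset.mul_sum, ← Finset.sum_sub_distrib]
    refine Finset.sum_congr rfl fun i _ => ?_
    rw [Finset.mul_sum, ← Finset.sum_sub_distrib]
    refine Finset.sum_congr rfl fun j _ => ?_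
    ring
  rw [h3, h2, h1, Finset.mul_sum, Finset.mul_sum, ← Finset.sum_sub_distrib, ← Finset.sum_add_distrib]
  unfold cas
  refine Finset.sum_congr rfl fun i _ => ?_
  ring

lemma casi_hw (hE : IsGl E) {v : V} {m : Fin n → ℕ} (hv : ∀ i, E i i v = (m i : K) • v)
    (hu : ∀ i j, i < j → E i j v = 0) : casi E v = (cas m : K) • v := by
  rw [casi_eq hE, cas_eq]
  push_cast
  simp only [LinearMap.add_apply, LinearMap.sum_apply, Module.End.mul_apply, hv, map_smul, add_smul,
    Finset.sum_smul]
  congr 1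
  · refine Finset.sum_congr rfl fun i _ => ?_
    rw [smul_smul, pow_two]
  · refine Finset.sum_congr rfl fun i _ => Finset.sum_congr rfl fun j hj => ?_
    simp [hu i j (by simpa using hj), hv, sub_smul]

lemma dominant [FiniteDimensional K V] (hE : IsGl E) {v : V} (hv0 : v ≠ 0) {m : Fin n → ℕ}
    (hv : ∀ i, E i i v = (m i : K) • v)
    (hu : ∀ i j, i < j → E i j v = 0) : Antitone m := by
  intro i j hij
  rcases hij.eq_or_lt with rfl | hij
  · exact le_rfl
  have hs : (E i i - E j j) v = ((m i : K) - m j) • v := by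
    simp [hv, sub_smul]
  by_cases h0 : E i i - E j j = 0
  · rw [h0] at hs
    have : (m i : K) - m j = 0 := by
      by_contra hc
      exact hv0 ((smul_eq_zero.1 hs.symm).resolve_left hc)
    have : (m i : K) = m j := sub_eq_zero.1 this
    have : m i = m j := by exact_mod_cast this
    omega
  letI : LieRing (Module.End K V) := LieRing.ofAssociativeRing
  letI : LieRingModule (Module.End K V) V := LieRingModule.ofAssociativeModule
  haveI : LieModule K (Module.End K V) V := LieModule.ofAssociativeModule
  have t : IsSl2Triple (E i i - E j j) (E i j) (E j i) := by
    have hne := hij.ne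
    refine ⟨h0, ?_, ?_, ?_⟩
    · rw [Ring.lie_def, hE]; simp
    · rw [sub_lie, Ring.lie_def, Ring.lie_def, hE, hE]; simp [hne, hne.symm, two_smul]
    · rw [sub_lie, Ring.lie_def, Ring.lie_def, hE, hE]; simp [hne, hne.symm, two_smul, sub_eq_add_neg]
  have P : t.HasPrimitiveVectorWith v ((m i : K) - m j) := ⟨hv0, hs, hu i j hij⟩
  obtain ⟨r, hr⟩ := P.exists_nat
  have : (m i : K) = ((m j + r : ℕ) : K) := by push_cast; linear_combination hr
  have : m i = m j + r := by exact_mod_cast this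
  omega

lemma aeval_comm (Cc A : Module.End K V) (h : Cc * A = A * Cc) (q : Polynomial K) :
    Polynomial.aeval Cc q * A = A * Polynomial.aeval Cc q := by
  induction q using Polynomial.induction_on' with
  | add p q hp hq => rw [map_add, add_mul, hp, hq, mul_add]
  | monomial k c =>
    rw [Polynomial.aeval_monomial, mul_assoc, (Commute.pow_left h k).eq, ← mul_assoc, ← mul_assoc,
      Algebra.commutes]

lemma exists_fP [FiniteDimensional K V] (Cc : Module.End K V) (c : K) :
    ∃ (p q : Polynomial K) (k : ℕ), (Cc - c • 1) ^ k * Polynomial.aeval Cc q = 0 ∧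
      (1 : Module.End K V) = Polynomial.aeval Cc p * (Cc - c • 1) + Polynomial.aeval Cc q := by
  have hmin : minpoly K Cc ≠ 0 := minpoly.ne_zero (Algebra.IsIntegral.isIntegral Cc)
  obtain ⟨q, hq, hnd⟩ := Polynomial.exists_eq_pow_rootMultiplicity_mul_and_not_dvd _ hmin c
  set k := (minpoly K Cc).rootMultiplicity c
  have hco : IsCoprime ((Polynomial.X - Polynomial.C c) ^ (k + 1)) q :=
    IsCoprime.pow_left ((Polynomial.irreducible_X_sub_C c).coprime_iff_not_dvd.2 hnd)
  obtain ⟨a, b, hab⟩ := hco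
  have hX : Polynomial.aeval Cc (Polynomial.X - Polynomial.C c) = Cc - c • 1 := by
    simp [Algebra.algebraMap_eq_smul_one]
  refine ⟨a * (Polynomial.X - Polynomial.C c) ^ k, b * q, k, ?_, ?_⟩
  · rw [← hX, ← map_pow, ← map_mul]
    have : (Polynomial.X - Polynomial.C c) ^ k * (b * q) = b * minpoly K Cc := by
      rw [hq]; ring
    rw [this, map_mul, minpoly.aeval, mul_zero]
  · have h := congr_arg (Polynomial.aeval Cc) hab
    rw [map_one] at h
    refine h.symm.trans ?_
    rw [← hX, ← map_mul, ← map_add]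
    have e : a * (Polynomial.X - Polynomial.C c) ^ (k + 1) + b * q =
      a * (Polynomial.X - Polynomial.C c) ^ k * (Polynomial.X - Polynomial.C c) + b * q := by ring
    rw [e]

variable [FiniteDimensional K V]

lemma IsProjs.claim (h : IsProjs E B π) (hE : IsGl E) (κ : Fin n → ℕ) (hκ : Antitone κ)
    (f : Module.End K V) (hf : ∀ i j, f * E i j = E i j * f) (k : ℕ)
    (hk : (casi E - (cas κ : K) • 1) ^ k * f = 0) (m : Fin n →₀ ℕ)
    (hm : Dom (fun i => (m i : ℤ) - κ i)) (hne : (fun i => (m i : ℤ) - κ i) ≠ 0) : f * π m = 0 := by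
  by_contra hcon
  let S := B.filter (fun m => Dom (fun i => (m i : ℤ) - κ i) ∧ (fun i => (m i : ℤ) - κ i) ≠ 0 ∧
    f * π m ≠ 0)
  let ht : (Fin n →₀ ℕ) → ℤ := fun m => ∑ i, (m i : ℤ) * (-(i : ℤ))
  have inB : ∀ m, f * π m ≠ 0 → m ∈ B := fun m hm => by
    by_contra hc; exact hm (by rw [h.out m hc, mul_zero])
  obtain ⟨m', hm'S, hmax⟩ := S.exists_max_image ht ⟨m, by simp [S, inB m hcon, hm, hne, hcon]⟩
  simp only [S, Finset.mem_filter] at hm'S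
  obtain ⟨hB', hD, hne', hfm⟩ := hm'S
  obtain ⟨v, hv⟩ : ∃ v, f (π m' v) ≠ 0 := by
    by_contra! hc; exact hfm (LinearMap.ext hc)
  have hcf : ∀ i j u, f (E i j u) = E i j (f u) := fun i j u => by
    rw [← Module.End.mul_apply, hf]; rfl
  set w := f (π m' v) with hw
  have hww : ∀ i, E i i w = (m' i : K) • w := fun i => by
    rw [hw, ← hcf, h.wt, map_smul]
  have hyanti : StrictAnti (fun i : Fin n => -(i : ℤ)) := fun a b hab => by
    simp; exact hab
  have hu : ∀ i j, i < j → E i j w = 0 := by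
    intro i j hij
    by_contra hz
    rw [hw, ← hcf] at hz
    set u := E i j (π m' v) with hudef
    have hwu := gl_wt hE (fun k => h.wt m' v k) i j
    have hu0 : u ≠ 0 := fun h0 => hz (by rw [h0, map_zero])
    have hj1 : 1 ≤ m' j := by
      by_contra hc
      have hc0 : m' j = 0 := by omega
      refine hu0 (h.eq_zero hwu fun m2 => ⟨j, ?_⟩)
      simp [hij.ne', hc0]
      intro hh
      have : ((m2 j + 1 : ℕ) : K) = 0 := by push_cast; rw [← hh]; ring
      norm_cast at this
    let m2 : Fin n →₀ ℕ := m' + Finsupp.single i 1 - Finsupp.single j 1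
    have hm2 : ∀ t, (m2 t : ℤ) = m' t + ((if t = i then 1 else 0) - (if t = j then 1 else 0)) := by
      intro t
      simp only [m2, Finsupp.tsub_apply, Finsupp.add_apply, Finsupp.single_apply, eq_comm (b := t)]
      have := hij.ne
      split_ifs with h1 h2 h2
      · subst h1; exact (this h2).elim
      · simp
      · subst h2; simp; omega
      · simp
    have hroot : (fun t => (m2 t : ℤ) - κ t) = (fun t => (m' t : ℤ) - κ t) +
        (Pi.single i 1 - Pi.single j 1) := by
      funext t
      simp only [hm2, Pi.add_apply, Pi.sub_apply, Pi.single_apply]; ring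
    have hrp := (Dom.root hij).pos (by
      intro h0; have := congr_fun h0 i; simp [hij.ne] at this) hyanti
    have hself : π m2 u = u := h.apply_self (fun t => by
      rw [hwu t]
      congr 1
      have := congr_arg (Int.cast : ℤ → K) (hm2 t)
      push_cast at this
      rw [this])
    have hf2 : f * π m2 ≠ 0 := fun h0 => hz (by
      rw [← hself, ← Module.End.mul_apply, h0]; rfl)
    have hS2 : m2 ∈ S := by
      simp only [S, Finset.mem_filter]
      refine ⟨inB _ hf2, ?_, ?_, hf2⟩
      · rw [hroot]; exact hD.add (Dom.root hij)
      · rw [hroot]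
        intro h0
        have hp := hD.pos hne' hyanti
        have h00 : ∑ t, ((fun t => (m' t : ℤ) - κ t) + (Pi.single i 1 - Pi.single j 1) : Fin n → ℤ) t * (-(t : ℤ)) = 0 := by
          rw [h0]; simp
        simp only [Pi.add_apply, add_mul, Finset.sum_add_distrib] at h00
        linarith
    have := hmax m2 hS2
    have h3 : ht m2 = ht m' + ∑ t, (Pi.single i 1 - Pi.single j 1 : Fin n → ℤ) t * (-(t : ℤ)) := by
      simp only [ht]
      rw [← Finset.sum_add_distrib]
      refine Finset.sum_congr rfl fun t _ => ?_
      rw [hm2]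
      simp only [Pi.sub_apply, Pi.single_apply]; ring
    linarith
  have hdom : Antitone m' := dominant hE hv hww hu
  have hcw := casi_hw hE hww hu
  have hpow : ∀ r : ℕ, ((casi E - (cas κ : K) • 1) ^ r) w = ((cas m' : K) - cas κ) ^ r • w := by
    intro r
    induction r with
    | zero => simp
    | succ r ih =>
      rw [pow_succ, Module.End.mul_apply, LinearMap.sub_apply, hcw, LinearMap.smul_apply,
        Module.End.one_apply, ← sub_smul, map_smul, ih, smul_smul, pow_succ']
  have h0 : ((cas m' : K) - cas κ) ^ k • w = 0 := by
    rw [← hpow, hw, ← Module.End.mul_apply, hk]; rfl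
  have h1 : (cas m' : K) - cas κ = 0 := by
    have := (smul_eq_zero.1 h0).resolve_right hv
    exact eq_zero_of_pow_eq_zero this
  have h2 : cas m' = cas κ := by exact_mod_cast sub_eq_zero.1 h1
  have h3 := hD.pos hne' (y := fun i => (m' i : ℤ) + κ i + (n - 1 - 2 * (i : ℤ))) (by
    intro a b hab
    have e1 := hdom hab.le
    have e2 := hκ hab.le
    have e3 : (a : ℕ) < b := hab
    show (m' b : ℤ) + κ b + (n - 1 - 2 * (b : ℤ)) < (m' a : ℤ) + κ a + (n - 1 - 2 * (a : ℤ))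
    omega)
  have h4 : cas m' - cas κ = ∑ i, ((m' i : ℤ) - κ i) * ((m' i : ℤ) + κ i + (n - 1 - 2 * (i : ℤ))) := by
    unfold cas
    rw [← Finset.sum_sub_distrib]
    refine Finset.sum_congr rfl fun i _ => ?_
    ring
  omega

theorem hw_finrank (E : Fin n → Fin n → Module.End K V) (hE : IsGl E) (M : ℕ) (hM : IsDiag E M)
    (κ : Fin n → ℕ) (hκ : Antitone κ) :
    (Module.finrank K (HW E (fun i => (κ i : ℤ))) : ℤ) =
      alt (fun i => (κ i : ℤ)) (fun a => (Module.finrank K (WS E a) : ℤ)) := by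
  obtain ⟨B, π, h⟩ := exists_projs E hE M hM
  have hdim : ∀ a, cf (ch B π 1) a = (Module.finrank K (WS E a) : K) := by
    intro a
    unfold cf
    split_ifs with ha
    · rw [h.coeff_ch, one_mul]
      apply LinearMap.IsProj.trace
      set m : Fin n →₀ ℕ := Finsupp.equivFunOnFinite.symm fun i => (a i).toNat
      have hm : ∀ i, ((a i : ℤ) : K) = m i := by
        intro i
        conv_lhs => rw [← Int.toNat_of_nonneg (ha i)]
        rw [Int.cast_natCast]; rfl
      refine ⟨fun v i => ?_, fun v hv => h.apply_self fun i => ?_⟩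
      · rw [h.wt, hm]
      · rw [hv i, hm]
    · push Not at ha
      obtain ⟨i, hi⟩ := ha
      have : WS E a = ⊥ := by
        rw [eq_bot_iff]
        intro v hv
        refine h.eq_zero (v := v) hv fun m => ⟨i, ?_⟩
        intro hc
        have : a i = m i := by exact_mod_cast hc
        omega
      rw [this]; simp
  obtain ⟨p, q, k, hk, hone⟩ := exists_fP (casi E) (cas κ : K)
  set f := Polynomial.aeval (casi E) q with hfdef
  set P := Polynomial.aeval (casi E) p with hPdef
  have hf : ∀ i j, f * E i j = E i j * f := fun i j => aeval_comm _ _ (casi_comm hE i j) _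
  have hP : ∀ i j, P * E i j = E i j * P := fun i j => aeval_comm _ _ (casi_comm hE i j) _
  have cfadd : ∀ (g g' : MvPolynomial (Fin n) K) a, cf (g + g') a = cf g a + cf g' a := by
    intro g g' a; unfold cf; split_ifs <;> simp
  have altadd : ∀ (g g' : MvPolynomial (Fin n) K), alt (fun i => (κ i : ℤ)) (cf (g + g')) =
      alt (fun i => (κ i : ℤ)) (cf g) + alt (fun i => (κ i : ℤ)) (cf g') := by
    intro g g'
    simp [alt, cfadd, mul_add, Finset.sum_add_distrib]
  have altC : ∀ (c : K) (g : MvPolynomial (Fin n) K), alt (fun i => (κ i : ℤ)) (cf (C c * g)) =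
      c * alt (fun i => (κ i : ℤ)) (cf g) := by
    intro c g
    have : ∀ a, cf (C c * g) a = c * cf g a := by
      intro a; unfold cf; split_ifs <;> simp
    simp only [alt, this, Finset.mul_sum]
    refine Finset.sum_congr rfl fun _ _ => ?_
    ring
  have e1 : alt (fun i => (κ i : ℤ)) (cf (ch B π 1)) = alt (fun i => (κ i : ℤ)) (cf (ch B π f)) := by
    have : ch B π 1 = ch B π (P * casi E) + C (-(cas κ : K)) * ch B π P + ch B π f := by
      rw [hone, ← ch_smul, ← ch_add, ← ch_add]
      congr 2
      rw [mul_sub, mul_smul_comm, mul_one, neg_smul, sub_eq_add_neg]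
    rw [this, altadd, altadd, altC, h.alt_casi hE P hP]
    ring
  let κ' : Fin n →₀ ℕ := Finsupp.equivFunOnFinite.symm κ
  have e2 : alt (fun i => (κ i : ℤ)) (cf (ch B π f)) = LinearMap.trace K V (f * π κ') := by
    unfold alt
    rw [Finset.sum_eq_single 1]
    · have hs : shf (fun i => (κ i : ℤ)) 1 = fun i => (κ i : ℤ) := by funext i; simp [shf]
      rw [hs, Equiv.Perm.sign_one]
      unfold cf
      rw [if_pos (by intro i; simp), h.coeff_ch]
      simp [κ']
    · intro σ _ hσ
      unfold cf
      split_ifs with ha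
      · have hsh : ∀ i, (((Finsupp.equivFunOnFinite.symm fun i => (shf (fun i => (κ i : ℤ)) σ i).toNat : Fin n →₀ ℕ) i : ℕ) : ℤ) - κ i = (σ i : ℕ) - (i : ℤ) := by
          intro i
          rw [Finsupp.equivFunOnFinite_symm_apply_apply, Int.toNat_of_nonneg (ha i)]
          simp [shf]; ring
        rw [h.coeff_ch, h.claim hE κ hκ f hf k hk, map_zero, mul_zero]
        · simp_rw [hsh]; exact Dom.perm σ
        · simp_rw [hsh]
          intro h0
          apply hσ
          ext i
          have := congr_fun h0 i
          simp at this
          simp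
          omega
      · simp
    · simp
  have e3 : LinearMap.trace K V (f * π κ') = (Module.finrank K (HW E (fun i => (κ i : ℤ))) : K) := by
    apply LinearMap.IsProj.trace
    have hκ' : ∀ i, κ' i = κ i := fun i => rfl
    refine ⟨fun v => ⟨fun i => ?_, fun i j hij => ?_⟩, fun v hv => ?_⟩
    · rw [Module.End.mul_apply, ← Module.End.mul_apply, ← hf, Module.End.mul_apply, h.wt, map_smul,
        Int.cast_natCast]; rfl
    · rw [Module.End.mul_apply, ← Module.End.mul_apply, ← hf, Module.End.mul_apply]
      set u := E i j (π κ' v) with hudef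
      have hwu := gl_wt hE (fun k => h.wt κ' v k) i j
      by_cases hj0 : κ j = 0
      · have : u = 0 := by
          refine h.eq_zero hwu fun m2 => ⟨j, ?_⟩
          simp [hij.ne', hκ', hj0]
          intro hh
          have : ((m2 j + 1 : ℕ) : K) = 0 := by push_cast; rw [← hh]; ring
          norm_cast at this
        rw [this, map_zero]
      let m2 : Fin n →₀ ℕ := κ' + Finsupp.single i 1 - Finsupp.single j 1
      have hm2 : ∀ t, (m2 t : ℤ) = κ t + ((if t = i then 1 else 0) - (if t = j then 1 else 0)) := by
        intro t
        simp only [m2, Finsupp.tsub_apply, Finsupp.add_apply, Finsupp.single_apply, eq_comm (b := t), hκ']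
        have := hij.ne
        split_ifs with h1 h2 h2
        · subst h1; exact (this h2).elim
        · simp
        · subst h2; simp; omega
        · simp
      have hself : π m2 u = u := h.apply_self (fun t => by
        rw [hwu t]
        congr 1
        have := congr_arg (Int.cast : ℤ → K) (hm2 t)
        push_cast at this
        rw [this, hκ'])
      have hroot : (fun t => (m2 t : ℤ) - κ t) = (Pi.single i 1 - Pi.single j 1 : Fin n → ℤ) := by
        funext t
        simp only [hm2, Pi.sub_apply, Pi.single_apply]; ring
      have := h.claim hE κ hκ f hf k hk m2 (by rw [hroot]; exact Dom.root hij) (by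
        rw [hroot]; intro h0; have := congr_fun h0 i; simp [hij.ne] at this)
      rw [← hself, ← Module.End.mul_apply, this]; rfl
    · have h1 : π κ' v = v := h.apply_self (fun i => by rw [hv.1 i, Int.cast_natCast]; rfl)
      have h2 := casi_hw hE (m := κ) (fun i => by rw [hv.1 i, Int.cast_natCast]) hv.2
      rw [Module.End.mul_apply, h1]
      have h3 := LinearMap.congr_fun hone v
      rw [LinearMap.add_apply, Module.End.mul_apply, LinearMap.sub_apply, h2] at h3
      simpa using h3.symm
  have e4 : ((Module.finrank K (HW E (fun i => (κ i : ℤ))) : ℤ) : K) =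
      ((alt (fun i => (κ i : ℤ)) (fun a => (Module.finrank K (WS E a) : ℤ)) : ℤ) : K) := by
    rw [Int.cast_natCast, ← e3, ← e2, ← e1]
    simp [alt, hdim]
  exact_mod_cast e4

end HW
end Agu

namespace Agu
open MvPolynomial

section HWsub
variable {n : ℕ} {K : Type*} [Field K] [CharZero K] {V : Type*} [AddCommGroup V] [Module K V]

lemma finrank_comap_inf (Y W : Submodule K V) :
    Module.finrank K (W.comap Y.subtype) = Module.finrank K (Y ⊓ W : Submodule K V) := by
  have := Submodule.finrank_map_subtype_eq Y (W.comap Y.subtype)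
  rw [← this, Submodule.map_comap_subtype]

theorem hw_sub (E : Fin n → Fin n → Module.End K V) (hE : IsGl E) (M : ℕ)
    (Y : Submodule K V) [FiniteDimensional K Y] (hY : ∀ i j, ∀ v ∈ Y, E i j v ∈ Y)
    (hM : ∀ i, ∀ v ∈ Y, Polynomial.aeval (E i i)
      (∏ k ∈ Finset.range M, (Polynomial.X - Polynomial.C (k : K))) v = 0)
    (κ : Fin n → ℕ) (hκ : Antitone κ) :
    (Module.finrank K (Y ⊓ HW E (fun i => (κ i : ℤ)) : Submodule K V) : ℤ) =
      alt (fun i => (κ i : ℤ)) (fun a => (Module.finrank K (Y ⊓ WS E a : Submodule K V) : ℤ)) := by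
  let F : Fin n → Fin n → Module.End K Y := fun i j => (E i j).restrict (hY i j)
  have hFv : ∀ i j (v : Y), ((F i j v : Y) : V) = E i j v := fun i j v => rfl
  have hF : IsGl F := by
    intro i j k l
    ext v
    have := LinearMap.congr_fun (hE i j k l) v
    simp only [LinearMap.sub_apply, Module.End.mul_apply, Submodule.coe_sub, hFv] at this ⊢
    rw [this]
    congr 1 <;> split_ifs <;> rfl
  have hag : ∀ (i : Fin n) (q : Polynomial K) (v : Y),
      ((Polynomial.aeval (F i i) q v : Y) : V) = Polynomial.aeval (E i i) q v := by
    intro i q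
    induction q using Polynomial.induction_on' with
    | add p q hp hq => intro v; simp [hp, hq]
    | monomial k c =>
      intro v
      simp only [Polynomial.aeval_monomial, Module.End.mul_apply, Module.algebraMap_end_apply,
        Submodule.coe_smul]
      congr 1
      clear hM
      induction k generalizing v with
      | zero => rfl
      | succ k ih => rw [pow_succ, pow_succ, Module.End.mul_apply, Module.End.mul_apply, ih, hFv]
  have hD : IsDiag F M := by
    intro i
    ext v
    rw [hag, hM i v v.2]; rfl
  have := hw_finrank F hF M hD κ hκ
  have e1 : HW F (fun i => (κ i : ℤ)) = (HW E (fun i => (κ i : ℤ))).comap Y.subtype := by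
    ext v
    constructor
    · rintro ⟨h1, h2⟩
      exact ⟨fun i => by rw [Submodule.subtype_apply, ← hFv, h1]; rfl,
        fun i j h => by rw [Submodule.subtype_apply, ← hFv, h2 i j h]; rfl⟩
    · rintro ⟨h1, h2⟩
      exact ⟨fun i => Subtype.ext (h1 i), fun i j h => Subtype.ext (h2 i j h)⟩
  have e2 : ∀ a, WS F a = (WS E a).comap Y.subtype := by
    intro a
    ext v
    constructor
    · intro h1 i
      rw [Submodule.subtype_apply, ← hFv, h1]; rfl
    · intro h1 i
      exact Subtype.ext (h1 i)
  rw [e1, finrank_comap_inf] at this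
  rw [this]
  unfold alt
  refine Finset.sum_congr rfl fun σ _ => ?_
  beta_reduce
  rw [e2, finrank_comap_inf]

end HWsub

section Lin
variable {σ : Type*} [Fintype σ] {K : Type*} [Field K]

/-- the linear vector field attached to a matrix: `X_t ↦ ∑ s', a s' t X_{s'}`. -/
noncomputable def D (a : Matrix σ σ K) : Derivation K (MvPolynomial σ K) (MvPolynomial σ K) :=
  ∑ s, ∑ s', a s' s • ((X s' : MvPolynomial σ K) • pderiv s)

lemma D_apply (a : Matrix σ σ K) (p : MvPolynomial σ K) :
    D a p = ∑ s, ∑ s', C (a s' s) * (X s' * pderiv s p) := by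
  unfold D
  have h : ∀ (t : Finset σ) (f : σ → Derivation K (MvPolynomial σ K) (MvPolynomial σ K)),
      (∑ i ∈ t, f i) p = ∑ i ∈ t, f i p := by
    intro t f
    induction t using Finset.induction_on with
    | empty => simp
    | insert a s ha ih => rw [Finset.sum_insert ha, Finset.sum_insert ha, Derivation.add_apply, ih]
  rw [h]
  refine Finset.sum_congr rfl fun s _ => ?_
  rw [h]
  refine Finset.sum_congr rfl fun s' _ => ?_
  rw [Derivation.smul_apply, Derivation.smul_apply, smul_eq_C_mul, smul_eq_mul]

lemma D_X (a : Matrix σ σ K) (t : σ) : D a (X t) = ∑ s', C (a s' t) * X s' := by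
  rw [D_apply, Finset.sum_eq_single t]
  · simp
  · intro b _ hb
    refine Finset.sum_eq_zero fun s' _ => ?_
    rw [pderiv_X_of_ne hb.symm]; simp
  · simp

lemma D_ext (d d' : Derivation K (MvPolynomial σ K) (MvPolynomial σ K))
    (h : ∀ i, d (X i) = d' (X i)) (p : MvPolynomial σ K) : d p = d' p := by
  rw [derivation_ext h]

lemma D_add (a b : Matrix σ σ K) (p : MvPolynomial σ K) : D (a + b) p = D a p + D b p := by
  simp only [D_apply, ← Finset.sum_add_distrib, Matrix.add_apply, map_add, add_mul]

lemma D_sub (a b : Matrix σ σ K) (p : MvPolynomial σ K) : D (a - b) p = D a p - D b p := by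
  simp only [D_apply, ← Finset.sum_sub_distrib, Matrix.sub_apply, map_sub, sub_mul]

lemma D_smul (c : K) (b : Matrix σ σ K) (p : MvPolynomial σ K) : D (c • b) p = c • D b p := by
  simp only [D_apply, Finset.smul_sum, Matrix.smul_apply, smul_eq_mul, map_mul, smul_eq_C_mul, mul_assoc]

lemma D_zero (p : MvPolynomial σ K) : D (0 : Matrix σ σ K) p = 0 := by
  simp [D_apply]

lemma D_mul_X (a b : Matrix σ σ K) (t : σ) : D a (D b (X t)) = ∑ s', C ((a * b) s' t) * X s' := by
  rw [D_X, map_sum]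
  simp_rw [Derivation.leibniz, smul_eq_mul, D_X, derivation_C, mul_zero, add_zero, Matrix.mul_apply,
    Finset.mul_sum, map_sum, Finset.sum_mul]
  rw [Finset.sum_comm]
  refine Finset.sum_congr rfl fun s _ => Finset.sum_congr rfl fun s' _ => ?_
  rw [map_mul]; ring

lemma D_comm (a b : Matrix σ σ K) (p : MvPolynomial σ K) :
    D a (D b p) - D b (D a p) = D (a * b - b * a) p := by
  rw [← Derivation.commutator_apply]
  refine D_ext _ _ (fun i => ?_) p
  rw [Derivation.commutator_apply, D_mul_X, D_mul_X, D_X, ← Finset.sum_sub_distrib]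
  refine Finset.sum_congr rfl fun s _ => ?_
  simp [sub_mul]

lemma D_diag_coeff [DecidableEq σ] (c : σ → K) (p : MvPolynomial σ K) (m : σ →₀ ℕ) :
    (D (Matrix.diagonal c) p).coeff m = (∑ s, c s * m s) * p.coeff m := by
  rw [D_apply, coeff_sum, Finset.sum_mul]
  refine Finset.sum_congr rfl fun s _ => ?_
  rw [Finset.sum_eq_single s]
  · rw [Matrix.diagonal_apply_eq, coeff_C_mul, mul_assoc]
    congr 1
    induction p using MvPolynomial.induction_on' with
    | monomial u a =>
      rw [X_mul_pderiv_monomial, coeff_smul, coeff_monomial, nsmul_eq_mul]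
      split_ifs with h
      · rw [h]
      · simp
    | add p q hp hq => rw [map_add, mul_add, coeff_add, hp, hq, coeff_add]; ring
  · intro b _ hb
    rw [Matrix.diagonal_apply_ne _ hb]; simp
  · simp

/-- `D a` preserves weighted homogeneous components -/
lemma D_wh {M : Type*} [AddCommMonoid M] (w : σ → M) (a : Matrix σ σ K)
    (ha : ∀ s' s, a s' s ≠ 0 → w s' = w s) (p : MvPolynomial σ K) (d : M)
    (hp : IsWeightedHomogeneous w p d) : IsWeightedHomogeneous w (D a p) d := by
  have key : ∀ (m : σ →₀ ℕ) (c : K), Finsupp.weight w m = d →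
      IsWeightedHomogeneous w (D a (monomial m c)) d := by
    intro m c hm
    rw [D_apply]
    refine (weightedHomogeneousSubmodule K w d).sum_mem fun s _ =>
      (weightedHomogeneousSubmodule K w d).sum_mem fun s' _ => ?_
    rw [mem_weightedHomogeneousSubmodule]
    by_cases h0 : a s' s = 0
    · rw [h0]; simp; exact isWeightedHomogeneous_zero _ _ _
    rw [pderiv_monomial, X, monomial_mul, C_mul_monomial, one_mul]
    by_cases hs : m s = 0
    · simp [hs]; exact isWeightedHomogeneous_zero _ _ _
    apply isWeightedHomogeneous_monomial
    rw [map_add, Finsupp.weight_single, one_smul, ha s' s h0]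
    rw [← hm]
    conv_rhs => rw [← tsub_add_cancel_of_le (show Finsupp.single s 1 ≤ m by
      simpa using Nat.one_le_iff_ne_zero.2 hs), map_add, Finsupp.weight_single, one_smul]
    rw [add_comm]
  have e : D a p = ∑ m ∈ p.support, D a (monomial m (p.coeff m)) := by
    conv_lhs => rw [p.as_sum]
    rw [map_sum]
  rw [e]
  refine (weightedHomogeneousSubmodule K w d).sum_mem fun m hm => ?_
  exact key m _ (hp (mem_support_iff.1 hm))

end Lin
end Agu

namespace Agu
open MvPolynomial

lemma wt1 {σ : Type*} (m : σ →₀ ℕ) : Finsupp.weight 1 m = m.degree := by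
  rw [Finsupp.degree_eq_weight_one]; rfl

/-- variables: `A × C`, `A × B × C`, `B × C` -/
abbrev Io (n : ℕ) : Type := (Fin n × Fin n) ⊕ (Fin n × Fin n × Fin n) ⊕ (Fin n × Fin n)

/-- the indices of a variable in the three blocks -/
def co {n : ℕ} : Io n → Fin 3 → Option (Fin n)
  | .inl (a, c) => ![some a, none, some c]
  | .inr (.inl (a, b, c)) => ![some a, some b, some c]
  | .inr (.inr (b, c)) => ![none, some b, some c]

lemma co_inj {n : ℕ} : Function.Injective (co (n := n)) := by
  rintro (⟨a, c⟩ | ⟨a, b, c⟩ | ⟨b, c⟩) (⟨a', c'⟩ | ⟨a', b', c'⟩ | ⟨b', c'⟩) h <;>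
  · have h0 := congrFun h 0
    have h1 := congrFun h 1
    have h2 := congrFun h 2
    simp [co] at h0 h1 h2
    try simp [*]

lemma co_upd {n : ℕ} (s : Io n) (b : Fin 3) (j i : Fin n) (h : co s b = some j) :
    ∃ s', co s' = Function.update (co s) b (some i) := by
  rcases s with ⟨a, c⟩ | ⟨a, b', c⟩ | ⟨b', c⟩ <;> fin_cases b <;> simp [co] at h
  · exact ⟨.inl (i, c), by ext k; fin_cases k <;> simp [co, Function.update]⟩
  · exact ⟨.inl (a, i), by ext k; fin_cases k <;> simp [co, Function.update]⟩
  · exact ⟨.inr (.inl (i, b', c)), by ext k; fin_cases k <;> simp [co, Function.update]⟩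
  · exact ⟨.inr (.inl (a, i, c)), by ext k; fin_cases k <;> simp [co, Function.update]⟩
  · exact ⟨.inr (.inl (a, b', i)), by ext k; fin_cases k <;> simp [co, Function.update]⟩
  · exact ⟨.inr (.inr (i, c)), by ext k; fin_cases k <;> simp [co, Function.update]⟩
  · exact ⟨.inr (.inr (b', i)), by ext k; fin_cases k <;> simp [co, Function.update]⟩

/-- elementary matrices -/
noncomputable def em {n : ℕ} (b : Fin 3) (i j : Fin n) : Matrix (Io n) (Io n) ℝ :=
  fun s' s => if co s b = some j ∧ co s' = Function.update (co s) b (some i) then 1 else 0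

lemma em_tr {n : ℕ} (b : Fin 3) (i j : Fin n) : (em b i j).transpose = em b j i := by
  ext s s'
  simp only [Matrix.transpose_apply, em]
  refine if_congr ?_ rfl rfl
  constructor
  · rintro ⟨h1, h2⟩
    refine ⟨by rw [h2]; simp, ?_⟩
    rw [h2, Function.update_idem, ← h1, Function.update_eq_self]
  · rintro ⟨h1, h2⟩
    refine ⟨by rw [h2]; simp, ?_⟩
    rw [h2, Function.update_idem, ← h1, Function.update_eq_self]

lemma em_mul {n : ℕ} (b b' : Fin 3) (i j k l : Fin n) (s'' s : Io n) :
    (em b i j * em b' k l) s'' s = if co s b' = some l ∧ 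
      Function.update (co s) b' (some k) b = some j ∧
      co s'' = Function.update (Function.update (co s) b' (some k)) b (some i) then 1 else 0 := by
  rw [Matrix.mul_apply]
  by_cases h : co s b' = some l
  · obtain ⟨s', hs'⟩ := co_upd s b' l k h
    rw [Finset.sum_eq_single s']
    · simp only [em, hs', h, true_and, and_true, if_true, mul_one]
    · intro t _ ht
      have : co t ≠ Function.update (co s) b' (some k) := by
        rw [← hs']; exact fun hh => ht (co_inj hh)
      simp [em, this]
    · simp
  · simp [em, h]

lemma em_mul_same {n : ℕ} (b : Fin 3) (i j k l : Fin n) :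
    em b i j * em b k l = if j = k then em b i l else 0 := by
  ext s'' s
  rw [em_mul]
  by_cases h : j = k
  · subst h
    simp [em]
  · simp [h, Ne.symm h]

lemma em_comm {n : ℕ} (b b' : Fin 3) (hb : b ≠ b') (i j k l : Fin n) :
    em b i j * em b' k l = em b' k l * em b i j := by
  ext s'' s
  rw [em_mul, em_mul, Function.update_of_ne hb, Function.update_of_ne hb.symm,
    Function.update_comm hb]
  refine if_congr ?_ rfl rfl
  tauto

lemma em_diag {n : ℕ} (b : Fin 3) (i : Fin n) :
    em b i i = Matrix.diagonal (fun s => if co s b = some i then 1 else 0) := by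
  ext s' s
  rw [Matrix.diagonal_apply]
  unfold em
  by_cases h : co s b = some i
  · have : Function.update (co s) b (some i) = co s := by rw [← h, Function.update_eq_self]
    rw [this]
    by_cases hs : s' = s
    · subst hs; simp [h]
    · simp [hs, co_inj.eq_iff, h]
  · by_cases hs : s' = s
    · subst hs; simp [h]
    · simp [h, hs]

abbrev Sr (n : ℕ) := MvPolynomial (Io n) ℝ

noncomputable def Ee {n : ℕ} (b : Fin 3) (i j : Fin n) : Module.End ℝ (Sr n) :=
  (D (em b i j)).toLinearMap

lemma Ee_apply {n : ℕ} (b : Fin 3) (i j : Fin n) (p : Sr n) : Ee b i j p = D (em b i j) p := rfl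

lemma Ee_gl {n : ℕ} (b : Fin 3) : IsGl (Ee (n := n) b) := by
  intro i j k l
  refine LinearMap.ext fun p => ?_
  simp only [LinearMap.sub_apply, Module.End.mul_apply, Ee_apply]
  rw [D_comm, em_mul_same, em_mul_same, D_sub]
  congr 1
  · split_ifs <;> simp [D_zero, Ee_apply]
  · split_ifs <;> simp [D_zero, Ee_apply]

lemma Ee_comm {n : ℕ} (b b' : Fin 3) (hb : b ≠ b') (i j k l : Fin n) (p : Sr n) :
    Ee b i j (Ee b' k l p) = Ee b' k l (Ee b i j p) := by
  rw [← sub_eq_zero]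
  simp only [Ee_apply]
  rw [D_comm, em_comm b b' hb, sub_self, D_zero]

/-- margins of a monomial -/
noncomputable def mg {n : ℕ} (m : Io n →₀ ℕ) (b : Fin 3) (i : Fin n) : ℕ :=
  ∑ s, if co s b = some i then m s else 0

lemma Ee_coeff {n : ℕ} (b : Fin 3) (i : Fin n) (p : Sr n) (m : Io n →₀ ℕ) :
    (Ee b i i p).coeff m = (mg m b i : ℝ) * p.coeff m := by
  rw [Ee_apply, em_diag, D_diag_coeff, mg]
  push_cast
  congr 1
  refine Finset.sum_congr rfl fun s _ => ?_
  split_ifs <;> simp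

lemma mg_two {n : ℕ} (m : Io n →₀ ℕ) : ∑ i, mg m 2 i = m.degree := by
  unfold mg
  rw [Finset.sum_comm, Finsupp.degree_eq_sum]
  refine Finset.sum_congr rfl fun s _ => ?_
  rcases s with ⟨a, c⟩ | ⟨a, b', c⟩ | ⟨b', c⟩ <;> simp [co]

lemma mg_le {n : ℕ} (m : Io n →₀ ℕ) (b : Fin 3) (i : Fin n) : mg m b i ≤ m.degree := by
  unfold mg
  rw [Finsupp.degree_eq_sum]
  refine Finset.sum_le_sum fun s _ => ?_
  split_ifs <;> simp

lemma mem_WS {n : ℕ} (b : Fin 3) (a : Fin n → ℤ) (p : Sr n) :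
    p ∈ WS (Ee b) a ↔ ∀ m, p.coeff m ≠ 0 → ∀ i, (mg m b i : ℤ) = a i := by
  constructor
  · intro h m hm i
    have := congrArg (coeff m) (h i)
    rw [Ee_coeff, coeff_smul, smul_eq_mul] at this
    exact_mod_cast mul_right_cancel₀ hm this
  · intro h i
    ext m
    rw [Ee_coeff, coeff_smul, smul_eq_mul]
    by_cases hm : p.coeff m = 0
    · rw [hm]; simp
    · rw [← h m hm i]; simp

lemma Ee_hom {n : ℕ} (b : Fin 3) (i j : Fin n) (d : ℕ) (p : Sr n)
    (hp : p ∈ homogeneousSubmodule (Io n) ℝ d) : Ee b i j p ∈ homogeneousSubmodule (Io n) ℝ d :=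
  D_wh 1 _ (fun _ _ _ => rfl) p d hp

lemma WS_hom {n : ℕ} (a : Fin n → ℤ) (d : ℕ) (hd : ∑ i, a i = d) :
    WS (Ee 2) a ≤ homogeneousSubmodule (Io n) ℝ d := by
  intro p hp
  rw [mem_homogeneousSubmodule]
  intro m hm
  have := (mem_WS 2 a p).1 hp m hm
  have h2 := mg_two m
  have : ((∑ i, mg m 2 i : ℕ) : ℤ) = ∑ i, a i := by push_cast; exact Finset.sum_congr rfl fun i _ => this i
  rw [h2, hd] at this
  rw [wt1]
  exact_mod_cast this

lemma aeval_coeff {n : ℕ} (b : Fin 3) (i : Fin n) (q : Polynomial ℝ) (p : Sr n) (m : Io n →₀ ℕ) :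
    (Polynomial.aeval (Ee b i i) q p).coeff m = q.eval (mg m b i : ℝ) * p.coeff m := by
  induction q using Polynomial.induction_on' with
  | add q q' h h' => simp [h, h', add_mul]
  | monomial k c =>
    simp only [Polynomial.aeval_monomial, Module.End.mul_apply, Module.algebraMap_end_apply,
      coeff_smul, Polynomial.eval_monomial, smul_eq_mul, mul_assoc]
    congr 1
    induction k generalizing p with
    | zero => simp
    | succ k ih => rw [pow_succ, Module.End.mul_apply, ih, Ee_coeff, pow_succ, mul_assoc]

lemma Ee_ann {n : ℕ} (b : Fin 3) (i : Fin n) (d : ℕ) (p : Sr n)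
    (hp : p ∈ homogeneousSubmodule (Io n) ℝ d) :
    Polynomial.aeval (Ee b i i) (∏ k ∈ Finset.range (d + 1),
      (Polynomial.X - Polynomial.C (k : ℝ))) p = 0 := by
  ext m
  rw [aeval_coeff, coeff_zero]
  by_cases hm : p.coeff m = 0
  · rw [hm, mul_zero]
  · have h1 := hp hm
    rw [wt1] at h1
    have h2 := mg_le m b i
    rw [Polynomial.eval_prod, Finset.prod_eq_zero (i := mg m b i), zero_mul]
    · rw [Finset.mem_range]; omega
    · simp

instance hom_fd (σ : Type*) [Finite σ] (d : ℕ) : FiniteDimensional ℝ (homogeneousSubmodule σ ℝ d) := by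
  have hf : {m : σ →₀ ℕ | m.degree = d}.Finite := by
    cases nonempty_fintype σ
    refine Set.Finite.subset (Finset.finite_toSet (Finset.finsuppAntidiag Finset.univ d)) ?_
    intro m hm
    simp only [Finset.mem_coe, Finset.mem_finsuppAntidiag]
    exact ⟨by rw [← hm, Finsupp.degree_eq_sum], by simp⟩
  have : homogeneousSubmodule σ ℝ d = restrictSupport ℝ {m | m.degree = d} := by
    ext p
    rw [mem_homogeneousSubmodule, mem_restrictSupport_iff]
    constructor
    · intro h m hm
      have := h (mem_support_iff.1 hm)
      rw [wt1] at this
      exact this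
    · intro h m hm
      rw [wt1]
      exact h (mem_support_iff.2 hm)
  rw [this]
  have := hf.to_subtype
  exact Module.Finite.of_basis (basisRestrictSupport ℝ _)

end Agu

namespace Agu
open MvPolynomial

/-- simultaneous highest weight vectors -/
noncomputable def HT {n : ℕ} (χ : Fin 3 → Fin n → ℤ) : Submodule ℝ (Sr n) :=
  HW (Ee 0) (χ 0) ⊓ HW (Ee 1) (χ 1) ⊓ HW (Ee 2) (χ 2)

lemma mem_HT {n : ℕ} (χ : Fin 3 → Fin n → ℤ) (p : Sr n) : p ∈ HT χ ↔
    (∀ b i, Ee b i i p = ((χ b i : ℤ) : ℝ) • p) ∧ ∀ b i j, i < j → Ee b i j p = 0 := by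
  constructor
  · rintro ⟨⟨h0, h1⟩, h2⟩
    constructor
    · intro b; fin_cases b
      exacts [h0.1, h1.1, h2.1]
    · intro b; fin_cases b
      exacts [h0.2, h1.2, h2.2]
  · rintro ⟨h, h'⟩
    exact ⟨⟨⟨h 0, h' 0⟩, ⟨h 1, h' 1⟩⟩, ⟨h 2, h' 2⟩⟩

/-- number of three-dimensional arrays with given margins -/
noncomputable def Nm {n : ℕ} (χ : Fin 3 → Fin n → ℤ) : ℕ :=
  Nat.card {m : Io n →₀ ℕ // ∀ b i, (mg m b i : ℤ) = χ b i}

lemma HW_le_WS {n : ℕ} (b : Fin 3) (a : Fin n → ℤ) : HW (Ee b) a ≤ WS (Ee b) a := fun _ h => h.1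

lemma HW_stab {n : ℕ} (b b' : Fin 3) (hb : b ≠ b') (a : Fin n → ℤ) (i j : Fin n) (p : Sr n)
    (hp : p ∈ HW (Ee b) a) : Ee b' i j p ∈ HW (Ee b) a := by
  refine ⟨fun k => ?_, fun k l h => ?_⟩
  · rw [Ee_comm b b' hb, hp.1, map_smul]
  · rw [Ee_comm b b' hb, hp.2 k l h, map_zero]

lemma WS_stab {n : ℕ} (b b' : Fin 3) (hb : b ≠ b') (a : Fin n → ℤ) (i j : Fin n) (p : Sr n)
    (hp : p ∈ WS (Ee b) a) : Ee b' i j p ∈ WS (Ee b) a := by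
  intro k
  rw [Ee_comm b b' hb, hp, map_smul]

lemma sum_shf {n : ℕ} (κ : Fin n → ℤ) (σ : Equiv.Perm (Fin n)) : ∑ i, shf κ σ i = ∑ i, κ i := by
  unfold shf
  rw [Finset.sum_sub_distrib, Finset.sum_add_distrib,
    Equiv.sum_comp σ (fun i : Fin n => ((i : ℕ) : ℤ))]
  ring

lemma finrank_WS3 {n : ℕ} (χ : Fin 3 → Fin n → ℤ) :
    Module.finrank ℝ (WS (Ee 1) (χ 1) ⊓ WS (Ee 2) (χ 2) ⊓ WS (Ee 0) (χ 0) : Submodule ℝ (Sr n))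
      = Nm χ := by
  have : (WS (Ee 1) (χ 1) ⊓ WS (Ee 2) (χ 2) ⊓ WS (Ee 0) (χ 0) : Submodule ℝ (Sr n)) =
      restrictSupport ℝ {m | ∀ b i, (mg m b i : ℤ) = χ b i} := by
    ext p
    rw [Submodule.mem_inf, Submodule.mem_inf, mem_WS, mem_WS, mem_WS, mem_restrictSupport_iff]
    constructor
    · rintro ⟨⟨h1, h2⟩, h3⟩ m hm
      have hm' := mem_support_iff.1 hm
      intro b; fin_cases b
      exacts [h3 m hm', h1 m hm', h2 m hm']
    · intro h
      exact ⟨⟨fun m hm => h (mem_support_iff.2 hm) 1, fun m hm => h (mem_support_iff.2 hm) 2⟩,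
        fun m hm => h (mem_support_iff.2 hm) 0⟩
  rw [this, Module.finrank_eq_nat_card_basis (basisRestrictSupport ℝ _)]
  rfl

theorem finrank_HT {n : ℕ} (κ : Fin 3 → Fin n → ℕ) (hκ : ∀ b, Antitone (κ b)) :
    (Module.finrank ℝ (HT (fun b i => (κ b i : ℤ))) : ℤ) =
      alt (fun i => (κ 2 i : ℤ)) fun c => alt (fun i => (κ 1 i : ℤ)) fun b =>
        alt (fun i => (κ 0 i : ℤ)) fun a => (Nm ![a, b, c] : ℤ) := by
  set d : ℕ := ∑ i, κ 2 i with hd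
  let H := homogeneousSubmodule (Io n) ℝ d
  have hsum : ∀ σ, ∑ i, shf (fun i => (κ 2 i : ℤ)) σ i = d := by
    intro σ; rw [sum_shf, hd]; push_cast; rfl
  have ann : ∀ (b : Fin 3) (Y : Submodule ℝ (Sr n)), Y ≤ H → ∀ i, ∀ v ∈ Y, Polynomial.aeval (Ee b i i)
      (∏ k ∈ Finset.range (d + 1), (Polynomial.X - Polynomial.C (k : ℝ))) v = 0 :=
    fun b Y hY i v hv => Ee_ann b i d v (hY hv)
  have fd : ∀ Y : Submodule ℝ (Sr n), Y ≤ H → FiniteDimensional ℝ Y := fun Y hY =>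
    Submodule.finiteDimensional_of_le hY
  -- first step
  let Y2 := HW (Ee 0) (fun i => (κ 0 i : ℤ)) ⊓ HW (Ee 1) (fun i => (κ 1 i : ℤ)) ⊓ H
  haveI := fd Y2 inf_le_right
  have s2 := hw_sub (Ee 2) (Ee_gl 2) (d + 1) Y2 (fun i j v hv =>
    ⟨⟨HW_stab 0 2 (by decide) _ i j v hv.1.1, HW_stab 1 2 (by decide) _ i j v hv.1.2⟩,
      Ee_hom 2 i j d v hv.2⟩) (ann 2 Y2 inf_le_right) (κ 2) (hκ 2)
  have e2 : Y2 ⊓ HW (Ee 2) (fun i => (κ 2 i : ℤ)) = HT (fun b i => (κ b i : ℤ)) := by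
    apply le_antisymm
    · intro p hp; exact ⟨hp.1.1, hp.2⟩
    · intro p hp
      exact ⟨⟨hp.1, WS_hom _ d (by rw [hd]; push_cast; rfl) (HW_le_WS 2 _ hp.2)⟩, hp.2⟩
  rw [← e2, s2]
  unfold alt
  refine Finset.sum_congr rfl fun σ _ => ?_
  congr 1
  -- second step
  set c := shf (fun i => (κ 2 i : ℤ)) σ with hc
  have hcH : WS (Ee 2) c ≤ H := WS_hom _ d (hsum σ)
  let Y1 := HW (Ee 0) (fun i => (κ 0 i : ℤ)) ⊓ WS (Ee 2) c
  have hY1 : Y1 ≤ H := inf_le_right.trans hcH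
  haveI := fd Y1 hY1
  have s1 := hw_sub (Ee 1) (Ee_gl 1) (d + 1) Y1 (fun i j v hv =>
    ⟨HW_stab 0 1 (by decide) _ i j v hv.1, WS_stab 2 1 (by decide) _ i j v hv.2⟩)
      (ann 1 Y1 hY1) (κ 1) (hκ 1)
  have e1 : Y2 ⊓ WS (Ee 2) c = Y1 ⊓ HW (Ee 1) (fun i => (κ 1 i : ℤ)) := by
    apply le_antisymm
    · intro p hp; exact ⟨⟨hp.1.1.1, hp.2⟩, hp.1.1.2⟩
    · intro p hp; exact ⟨⟨⟨hp.1.1, hp.2⟩, hcH hp.1.2⟩, hp.1.2⟩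
  beta_reduce
  rw [e1, s1]
  unfold alt
  refine Finset.sum_congr rfl fun σ' _ => ?_
  congr 1
  set b := shf (fun i => (κ 1 i : ℤ)) σ' with hb
  let Y0 := WS (Ee 1) b ⊓ WS (Ee 2) c
  have hY0 : Y0 ≤ H := inf_le_right.trans hcH
  haveI := fd Y0 hY0
  have s0 := hw_sub (Ee 0) (Ee_gl 0) (d + 1) Y0 (fun i j v hv =>
    ⟨WS_stab 1 0 (by decide) _ i j v hv.1, WS_stab 2 0 (by decide) _ i j v hv.2⟩)
      (ann 0 Y0 hY0) (κ 0) (hκ 0)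
  have e0 : Y1 ⊓ WS (Ee 1) b = Y0 ⊓ HW (Ee 0) (fun i => (κ 0 i : ℤ)) := by
    apply le_antisymm
    · intro p hp; exact ⟨⟨hp.2, hp.1.2⟩, hp.1.1⟩
    · intro p hp; exact ⟨⟨hp.2, hp.1.2⟩, hp.1.1⟩
  beta_reduce
  rw [e0, s0]
  unfold alt
  refine Finset.sum_congr rfl fun σ'' _ => ?_
  congr 1
  beta_reduce
  have := finrank_WS3 ![shf (fun i => (κ 0 i : ℤ)) σ'', b, c]
  simp only [Matrix.cons_val_zero, Matrix.cons_val_one, Matrix.cons_val] at this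
  rw [← this]
  rfl

end Agu

namespace Agu
open MvPolynomial

section Fis
variable {σ : Type*} [Fintype σ]

noncomputable def mfac (m : σ →₀ ℕ) : ℝ := ∏ s, ((m s).factorial : ℝ)

lemma mfac_pos (m : σ →₀ ℕ) : 0 < mfac m :=
  Finset.prod_pos fun s _ => by exact_mod_cast Nat.factorial_pos _

/-- the Fischer inner product -/
noncomputable def fis : MvPolynomial σ ℝ →ₗ[ℝ] MvPolynomial σ ℝ →ₗ[ℝ] ℝ :=
  (basisMonomials σ ℝ).constr ℝ (fun m => mfac m • lcoeff ℝ m)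

lemma fis_mon (m : σ →₀ ℕ) (c : ℝ) (q : MvPolynomial σ ℝ) :
    fis (monomial m c) q = c * mfac m * q.coeff m := by
  have h : monomial m c = c • (basisMonomials σ ℝ m) := by
    rw [coe_basisMonomials, smul_monomial, smul_eq_mul, mul_one]
  rw [h, map_smul, fis, Module.Basis.constr_basis]
  simp [mul_assoc]

lemma fis_eq (p q : MvPolynomial σ ℝ) :
    fis p q = ∑ m ∈ p.support, p.coeff m * mfac m * q.coeff m := by
  conv_lhs => rw [p.as_sum]
  rw [map_sum, LinearMap.sum_apply]
  exact Finset.sum_congr rfl fun m _ => fis_mon _ _ _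

lemma fis_symm (p q : MvPolynomial σ ℝ) : fis p q = fis q p := by
  have h : ∀ p q : MvPolynomial σ ℝ, fis p q =
      ∑ m ∈ p.support ∪ q.support, p.coeff m * mfac m * q.coeff m := by
    intro p q
    rw [fis_eq]
    apply Finset.sum_subset Finset.subset_union_left
    intro m _ hm
    rw [notMem_support_iff.1 hm]; simp
  rw [h, h, Finset.union_comm]
  exact Finset.sum_congr rfl fun m _ => by ring

lemma fis_nonneg (p : MvPolynomial σ ℝ) : 0 ≤ fis p p := by
  rw [fis_eq]
  refine Finset.sum_nonneg fun m _ => ?_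
  have := mfac_pos m
  have := mul_self_nonneg (coeff m p)
  rw [mul_right_comm]; positivity

lemma fis_def (p : MvPolynomial σ ℝ) (h : fis p p = 0) : p = 0 := by
  ext m
  by_contra hm
  rw [coeff_zero] at hm
  rw [fis_eq] at h
  have h2 := (Finset.sum_eq_zero_iff_of_nonneg (fun m _ => by
    have := mfac_pos m
    have := mul_self_nonneg (coeff m p)
    rw [mul_right_comm]; positivity)).1 h m (mem_support_iff.2 hm)
  have := (mfac_pos m).ne'
  simp_all

lemma mfac_add (m : σ →₀ ℕ) (s : σ) :
    mfac (m + Finsupp.single s 1) = (m s + 1) * mfac m := by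
  unfold mfac
  rw [← Finset.mul_prod_erase _ _ (Finset.mem_univ s), ← Finset.mul_prod_erase _ _ (Finset.mem_univ s)]
  simp only [Finsupp.add_apply, Finsupp.single_eq_same, Nat.factorial_succ, Nat.cast_mul, Nat.cast_add,
    Nat.cast_one, mul_assoc]
  congr 2
  refine Finset.prod_congr rfl fun t ht => ?_
  rw [Finsupp.single_eq_of_ne (Finset.ne_of_mem_erase ht)]; simp

lemma fis_X (s : σ) (p q : MvPolynomial σ ℝ) : fis (X s * p) q = fis p (pderiv s q) := by
  induction p using MvPolynomial.induction_on' with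
  | add p p' h h' => rw [mul_add, map_add, map_add, LinearMap.add_apply, LinearMap.add_apply, h, h']
  | monomial m c =>
    rw [X, monomial_mul, one_mul, fis_mon, fis_mon, coeff_pderiv, add_comm, mfac_add]
    push_cast; ring

lemma fis_D (a : Matrix σ σ ℝ) (p q : MvPolynomial σ ℝ) : fis (D a p) q = fis p (D a.transpose q) := by
  rw [D_apply, D_apply]
  simp only [map_sum, LinearMap.sum_apply]
  rw [Finset.sum_comm]
  refine Finset.sum_congr rfl fun s _ => Finset.sum_congr rfl fun s' _ => ?_
  rw [← smul_eq_C_mul, ← smul_eq_C_mul, map_smul, map_smul, LinearMap.smul_apply, fis_X,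
    fis_symm p (X s' * _), fis_X, fis_symm]
  rfl

/-- orthogonal decomposition -/
lemma fis_compl (W : Submodule ℝ (MvPolynomial σ ℝ)) [FiniteDimensional ℝ W] :
    ∃ π : Module.End ℝ (MvPolynomial σ ℝ), (∀ v, π v ∈ W) ∧ (∀ v ∈ W, π v = v) ∧
      ∀ v, ∀ w ∈ W, fis w (v - π v) = 0 := by
  let R : MvPolynomial σ ℝ →ₗ[ℝ] Module.Dual ℝ W := (LinearMap.lcomp ℝ ℝ W.subtype) ∘ₗ fis
  have hR : ∀ v (w : W), R v w = fis v w := fun v w => rfl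
  have hinj : Function.Injective (R ∘ₗ W.subtype) := by
    rw [injective_iff_map_eq_zero]
    intro w hw
    have := LinearMap.congr_fun hw w
    exact Subtype.ext (fis_def _ this)
  let e := LinearMap.linearEquivOfInjective (R ∘ₗ W.subtype) hinj Subspace.dual_finrank_eq.symm
  have he : ∀ w : W, e w = R w := fun w => rfl
  refine ⟨W.subtype ∘ₗ e.symm.toLinearMap ∘ₗ R, fun v => by simp, fun v hv => ?_, fun v w hw => ?_⟩
  · have := he ⟨v, hv⟩
    simp only [LinearMap.comp_apply, LinearEquiv.coe_coe, Submodule.subtype_apply]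
    rw [← this, LinearEquiv.symm_apply_apply]
  · have h1 : R (e.symm (R v)) = R v := by rw [← he, LinearEquiv.apply_symm_apply]
    have := LinearMap.congr_fun h1 ⟨w, hw⟩
    rw [hR, hR] at this
    rw [fis_symm, map_sub, LinearMap.sub_apply]
    simp only [LinearMap.comp_apply, LinearEquiv.coe_coe, Submodule.subtype_apply]
    rw [this, sub_self]
end Fis
end Agu

namespace Agu
open MvPolynomial

section Int
variable {n : ℕ}

lemma Ee_adj (b : Fin 3) (i j : Fin n) (p q : Sr n) : fis (Ee b i j p) q = fis p (Ee b j i q) := by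
  rw [Ee_apply, fis_D, em_tr, Ee_apply]

lemma Ee_swap (b b' : Fin 3) (i j k l : Fin n) (p : Sr n) :
    Ee b i j (Ee b' k l p) = Ee b' k l (Ee b i j p) +
      (if b = b' then (if j = k then Ee b i l p else 0) - (if l = i then Ee b k j p else 0) else 0) := by
  by_cases h : b = b'
  · subst h
    rw [if_pos rfl]
    have := LinearMap.congr_fun (Ee_gl b i j k l) p
    simp only [LinearMap.sub_apply, Module.End.mul_apply] at this
    rw [← sub_eq_iff_eq_add', this]
    split_ifs <;> simp
  · rw [if_neg h, add_zero, Ee_comm b b' h]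

noncomputable def act (b : Fin 3) (i j : Fin n) : Module.End ℝ (Sr n × Sr n) :=
  (Ee b i j).prodMap (Ee b i j)

lemma act_fst (b : Fin 3) (i j : Fin n) (u : Sr n × Sr n) : (act b i j u).1 = Ee b i j u.1 := rfl
lemma act_snd (b : Fin 3) (i j : Fin n) (u : Sr n × Sr n) : (act b i j u).2 = Ee b i j u.2 := rfl

lemma act_swap (b b' : Fin 3) (i j k l : Fin n) (p : Sr n × Sr n) :
    act b i j (act b' k l p) = act b' k l (act b i j p) +
      (if b = b' then (if j = k then act b i l p else 0) - (if l = i then act b k j p else 0) else 0) := by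
  refine Prod.ext ?_ ?_
  · simp only [act, LinearMap.prodMap_apply, Prod.fst_add]
    rw [Ee_swap]
    congr 1
    split_ifs <;> simp
  · simp only [act, LinearMap.prodMap_apply, Prod.snd_add]
    rw [Ee_swap]
    congr 1
    split_ifs <;> simp

def lowset (m : Sr n × Sr n) : Set (Submodule ℝ (Sr n × Sr n)) :=
  {W | m ∈ W ∧ ∀ b i j, j < i → ∀ u ∈ W, act b i j u ∈ W}

noncomputable def low (m : Sr n × Sr n) : Submodule ℝ (Sr n × Sr n) := sInf (lowset m)

lemma low_mem (m : Sr n × Sr n) : low m ∈ lowset m := by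
  constructor
  · rw [low, Submodule.mem_sInf]; exact fun W hW => hW.1
  · intro b i j h u hu
    rw [low, Submodule.mem_sInf] at hu ⊢
    exact fun W hW => hW.2 b i j h u (hu W hW)

lemma low_le {m : Sr n × Sr n} {W : Submodule ℝ (Sr n × Sr n)} (h : W ∈ lowset m) : low m ≤ W :=
  sInf_le h

lemma low_ind {m : Sr n × Sr n} (P : Sr n × Sr n → Prop) (hadd : ∀ u v, P u → P v → P (u + v))
    (h0 : P 0) (hsmul : ∀ (c : ℝ) u, P u → P (c • u)) (hm : P m)
    (hlow : ∀ b i j, j < i → ∀ u, P u → P (act b i j u)) : ∀ u ∈ low m, P u :=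
  low_le (W := { carrier := {u | P u}
                 add_mem' := fun {u v} => hadd u v
                 zero_mem' := h0
                 smul_mem' := hsmul }) ⟨hm, hlow⟩

variable {χ : Fin 3 → Fin n → ℤ} {m1 m2 : Sr n}

lemma low_stab (h1 : m1 ∈ HT χ) (h2 : m2 ∈ HT χ) : ∀ u ∈ low (m1, m2), ∀ b i j,
    act b i j u ∈ low (m1, m2) := by
  have hl := low_mem (m1, m2)
  rw [mem_HT] at h1 h2
  let W : Submodule ℝ (Sr n × Sr n) :=
    { carrier := {u | u ∈ low (m1, m2) ∧ ∀ b i j, act b i j u ∈ low (m1, m2)}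
      add_mem' := fun hu hv => ⟨add_mem hu.1 hv.1, fun b i j => by
        rw [map_add]; exact add_mem (hu.2 b i j) (hv.2 b i j)⟩
      zero_mem' := ⟨zero_mem _, fun b i j => by rw [map_zero]; exact zero_mem _⟩
      smul_mem' := fun c u hu => ⟨Submodule.smul_mem _ c hu.1, fun b i j => by
        rw [map_smul]; exact Submodule.smul_mem _ c (hu.2 b i j)⟩ }
  have hW : low (m1, m2) ≤ W := by
    apply low_le
    refine ⟨⟨hl.1, fun b i j => ?_⟩, fun b i j hij u hu => ⟨hl.2 b i j hij u hu.1, fun b' k l => ?_⟩⟩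
    · rcases lt_trichotomy i j with h | h | h
      · have : act b i j (m1, m2) = 0 := by
          simp [act, LinearMap.prodMap_apply, h1.2 b i j h, h2.2 b i j h]
        rw [this]; exact zero_mem _
      · subst h
        have : act b i i (m1, m2) = ((χ b i : ℤ) : ℝ) • (m1, m2) := by
          simp only [act, LinearMap.prodMap_apply, h1.1 b i, h2.1 b i, Prod.smul_mk]
        rw [this]; exact Submodule.smul_mem _ _ hl.1
      · exact hl.2 b i j h _ hl.1
    · rw [act_swap]
      refine add_mem (hl.2 b i j hij _ (hu.2 _ _ _)) ?_
      split_ifs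
      · exact sub_mem (hu.2 _ _ _) (hu.2 _ _ _)
      · exact sub_mem (hu.2 _ _ _) (zero_mem _)
      · exact sub_mem (zero_mem _) (hu.2 _ _ _)
      · exact sub_mem (zero_mem _) (zero_mem _)
      · exact zero_mem _
  exact fun u hu => (hW hu).2

lemma low_hom (d : ℕ) (h1 : m1 ∈ homogeneousSubmodule (Io n) ℝ d)
    (h2 : m2 ∈ homogeneousSubmodule (Io n) ℝ d) :
    low (m1, m2) ≤ (homogeneousSubmodule (Io n) ℝ d).prod (homogeneousSubmodule (Io n) ℝ d) :=
  low_le ⟨⟨h1, h2⟩, fun b i j _ u hu => ⟨Ee_hom b i j d _ hu.1, Ee_hom b i j d _ hu.2⟩⟩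

lemma low_form (h1 : m1 ∈ HT χ) (h2 : m2 ∈ HT χ) : ∀ w ∈ low (m1, m2), ∀ u ∈ low (m1, m2),
    fis m2 m2 * fis u.1 w.1 = fis m1 m1 * fis u.2 w.2 := by
  have hs := low_stab h1 h2
  rw [mem_HT] at h1 h2
  have c3 : ∀ u ∈ low (m1, m2), fis m2 m2 * fis u.1 m1 = fis m1 m1 * fis u.2 m2 := by
    refine low_ind _ (fun u v hu hv => ?_) ?_ (fun c u hu => ?_) (mul_comm _ _) (fun b i j hij u hu => ?_)
    · rw [Prod.fst_add, Prod.snd_add, map_add, map_add, LinearMap.add_apply, LinearMap.add_apply,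
        mul_add, hu, hv, mul_add]
    · rw [Prod.fst_zero, Prod.snd_zero, map_zero, LinearMap.zero_apply, LinearMap.zero_apply]; simp
    · rw [Prod.smul_fst, Prod.smul_snd, map_smul, map_smul, LinearMap.smul_apply, LinearMap.smul_apply,
        smul_eq_mul, smul_eq_mul, mul_left_comm, hu, mul_left_comm]
    · change fis m2 m2 * fis (Ee b i j u.1) m1 = fis m1 m1 * fis (Ee b i j u.2) m2
      rw [Ee_adj, Ee_adj, h1.2 b j i hij, h2.2 b j i hij, map_zero, map_zero]; simp
  refine low_ind _ (fun w v hw hv u hu => ?_) (fun u hu => ?_) (fun c w hw u hu => ?_) c3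
    (fun b i j hij w hw u hu => ?_)
  · rw [Prod.fst_add, Prod.snd_add, map_add, map_add,
        mul_add, hw u hu, hv u hu, mul_add]
  · rw [Prod.fst_zero, Prod.snd_zero, map_zero, map_zero]; simp
  · rw [Prod.smul_fst, Prod.smul_snd, map_smul, map_smul,
        smul_eq_mul, smul_eq_mul, mul_left_comm, hw u hu, mul_left_comm]
  · rw [act_fst, act_snd, ← Ee_adj, ← Ee_adj]
    have := hw _ (hs u hu b j i)
    rwa [act_fst, act_snd] at this

theorem intertwiner (h1 : m1 ∈ HT χ) (h2 : m2 ∈ HT χ) (h0 : m2 ≠ 0) :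
    ∃ ψ : Module.End ℝ (Sr n), (∀ b i j v, ψ (Ee b i j v) = Ee b i j (ψ v)) ∧ ψ m2 = m1 := by
  set L := low (m1, m2) with hL
  have hs := low_stab h1 h2
  have hf := low_form h1 h2
  have hm : (m1, m2) ∈ L := (low_mem (m1, m2)).1
  -- homogeneity
  obtain ⟨d, hd⟩ : ∃ d : ℕ, ∑ i, χ 2 i = d := by
    obtain ⟨m, hm⟩ := ne_zero_iff.1 h0
    have := (mem_WS 2 (χ 2) m2).1 (HW_le_WS 2 _ h2.2) m hm
    exact ⟨∑ i, mg m 2 i, by push_cast; exact Finset.sum_congr rfl fun i _ => (this i).symm⟩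
  have hH : ∀ u ∈ HT χ, u ∈ homogeneousSubmodule (Io n) ℝ d := fun u hu =>
    WS_hom _ d hd (HW_le_WS 2 _ hu.2)
  have hLH := low_hom d (hH _ h1) (hH _ h2)
  let f : L →ₗ[ℝ] Sr n := LinearMap.snd ℝ _ _ ∘ₗ L.subtype
  have hfi : Function.Injective f := by
    rw [injective_iff_map_eq_zero]
    rintro ⟨u, hu⟩ h
    have h' : u.2 = 0 := h
    have := hf u hu u hu
    rw [h', map_zero, mul_zero] at this
    have h3 : u.1 = 0 := by
      apply fis_def
      rcases mul_eq_zero.1 this with h | h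
      · exact absurd (fis_def _ h) h0
      · exact h
    exact Subtype.ext (Prod.ext h3 h')
  let W := LinearMap.range f
  have hWH : W ≤ homogeneousSubmodule (Io n) ℝ d := by
    rintro _ ⟨u, rfl⟩
    exact (hLH u.2).2
  haveI : FiniteDimensional ℝ W := Submodule.finiteDimensional_of_le hWH
  obtain ⟨π, p1, p2, p3⟩ := fis_compl W
  have hW : ∀ v, v ∈ W ↔ ∃ u, (u, v) ∈ L := by
    intro v
    constructor
    · rintro ⟨u, rfl⟩; exact ⟨u.1.1, u.2⟩
    · rintro ⟨u, hu⟩; exact ⟨⟨_, hu⟩, rfl⟩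
  have hWs : ∀ v ∈ W, ∀ b i j, Ee b i j v ∈ W := by
    intro v hv b i j
    rw [hW] at hv ⊢
    obtain ⟨u, hu⟩ := hv
    exact ⟨_, hs _ hu b i j⟩
  have p0 : ∀ v, (∀ w ∈ W, fis w v = 0) → π v = 0 := by
    intro v hv
    apply fis_def
    have := p3 v _ (p1 v)
    rw [map_sub, hv _ (p1 v)] at this
    linarith
  have pE : ∀ b i j v, π (Ee b i j v) = Ee b i j (π v) := by
    intro b i j v
    have e : v = π v + (v - π v) := by abel
    conv_lhs => rw [e]
    rw [map_add, map_add, p2 _ (hWs _ (p1 v) b i j), p0 (Ee b i j (v - π v)), add_zero]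
    intro w hw
    rw [← Ee_adj]
    exact p3 v _ (hWs w hw b j i)
  let e := LinearEquiv.ofInjective f hfi
  let ψ : Module.End ℝ (Sr n) := LinearMap.fst ℝ _ _ ∘ₗ L.subtype ∘ₗ e.symm.toLinearMap ∘ₗ
    (π.codRestrict W p1)
  have hψ : ∀ v, (ψ v, π v) ∈ L := by
    intro v
    have h1 : f (e.symm (π.codRestrict W p1 v)) = π v := by
      have := LinearEquiv.apply_symm_apply e (π.codRestrict W p1 v)
      exact congrArg Subtype.val this
    have h2 := (e.symm (π.codRestrict W p1 v)).2
    have : (ψ v, π v) = (e.symm (π.codRestrict W p1 v)).1 := Prod.ext rfl h1.symm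
    rw [this]; exact h2
  have uniq : ∀ x x' y, (x, y) ∈ L → (x', y) ∈ L → x = x' := by
    intro x x' y h h'
    have : (⟨_, h⟩ : L) = ⟨_, h'⟩ := hfi rfl
    exact congrArg (fun u => u.1.1) this
  refine ⟨ψ, fun b i j v => uniq _ _ (π (Ee b i j v)) (hψ _) ?_, uniq _ _ m2 ?_ hm⟩
  · rw [pE]; exact hs _ (hψ v) b i j
  · have := hψ m2
    rwa [p2 m2 ((hW _).2 ⟨_, hm⟩)] at this

end Int
end Agu

namespace Agu
open MvPolynomial

section Gen
variable {ζ ι : Type*} [Fintype ζ] [Fintype ι]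

lemma D_inl (A : Matrix ζ ζ ℝ) (B : Matrix ι ι ℝ) (p : MvPolynomial ζ ℝ) :
    D (Matrix.fromBlocks A 0 0 B) (rename Sum.inl p) = rename Sum.inl (D A p) := by
  induction p using MvPolynomial.induction_on with
  | C a => simp
  | add p q hp hq => simp [hp, hq]
  | mul_X p i hp =>
    simp only [map_mul, rename_X, Derivation.leibniz, hp, smul_eq_mul, map_add, D_X, map_sum,
      Fintype.sum_sum_type, Matrix.fromBlocks_apply₁₁, Matrix.fromBlocks_apply₂₁, Matrix.zero_apply,
      map_zero, zero_mul, Finset.sum_const_zero, add_zero, rename_C]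

lemma D_inr (A : Matrix ζ ζ ℝ) (B : Matrix ι ι ℝ) (p : MvPolynomial ι ℝ) :
    D (Matrix.fromBlocks A 0 0 B) (rename Sum.inr p) = rename Sum.inr (D B p) := by
  induction p using MvPolynomial.induction_on with
  | C a => simp
  | add p q hp hq => simp [hp, hq]
  | mul_X p i hp =>
    simp only [map_mul, rename_X, Derivation.leibniz, hp, smul_eq_mul, map_add, D_X, map_sum,
      Fintype.sum_sum_type, Matrix.fromBlocks_apply₁₂, Matrix.fromBlocks_apply₂₂, Matrix.zero_apply,
      map_zero, zero_mul, Finset.sum_const_zero, zero_add, rename_C]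

lemma mon_split (q : ζ ⊕ ι →₀ ℕ) (c : ℝ) : monomial q c =
    rename Sum.inr (monomial (Finsupp.sumFinsuppEquivProdFinsupp q).2 c) *
    rename Sum.inl (monomial (Finsupp.sumFinsuppEquivProdFinsupp q).1 1) := by
  rw [rename_monomial, rename_monomial, monomial_mul, mul_one]
  refine congrArg (fun q => monomial q c) (Finsupp.ext ?_)
  rintro (x | x)
  · rw [Finsupp.add_apply, Finsupp.mapDomain_apply Sum.inl_injective, Finsupp.mapDomain_notin_range]
    · simp [Finsupp.sumFinsuppEquivProdFinsupp]
    · simp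
  · rw [Finsupp.add_apply, Finsupp.mapDomain_apply Sum.inr_injective,
      Finsupp.mapDomain_notin_range (f := Sum.inl)]
    · simp [Finsupp.sumFinsuppEquivProdFinsupp]
    · simp

lemma T_ind (P : MvPolynomial (ζ ⊕ ι) ℝ → Prop) (hadd : ∀ p q, P p → P q → P (p + q))
    (h : ∀ s z, P (rename Sum.inr s * rename Sum.inl z)) (p) : P p := by
  induction p using MvPolynomial.induction_on' with
  | monomial q c => rw [mon_split]; exact h _ _
  | add p q hp hq => exact hadd p q hp hq

lemma exists_ext (ψ : Module.End ℝ (MvPolynomial ι ℝ)) :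
    ∃ Ψ : Module.End ℝ (MvPolynomial (ζ ⊕ ι) ℝ), ∀ s z,
      Ψ (rename Sum.inr s * rename Sum.inl z) = rename Sum.inr (ψ s) * rename Sum.inl z := by
  let Ψ : Module.End ℝ (MvPolynomial (ζ ⊕ ι) ℝ) := (basisMonomials (ζ ⊕ ι) ℝ).constr ℝ (fun q =>
    rename Sum.inr (ψ (monomial (Finsupp.sumFinsuppEquivProdFinsupp q).2 1)) *
    rename Sum.inl (monomial (Finsupp.sumFinsuppEquivProdFinsupp q).1 1))
  have hΨ : ∀ q, Ψ (monomial q 1) =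
      rename Sum.inr (ψ (monomial (Finsupp.sumFinsuppEquivProdFinsupp q).2 1)) *
      rename Sum.inl (monomial (Finsupp.sumFinsuppEquivProdFinsupp q).1 1) := by
    intro q
    have : monomial q (1 : ℝ) = basisMonomials (ζ ⊕ ι) ℝ q := by rw [coe_basisMonomials]
    rw [this]
    exact Module.Basis.constr_basis _ _ _ _
  refine ⟨Ψ, fun s z => ?_⟩
  induction s using MvPolynomial.induction_on' with
  | add p q hp hq => rw [map_add, add_mul, map_add, hp, hq, map_add, map_add, add_mul]
  | monomial p c =>
    induction z using MvPolynomial.induction_on' with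
    | add p q hp hq => rw [map_add, mul_add, map_add, hp, hq, mul_add]
    | monomial q c' =>
      have e1 : monomial p c = c • monomial p (1 : ℝ) := by simp [smul_monomial]
      have e2 : monomial q c' = c' • monomial q (1 : ℝ) := by simp [smul_monomial]
      rw [e1, e2]
      simp only [map_smul, smul_mul_assoc, mul_smul_comm]
      congr 2
      have := hΨ (Finsupp.sumFinsuppEquivProdFinsupp.symm (q, p))
      rw [mon_split, Equiv.apply_symm_apply] at this
      exact this

end Gen

section Rey
variable {τ : Type*} [Fintype τ] {G : Type*} (a : G → Matrix τ τ ℝ)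

def Inv (F : MvPolynomial τ ℝ) : Prop := ∀ g, D (a g) F = 0

noncomputable def PS : Submodule ℝ (MvPolynomial τ ℝ) := Submodule.span ℝ {p | ∃ g u, p = D (a g) u}

variable {a}

lemma PS_inv (ht : ∀ g, ∃ g', a g' = (a g).transpose) {F : MvPolynomial τ ℝ} (hF : Inv a F)
    (hP : F ∈ PS a) : F = 0 := by
  apply fis_def
  have : ∀ p ∈ PS a, fis p F = 0 := by
    intro p hp
    induction hp using Submodule.span_induction with
    | mem p hp =>
      obtain ⟨g, u, rfl⟩ := hp
      obtain ⟨g', hg'⟩ := ht g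
      rw [fis_D, ← hg', hF g', map_zero]
    | zero => simp
    | add p q _ _ hp hq => rw [map_add, LinearMap.add_apply, hp, hq, add_zero]
    | smul c p _ hp => rw [map_smul, LinearMap.smul_apply, hp, smul_zero]
  exact this F hP

lemma PS_mul {F : MvPolynomial τ ℝ} (hF : Inv a F) {p : MvPolynomial τ ℝ}
    (hP : p ∈ PS a) : p * F ∈ PS a := by
  induction hP using Submodule.span_induction with
  | mem p hp =>
    obtain ⟨g, u, rfl⟩ := hp
    apply Submodule.subset_span
    refine ⟨g, u * F, ?_⟩
    rw [Derivation.leibniz, hF g, smul_zero, zero_add, smul_eq_mul, mul_comm]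
  | zero => simp
  | add p q _ _ hp hq => rw [add_mul]; exact add_mem hp hq
  | smul c p _ hp => rw [smul_mul_assoc]; exact Submodule.smul_mem _ _ hp

lemma Inv.add {F F' : MvPolynomial τ ℝ} (h : Inv a F) (h' : Inv a F') : Inv a (F + F') :=
  fun g => by rw [map_add, h g, h' g, add_zero]

lemma Inv.mul {F F' : MvPolynomial τ ℝ} (h : Inv a F) (h' : Inv a F') : Inv a (F * F') :=
  fun g => by rw [Derivation.leibniz, h g, h' g, smul_zero, smul_zero, add_zero]

lemma Inv.zero : Inv a (0 : MvPolynomial τ ℝ) := fun g => map_zero _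

theorem reynolds (ht : ∀ g, ∃ g', a g' = (a g).transpose) {M : Type*} [AddCommMonoid M] (w : τ → M)
    (hw : ∀ g s' s, a g s' s ≠ 0 → w s' = w s) (t : MvPolynomial τ ℝ) (δ : M)
    (h : IsWeightedHomogeneous w t δ) :
    ∃ t', Inv a t' ∧ IsWeightedHomogeneous w t' δ ∧ t - t' ∈ PS a := by
  have key : ∀ n : ℕ, ∀ t : MvPolynomial τ ℝ, IsWeightedHomogeneous w t δ → t.IsHomogeneous n →
      ∃ t', Inv a t' ∧ IsWeightedHomogeneous w t' δ ∧ t - t' ∈ PS a := by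
    intro n t h1 h2
    let V : Submodule ℝ (MvPolynomial τ ℝ) :=
      weightedHomogeneousSubmodule ℝ w δ ⊓ homogeneousSubmodule τ ℝ n
    have hV : ∀ g, ∀ u ∈ V, D (a g) u ∈ V := fun g u hu =>
      ⟨D_wh w _ (hw g) u δ hu.1, D_wh 1 _ (fun _ _ _ => rfl) u n hu.2⟩
    let Q : Submodule ℝ (MvPolynomial τ ℝ) := Submodule.span ℝ {p | ∃ g, ∃ u ∈ V, p = D (a g) u}
    have hQV : Q ≤ V := by
      apply Submodule.span_le.2
      rintro _ ⟨g, u, hu, rfl⟩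
      exact hV g u hu
    have hQP : Q ≤ PS a := by
      apply Submodule.span_mono
      rintro _ ⟨g, u, hu, rfl⟩
      exact ⟨g, u, rfl⟩
    haveI : FiniteDimensional ℝ Q := Submodule.finiteDimensional_of_le (hQV.trans inf_le_right)
    obtain ⟨π, p1, p2, p3⟩ := fis_compl Q
    have ht' : t - π t ∈ V := sub_mem ⟨h1, h2⟩ (hQV (p1 t))
    refine ⟨t - π t, fun g => ?_, ht'.1, ?_⟩
    · apply fis_def
      obtain ⟨g', hg'⟩ := ht g
      rw [fis_D, fis_symm, ← hg']
      exact p3 t _ (Submodule.subset_span ⟨g', _, hV g _ ht', rfl⟩)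
    · rw [sub_sub_cancel]; exact hQP (p1 t)
  have hs := sum_homogeneousComponent t
  have : ∀ s : Finset ℕ, ∃ t', Inv a t' ∧ IsWeightedHomogeneous w t' δ ∧
      (∑ i ∈ s, homogeneousComponent i t) - t' ∈ PS a := by
    intro s
    induction s using Finset.induction_on with
    | empty => exact ⟨0, Inv.zero, isWeightedHomogeneous_zero _ _ _, by simp⟩
    | insert n s hn ih =>
      obtain ⟨t1, i1, w1, q1⟩ := ih
      obtain ⟨t2, i2, w2, q2⟩ := key n (homogeneousComponent n t) (by
        intro m hm
        rw [coeff_homogeneousComponent] at hm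
        split_ifs at hm
        · exact h hm
        · exact absurd rfl hm) (homogeneousComponent_isHomogeneous n t)
      refine ⟨t2 + t1, i2.add i1, w2.add w1, ?_⟩
      rw [Finset.sum_insert hn, add_sub_add_comm]
      exact add_mem q2 q1
  have := this (Finset.range (t.totalDegree + 1))
  rwa [hs] at this

end Rey
end Agu

namespace Agu
open MvPolynomial

section Hil
variable {τ : Type*} [Fintype τ] {G : Type*} {a : G → Matrix τ τ ℝ}

lemma whc_mul (w : τ → ℕ × ℕ) (x : MvPolynomial τ ℝ) (e d : ℕ) (hx : IsWeightedHomogeneous w x (e, 1))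
    (c : MvPolynomial τ ℝ) : weightedHomogeneousComponent w (d, 1) (c * x) =
      if e ≤ d then weightedHomogeneousComponent w (d - e, 0) c * x else 0 := by
  induction c using MvPolynomial.induction_on' with
  | add p q hp hq => 
    rw [add_mul, map_add, hp, hq, map_add]
    split_ifs <;> ring
  | monomial m b =>
    set μ := Finsupp.weight w m with hμ
    have h1 : IsWeightedHomogeneous w (monomial m b) μ := isWeightedHomogeneous_monomial _ _ _ rfl
    have h2 := h1.mul hx
    have key : ∀ (p : MvPolynomial τ ℝ) (ν n : ℕ × ℕ), IsWeightedHomogeneous w p ν →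
        weightedHomogeneousComponent w n p = if n = ν then p else 0 := by
      intro p ν n hp
      exact weightedHomogeneousComponent_of_mem hp
    rw [key _ _ _ h2, key _ _ _ h1]
    by_cases he : e ≤ d
    · rw [if_pos he]
      by_cases h : (d - e, 0) = μ
      · rw [if_pos h, if_pos]
        rw [← h]; ext <;> simp <;> omega
      · rw [if_neg h, if_neg, zero_mul]
        intro h'
        apply h
        have e1 := congrArg Prod.fst h'
        have e2 := congrArg Prod.snd h'
        simp at e1 e2
        ext <;> simp <;> omega
    · rw [if_neg he, if_neg]
      intro h'
      have e1 := congrArg Prod.fst h'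
      simp at e1
      omega

theorem hilb (ht : ∀ g, ∃ g', a g' = (a g).transpose) (w : τ → ℕ × ℕ)
    (hw : ∀ g s' s, a g s' s ≠ 0 → w s' = w s) :
    ∃ (s : Finset (MvPolynomial τ ℝ)) (dg : MvPolynomial τ ℝ → ℕ),
      (∀ x ∈ s, Inv a x ∧ IsWeightedHomogeneous w x (dg x, 1)) ∧
      ∀ F d, Inv a F → IsWeightedHomogeneous w F (d, 1) →
        ∃ t : MvPolynomial τ ℝ → MvPolynomial τ ℝ,
          (∀ x ∈ s, Inv a (t x) ∧ (dg x ≤ d → IsWeightedHomogeneous w (t x) (d - dg x, 0)) ∧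
            (¬ dg x ≤ d → t x = 0)) ∧ F = ∑ x ∈ s, t x * x := by
  let I : Set (MvPolynomial τ ℝ) := {F | Inv a F ∧ ∃ d, IsWeightedHomogeneous w F (d, 1)}
  have hfg : (Submodule.span (MvPolynomial τ ℝ) I).FG := IsNoetherian.noetherian _
  obtain ⟨s, hsI, hs⟩ := (Submodule.fg_span_iff_fg_span_finset_subset I).1 hfg
  have hdg : ∀ x, ∃ d : ℕ, x ∈ I → IsWeightedHomogeneous w x (d, 1) := by
    intro x
    by_cases h : x ∈ I
    · obtain ⟨d, hd⟩ := h.2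
      exact ⟨d, fun _ => hd⟩
    · exact ⟨0, fun h' => absurd h' h⟩
  choose dg hdg using hdg
  refine ⟨s, dg, fun x hx => ⟨(hsI hx).1, hdg x (hsI hx)⟩, fun F d hF hFd => ?_⟩
  have hFs : F ∈ Submodule.span (MvPolynomial τ ℝ) (s : Set (MvPolynomial τ ℝ)) := by
    rw [← hs]; exact Submodule.subset_span ⟨hF, d, hFd⟩
  obtain ⟨c, -, hc⟩ := Submodule.mem_span_finset.1 hFs
  have hc2 : F = ∑ x ∈ s, (if dg x ≤ d then weightedHomogeneousComponent w (d - dg x, 0) (c x) else 0) * x := by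
    have h1 : weightedHomogeneousComponent w (d, 1) F = F := by
      rw [weightedHomogeneousComponent_of_mem hFd, if_pos rfl]
    rw [← h1, ← hc, map_sum]
    refine Finset.sum_congr rfl fun x hx => ?_
    rw [smul_eq_mul, whc_mul w x (dg x) d (hdg x (hsI hx))]
    split_ifs <;> simp
  have : ∀ x, ∃ t', Inv a t' ∧ (dg x ≤ d → IsWeightedHomogeneous w t' (d - dg x, 0)) ∧
      (¬ dg x ≤ d → t' = 0) ∧
      (if dg x ≤ d then weightedHomogeneousComponent w (d - dg x, 0) (c x) else 0) - t' ∈ PS a := by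
    intro x
    by_cases h : dg x ≤ d
    · rw [if_pos h]
      obtain ⟨t', h1, h2, h3⟩ := reynolds ht w hw _ (d - dg x, 0)
        (weightedHomogeneousComponent_isWeightedHomogeneous (d - dg x, 0) (c x))
      exact ⟨t', h1, fun _ => h2, fun h' => absurd h h', h3⟩
    · rw [if_neg h]
      exact ⟨0, Inv.zero, fun h' => absurd h' h, fun _ => rfl, by simp⟩
  choose t h1 h2 h3 h4 using this
  refine ⟨t, fun x hx => ⟨h1 x, h2 x, h3 x⟩, ?_⟩
  rw [← sub_eq_zero]
  apply PS_inv ht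
  · intro g
    rw [map_sub, hF g, map_sum, zero_sub, neg_eq_zero]
    exact Finset.sum_eq_zero fun x hx => (h1 x).mul (hsI hx).1 g
  · rw [hc2, ← Finset.sum_sub_distrib]
    refine Submodule.sum_mem _ fun x hx => ?_
    rw [← sub_mul]
    exact PS_mul (hsI hx).1 (h4 x)

end Hil
end Agu

namespace Agu
open MvPolynomial

section Zs
variable {n : ℕ}

abbrev Zt (n N : ℕ) : Type := {m : Io n →₀ ℕ // m.degree = N}

noncomputable instance (N : ℕ) : Fintype (Zt n N) := by
  have hf : {m : Io n →₀ ℕ | m.degree = N}.Finite := by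
    refine Set.Finite.subset (Finset.finite_toSet (Finset.finsuppAntidiag Finset.univ N)) ?_
    intro m hm
    simp only [Finset.mem_coe, Finset.mem_finsuppAntidiag]
    exact ⟨by rw [← hm, Finsupp.degree_eq_sum], by simp⟩
  exact hf.fintype

noncomputable def uz {N : ℕ} (m : Zt n N) : Sr n := monomial m.1 (1 / √(mfac m.1))

noncomputable def cz (N : ℕ) (p : Sr n) (m : Zt n N) : ℝ := √(mfac m.1) * p.coeff m.1

lemma sq_pos (m : Io n →₀ ℕ) : 0 < √(mfac m) := Real.sqrt_pos.2 (mfac_pos m)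

lemma uz_hom {N : ℕ} (m : Zt n N) : uz m ∈ homogeneousSubmodule (Io n) ℝ N := by
  rw [mem_homogeneousSubmodule]
  apply isHomogeneous_monomial
  exact m.2

lemma cz_fis {N : ℕ} (p : Sr n) (m : Zt n N) : cz N p m = fis (uz m) p := by
  rw [uz, fis_mon, cz]
  congr 1
  have := sq_pos m.1
  have h2 := Real.mul_self_sqrt (mfac_pos m.1).le
  field_simp
  nlinarith

lemma cz_expand {N : ℕ} (p : Sr n) (hp : p ∈ homogeneousSubmodule (Io n) ℝ N) :
    p = ∑ m : Zt n N, cz N p m • uz m := by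
  ext k
  rw [coeff_sum]
  by_cases hk : k.degree = N
  · rw [Finset.sum_eq_single (⟨k, hk⟩ : Zt n N)]
    · rw [coeff_smul, uz, coeff_monomial, if_pos rfl, cz, smul_eq_mul]
      have := sq_pos k
      field_simp
    · intro m _ hm
      rw [coeff_smul, uz, coeff_monomial, if_neg, smul_zero]
      intro h; exact hm (Subtype.ext h)
    · simp
  · rw [Finset.sum_eq_zero]
    · by_contra h
      have := hp h
      rw [wt1] at this
      exact hk this
    · intro m _
      rw [coeff_smul, uz, coeff_monomial, if_neg, smul_zero]
      intro h; exact hk (by rw [← h]; exact m.2)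

noncomputable def zm (N : ℕ) (e : Matrix (Io n) (Io n) ℝ) : Matrix (Zt n N) (Zt n N) ℝ :=
  fun m' m => cz N (D e (uz m)) m'

lemma zm_tr (N : ℕ) (e : Matrix (Io n) (Io n) ℝ) : (zm N e).transpose = zm N e.transpose := by
  ext m m'
  rw [Matrix.transpose_apply, zm, zm, cz_fis, cz_fis, fis_symm, fis_D]

lemma D_homog (e : Matrix (Io n) (Io n) ℝ) {N : ℕ} {p : Sr n}
    (hp : p ∈ homogeneousSubmodule (Io n) ℝ N) : D e p ∈ homogeneousSubmodule (Io n) ℝ N :=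
  D_wh 1 _ (fun _ _ _ => rfl) p N hp

lemma D_uz {N : ℕ} (e : Matrix (Io n) (Io n) ℝ) (m : Zt n N) :
    D e (uz m) = ∑ m', zm N e m' m • uz m' := cz_expand _ (D_homog e (uz_hom m))

lemma cz_D {N : ℕ} (e : Matrix (Io n) (Io n) ℝ) (f : Sr n)
    (hf : f ∈ homogeneousSubmodule (Io n) ℝ N) (m' : Zt n N) :
    cz N (D e f) m' = ∑ m, zm N e m' m * cz N f m := by
  conv_lhs => rw [cz_expand f hf]
  simp only [zm, cz_fis, map_sum, Derivation.map_smul, map_smul, smul_eq_mul]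
  exact Finset.sum_congr rfl fun m _ => mul_comm _ _

/-- the block matrices acting on the auxiliary variables -/
noncomputable def zb (N1 N2 : ℕ) (e : Matrix (Io n) (Io n) ℝ) :
    Matrix (Zt n N1 ⊕ Zt n N2) (Zt n N1 ⊕ Zt n N2) ℝ :=
  Matrix.fromBlocks (-(zm N1 e).transpose) 0 0 (-(zm N2 e).transpose)

noncomputable def aT (N1 N2 : ℕ) (g : Fin 3 × Fin n × Fin n) :
    Matrix ((Zt n N1 ⊕ Zt n N2) ⊕ Io n) ((Zt n N1 ⊕ Zt n N2) ⊕ Io n) ℝ :=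
  Matrix.fromBlocks (zb N1 N2 (em g.1 g.2.1 g.2.2)) 0 0 (em g.1 g.2.1 g.2.2)

lemma aT_tr (N1 N2 : ℕ) (g : Fin 3 × Fin n × Fin n) : ∃ g', aT N1 N2 g' = (aT N1 N2 g).transpose := by
  refine ⟨(g.1, g.2.2, g.2.1), ?_⟩
  rw [aT, aT, zb, zb, Matrix.fromBlocks_transpose, Matrix.fromBlocks_transpose, em_tr,
    Matrix.transpose_neg, Matrix.transpose_neg]
  simp only [zm_tr, em_tr, Matrix.transpose_zero]

def wT (N1 N2 : ℕ) : (Zt n N1 ⊕ Zt n N2) ⊕ Io n → ℕ × ℕ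
  | .inl (.inl _) => (1, 0)
  | .inl (.inr _) => (0, 1)
  | .inr _ => 0

lemma aT_w (N1 N2 : ℕ) (g : Fin 3 × Fin n × Fin n) (s' s : (Zt n N1 ⊕ Zt n N2) ⊕ Io n)
    (h : aT N1 N2 g s' s ≠ 0) : wT N1 N2 s' = wT N1 N2 s := by
  rcases s' with (s' | s') | s' <;> rcases s with (s | s) | s <;> first | rfl | simp [aT, zb] at h

abbrev Tr (n N1 N2 : ℕ) := MvPolynomial ((Zt n N1 ⊕ Zt n N2) ⊕ Io n) ℝ

variable {N1 N2 : ℕ}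

noncomputable def ev (f f' : Sr n) : Tr n N1 N2 →ₐ[ℝ] Sr n :=
  aeval (Sum.elim (fun z => C (Sum.elim (cz N1 f) (cz N2 f') z)) X)

lemma evD (f f' : Sr n) (hf : f ∈ homogeneousSubmodule (Io n) ℝ N1)
    (hf' : f' ∈ homogeneousSubmodule (Io n) ℝ N2) (g : Fin 3 × Fin n × Fin n) (c c' : ℝ)
    (hc : D (em g.1 g.2.1 g.2.2) f = c • f) (hc' : D (em g.1 g.2.1 g.2.2) f' = c' • f')
    (F : Tr n N1 N2) :
    ev f f' (D (aT N1 N2 g) F) = D (em g.1 g.2.1 g.2.2) (ev f f' F) -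
      ev f f' (D (Matrix.diagonal (Sum.elim (Sum.elim (fun _ => c) (fun _ => c')) (fun _ => 0))) F) := by
  induction F using MvPolynomial.induction_on with
  | C r => simp [ev]
  | add p q hp hq => simp only [map_add, hp, hq]; ring
  | mul_X p s hp =>
    have hX : ev f f' (D (aT N1 N2 g) (X s)) = D (em g.1 g.2.1 g.2.2) (ev f f' (X s)) -
      ev f f' (D (Matrix.diagonal (Sum.elim (Sum.elim (fun _ => c) (fun _ => c')) (fun _ => 0))) (X s)) := by
      have hdiag : ∀ (k : (Zt n N1 ⊕ Zt n N2) ⊕ Io n → ℝ), D (Matrix.diagonal k) (X s) = C (k s) * X s := by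
        intro k
        rw [D_X, Finset.sum_eq_single s]
        · rw [Matrix.diagonal_apply_eq]
        · intro b _ hb; rw [Matrix.diagonal_apply_ne _ hb]; simp
        · simp
      rw [hdiag]
      rcases s with s | s
      · have h1 : (X (Sum.inl s) : Tr n N1 N2) = rename Sum.inl (X s) := by rw [rename_X]
        conv_lhs => rw [h1, aT, D_inl, D_X]
        have h2 : ∀ t, ev f f' (X (Sum.inl t) : Tr n N1 N2) = C (Sum.elim (cz N1 f) (cz N2 f') t) := by
          intro t; simp [ev]
        have h3 : ∀ r, ev f f' (C r : Tr n N1 N2) = C r := by intro r; simp [ev]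
        simp only [map_sum, map_mul, rename_C, rename_X, h2, h3, derivation_C, zero_sub]
        rcases s with s | s
        · simp only [zb, Fintype.sum_sum_type, Matrix.fromBlocks_apply₁₁, Matrix.fromBlocks_apply₂₁,
            Matrix.neg_apply, Matrix.transpose_apply, Sum.elim_inl, Sum.elim_inr, Matrix.zero_apply,
            map_zero, zero_mul, Finset.sum_const_zero, add_zero]
          simp only [← map_mul, ← map_sum, ← map_neg]
          congr 1
          have := cz_D (em g.1 g.2.1 g.2.2) f hf s
          rw [hc] at this
          simp only [neg_mul, Finset.sum_neg_distrib, ← this]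
          simp only [cz, coeff_smul, smul_eq_mul]; ring
        · simp only [zb, Fintype.sum_sum_type, Matrix.fromBlocks_apply₁₂, Matrix.fromBlocks_apply₂₂,
            Matrix.neg_apply, Matrix.transpose_apply, Sum.elim_inl, Sum.elim_inr, Matrix.zero_apply,
            map_zero, zero_mul, Finset.sum_const_zero, zero_add]
          simp only [← map_mul, ← map_sum, ← map_neg]
          congr 1
          have := cz_D (em g.1 g.2.1 g.2.2) f' hf' s
          rw [hc'] at this
          simp only [neg_mul, Finset.sum_neg_distrib, ← this]
          simp only [cz, coeff_smul, smul_eq_mul]; ring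
      · have h1 : (X (Sum.inr s) : Tr n N1 N2) = rename Sum.inr (X s) := by rw [rename_X]
        have h2 : ∀ q : Sr n, ev f f' (rename Sum.inr q : Tr n N1 N2) = q := by
          intro q; rw [ev, aeval_rename, Sum.elim_comp_inr, aeval_X_left_apply]
        rw [h1, aT, D_inr, h2, h2]
        simp
    simp only [Derivation.leibniz, map_add, map_mul, smul_eq_mul, hp, hX]
    ring

end Zs
end Agu

namespace Agu
open MvPolynomial

section Fin3
variable {n N1 N2 : ℕ}

lemma wT_weight (m : (Zt n N1 ⊕ Zt n N2) ⊕ Io n →₀ ℕ) : Finsupp.weight (wT N1 N2) m =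
    (∑ s, m (Sum.inl (Sum.inl s)), ∑ s, m (Sum.inl (Sum.inr s))) := by
  rw [Finsupp.weight_apply, Finsupp.sum_fintype _ _ (by simp)]
  rw [Fintype.sum_sum_type, Fintype.sum_sum_type]
  ext <;> simp [wT, Prod.fst_sum, Prod.snd_sum]

lemma D_wT (c c' : ℝ) (d k : ℕ) (F : Tr n N1 N2) (hF : IsWeightedHomogeneous (wT N1 N2) F (d, k)) :
    D (Matrix.diagonal (Sum.elim (Sum.elim (fun _ => c) (fun _ => c')) (fun _ => 0))) F =
      (d * c + k * c') • F := by
  ext m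
  rw [D_diag_coeff, coeff_smul, smul_eq_mul]
  by_cases hm : F.coeff m = 0
  · rw [hm, mul_zero, mul_zero]
  have := hF hm
  rw [wT_weight] at this
  congr 1
  rw [Fintype.sum_sum_type, Fintype.sum_sum_type]
  have h1 := congrArg Prod.fst this
  have h2 := congrArg Prod.snd this
  simp only at h1 h2
  simp only [Sum.elim_inl, Sum.elim_inr, zero_mul, Finset.sum_const_zero, add_zero, ← Finset.mul_sum]
  rw [← h1, ← h2]; push_cast; ring

lemma ev_HT {ω χ : Fin 3 → Fin n → ℤ} {f f' : Sr n} (hf : f ∈ HT ω) (hf' : f' ∈ HT χ)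
    (h1 : f ∈ homogeneousSubmodule (Io n) ℝ N1) (h2 : f' ∈ homogeneousSubmodule (Io n) ℝ N2)
    {F : Tr n N1 N2} (hF : Inv (aT N1 N2) F) {d k : ℕ}
    (hw : IsWeightedHomogeneous (wT N1 N2) F (d, k)) : ev f f' F ∈ HT (d • ω + k • χ) := by
  rw [mem_HT] at hf hf' ⊢
  constructor
  · intro b i
    have := evD f f' h1 h2 (b, i, i) _ _ (hf.1 b i) (hf'.1 b i) F
    rw [hF, map_zero, D_wT _ _ d k F hw, map_smul] at this
    rw [Ee_apply, ← sub_eq_zero]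
    rw [this]
    simp
  · intro b i j hij
    have := evD f f' h1 h2 (b, i, j) 0 0 (by rw [zero_smul]; exact hf.2 b i j hij)
      (by rw [zero_smul]; exact hf'.2 b i j hij) F
    rw [hF, map_zero, D_wT _ _ d k F hw, map_smul] at this
    rw [Ee_apply, ← sub_eq_zero]
    simpa using this.symm

lemma ev_sz (f f' s : Sr n) (z) : ev f f' (rename Sum.inr s * rename Sum.inl z : Tr n N1 N2) =
    s * C (eval (Sum.elim (cz N1 f) (cz N2 f')) z) := by
  rw [map_mul]
  congr 1
  · rw [ev, aeval_rename, Sum.elim_comp_inr, aeval_X_left_apply]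
  · rw [ev, aeval_rename, Sum.elim_comp_inl]
    induction z using MvPolynomial.induction_on with
    | C a => simp
    | add p q hp hq => simp only [map_add, hp, hq]
    | mul_X p s h => simp only [map_mul, aeval_X, eval_X, h]

noncomputable def Th1 (n N1 N2 : ℕ) : Tr n N1 N2 :=
  ∑ m : Zt n N1, rename Sum.inr (uz m) * rename Sum.inl (X (Sum.inl m))
noncomputable def Th2 (n N1 N2 : ℕ) : Tr n N1 N2 :=
  ∑ m : Zt n N2, rename Sum.inr (uz m) * rename Sum.inl (X (Sum.inr m))

lemma ev_Th1 (f f' : Sr n) (h1 : f ∈ homogeneousSubmodule (Io n) ℝ N1) :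
    ev f f' (Th1 n N1 N2) = f := by
  conv_rhs => rw [cz_expand f h1]
  rw [Th1, map_sum]
  refine Finset.sum_congr rfl fun m _ => ?_
  rw [ev_sz, eval_X, Sum.elim_inl, mul_comm, smul_eq_C_mul]

lemma ev_Th2 (f f' : Sr n) (h1 : f' ∈ homogeneousSubmodule (Io n) ℝ N2) :
    ev f f' (Th2 n N1 N2) = f' := by
  conv_rhs => rw [cz_expand f' h1]
  rw [Th2, map_sum]
  refine Finset.sum_congr rfl fun m _ => ?_
  rw [ev_sz, eval_X, Sum.elim_inr, mul_comm, smul_eq_C_mul]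

lemma D_sz (g : Fin 3 × Fin n × Fin n) (s : Sr n) (z) :
    D (aT N1 N2 g) (rename Sum.inr s * rename Sum.inl z) =
      rename Sum.inr s * rename Sum.inl (D (zb N1 N2 (em g.1 g.2.1 g.2.2)) z) +
      rename Sum.inr (D (em g.1 g.2.1 g.2.2) s) * rename Sum.inl z := by
  rw [Derivation.leibniz, aT, D_inl, D_inr, smul_eq_mul, smul_eq_mul]
  ring

lemma Th1_inv : Inv (aT N1 N2) (Th1 n N1 N2) := by
  intro g
  rw [Th1, map_sum]
  simp only [D_sz]
  simp only [ D_uz, D_X, zb, Fintype.sum_sum_type, Matrix.fromBlocks_apply₁₁, Matrix.fromBlocks_apply₂₁,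
      Matrix.neg_apply, Matrix.transpose_apply, Matrix.zero_apply, map_zero, zero_mul,
      Finset.sum_const_zero, add_zero, Finset.sum_add_distrib, map_sum, map_neg, map_mul, rename_C,
      rename_X, Finset.mul_sum, Finset.sum_mul, map_smul]
  rw [Finset.sum_comm, ← Finset.sum_add_distrib]
  refine Finset.sum_eq_zero fun m _ => ?_
  rw [← Finset.sum_add_distrib]
  refine Finset.sum_eq_zero fun m' _ => ?_
  rw [smul_eq_C_mul]
  ring

lemma Th2_inv : Inv (aT N1 N2) (Th2 n N1 N2) := by
  intro g
  rw [Th2, map_sum]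
  simp only [D_sz]
  simp only [ D_uz, D_X, zb, Fintype.sum_sum_type, Matrix.fromBlocks_apply₁₂, Matrix.fromBlocks_apply₂₂,
      Matrix.neg_apply, Matrix.transpose_apply, Matrix.zero_apply, map_zero, zero_mul,
      Finset.sum_const_zero, zero_add, Finset.sum_add_distrib, map_sum, map_neg, map_mul, rename_C,
      rename_X, Finset.mul_sum, Finset.sum_mul, map_smul]
  rw [Finset.sum_comm, ← Finset.sum_add_distrib]
  refine Finset.sum_eq_zero fun m _ => ?_
  rw [← Finset.sum_add_distrib]
  refine Finset.sum_eq_zero fun m' _ => ?_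
  rw [smul_eq_C_mul]
  ring

lemma inr_wh (s : Sr n) : IsWeightedHomogeneous (wT N1 N2) (rename Sum.inr s : Tr n N1 N2) 0 := by
  induction s using MvPolynomial.induction_on with
  | C a => rw [rename_C]; exact isWeightedHomogeneous_C _ _
  | add p q hp hq => rw [map_add]; exact hp.add hq
  | mul_X p s h =>
    rw [map_mul, rename_X]
    have := h.mul (isWeightedHomogeneous_X ℝ (wT N1 N2) (Sum.inr s))
    simpa [wT] using this

lemma Th1_wh : IsWeightedHomogeneous (wT N1 N2) (Th1 n N1 N2) (1, 0) := by
  rw [Th1]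
  refine IsWeightedHomogeneous.sum _ _ _ fun m _ => ?_
  rw [rename_X]
  simpa [wT] using (inr_wh (uz m)).mul (isWeightedHomogeneous_X ℝ (wT N1 N2) (Sum.inl (Sum.inl m)))

lemma Th2_wh : IsWeightedHomogeneous (wT N1 N2) (Th2 n N1 N2) (0, 1) := by
  rw [Th2]
  refine IsWeightedHomogeneous.sum _ _ _ fun m _ => ?_
  rw [rename_X]
  simpa [wT] using (inr_wh (uz m)).mul (isWeightedHomogeneous_X ℝ (wT N1 N2) (Sum.inl (Sum.inr m)))

lemma exists_Psi (ψ : Module.End ℝ (Sr n)) (hψ : ∀ b i j v, ψ (Ee b i j v) = Ee b i j (ψ v)) (f f' : Sr n) :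
    ∃ Ψ : Module.End ℝ (Tr n N1 N2), (∀ F, Inv (aT N1 N2) F → Inv (aT N1 N2) (Ψ F)) ∧
      (∀ F, ev f f' (Ψ F) = ψ (ev f f' F)) ∧
      ∀ F d, IsWeightedHomogeneous (wT N1 N2) F d → IsWeightedHomogeneous (wT N1 N2) (Ψ F) d := by
  obtain ⟨Ψ, h⟩ := exists_ext (ζ := Zt n N1 ⊕ Zt n N2) ψ
  refine ⟨Ψ, ?_, ?_, ?_⟩
  · intro F hF g
    have : ∀ F, Ψ (D (aT N1 N2 g) F) = D (aT N1 N2 g) (Ψ F) := by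
      refine T_ind _ (fun p q hp hq => by simp only [map_add, hp, hq]) fun s z => ?_
      rw [D_sz, map_add, h, h, h, D_sz]
      congr 3
      exact hψ _ _ _ _
    rw [← this, hF, map_zero]
  · refine T_ind _ (fun p q hp hq => by simp only [map_add, hp, hq]) fun s z => ?_
    rw [h, ev_sz, ev_sz, mul_comm s, mul_comm (ψ s), ← smul_eq_C_mul, ← smul_eq_C_mul, map_smul]
  · intro F d hF
    rw [F.as_sum, map_sum]
    refine IsWeightedHomogeneous.sum _ _ _ fun m hm => ?_
    have hm := hF (mem_support_iff.1 hm)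
    rw [mon_split, h]
    have e : Finsupp.weight (wT N1 N2) m = 0 + Finsupp.weight (fun z => wT N1 N2 (Sum.inl z))
        (Finsupp.sumFinsuppEquivProdFinsupp m).1 := by
      rw [zero_add, Finsupp.weight_apply, Finsupp.weight_apply, Finsupp.sum_fintype _ _ (by simp),
        Finsupp.sum_fintype _ _ (by simp), Fintype.sum_sum_type]
      simp [wT]
    rw [← hm, e]
    refine (inr_wh _).mul ?_
    rw [rename_monomial]
    refine isWeightedHomogeneous_monomial _ _ _ ?_
    rw [Finsupp.weight_apply, Finsupp.weight_apply, Finsupp.sum_mapDomain_index (by simp)]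
    intro b m1 m2; rw [add_smul]

lemma HT_mul {χ1 χ2 : Fin 3 → Fin n → ℤ} {p q : Sr n} (hp : p ∈ HT χ1) (hq : q ∈ HT χ2) :
    p * q ∈ HT (χ1 + χ2) := by
  rw [mem_HT] at *
  constructor
  · intro b i
    have h1 := hp.1 b i
    have h2 := hq.1 b i
    rw [Ee_apply] at *
    rw [Derivation.leibniz, h1, h2]
    simp only [smul_eq_mul, smul_eq_C_mul, Pi.add_apply, Int.cast_add, map_add]
    ring
  · intro b i j hij
    have h1 := hp.2 b i j hij
    have h2 := hq.2 b i j hij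
    rw [Ee_apply] at *
    rw [Derivation.leibniz, h1, h2, smul_zero, smul_zero, add_zero]

lemma HT_one : (1 : Sr n) ∈ HT (0 : Fin 3 → Fin n → ℤ) := by
  rw [mem_HT]
  constructor
  · intro b i; rw [Ee_apply]; simp
  · intro b i j _; rw [Ee_apply]; simp

lemma HT_pow {χ : Fin 3 → Fin n → ℤ} {p : Sr n} (hp : p ∈ HT χ) (d : ℕ) : p ^ d ∈ HT (d • χ) := by
  induction d with
  | zero => simpa using HT_one
  | succ d ih => rw [pow_succ, succ_nsmul]; exact HT_mul ih hp

lemma HT_hom (χ : Fin 3 → Fin n → ℤ) : ∃ d : ℕ, HT χ ≤ homogeneousSubmodule (Io n) ℝ d := by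
  by_cases h : ∃ p ∈ HT χ, p ≠ 0
  · obtain ⟨m2, h2, h0⟩ := h
    obtain ⟨d, hd⟩ : ∃ d : ℕ, ∑ i, χ 2 i = d := by
      obtain ⟨m, hm⟩ := ne_zero_iff.1 h0
      have := (mem_WS 2 (χ 2) m2).1 (HW_le_WS 2 _ h2.2) m hm
      exact ⟨∑ i, mg m 2 i, by push_cast; exact Finset.sum_congr rfl fun i _ => (this i).symm⟩
    exact ⟨d, fun u hu => WS_hom _ d hd (HW_le_WS 2 _ hu.2)⟩
  · push Not at h
    exact ⟨0, fun p hp => by rw [h p hp]; exact zero_mem _⟩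

instance HT_fd (χ : Fin 3 → Fin n → ℤ) : FiniteDimensional ℝ (HT χ) := by
  obtain ⟨d, hd⟩ := HT_hom χ
  exact Submodule.finiteDimensional_of_le hd

theorem HT_bound {ω χ : Fin 3 → Fin n → ℤ} {f f' : Sr n} (hf : f ∈ HT ω) (hf' : f' ∈ HT χ)
    (h0 : f ≠ 0) (h0' : f' ≠ 0) (C : ℕ) (hC : ∀ e : ℕ, Module.finrank ℝ (HT (e • ω)) ≤ C) :
    ∃ B : ℕ, ∀ d : ℕ, Module.finrank ℝ (HT (d • ω + χ)) ≤ B := by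
  obtain ⟨N1, hN1⟩ := HT_hom ω
  obtain ⟨N2, hN2⟩ := HT_hom χ
  obtain ⟨s, dg, hs, hs'⟩ := hilb (aT_tr (n := n) N1 N2) (wT N1 N2) (aT_w N1 N2)
  refine ⟨s.card * C, fun d => ?_⟩
  let L : ((x : s) → HT ((d - dg x) • ω)) →ₗ[ℝ] Sr n :=
    ∑ x : s, (LinearMap.mulRight ℝ (ev f f' x.1)) ∘ₗ (HT ((d - dg x) • ω)).subtype ∘ₗ LinearMap.proj x
  have hle : HT (d • ω + χ) ≤ LinearMap.range L := by
    intro m hm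
    have hm2 : f ^ d * f' ∈ HT (d • ω + χ) := HT_mul (HT_pow hf d) hf'
    obtain ⟨ψ, h1, h2⟩ := intertwiner hm hm2 (mul_ne_zero (pow_ne_zero _ h0) h0')
    obtain ⟨Ψ, p1, p2, p3⟩ := exists_Psi (N1 := N1) (N2 := N2) ψ h1 f f'
    have hTi : ∀ d, Inv (aT N1 N2) (Th1 n N1 N2 ^ d * Th2 n N1 N2) := by
      intro d
      induction d with
      | zero => simpa using Th2_inv
      | succ d ih => rw [pow_succ', mul_assoc]; exact Th1_inv.mul ih
    have hTw : IsWeightedHomogeneous (wT N1 N2) (Th1 n N1 N2 ^ d * Th2 n N1 N2) (d, 1) := by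
      have := (Th1_wh (n := n) (N1 := N1) (N2 := N2)).pow d |>.mul Th2_wh
      simpa using this
    obtain ⟨t, ht, hF⟩ := hs' _ d (p1 _ (hTi d)) (p3 _ _ hTw)
    have hev : m = ev f f' (Ψ (Th1 n N1 N2 ^ d * Th2 n N1 N2)) := by
      rw [p2, map_mul, map_pow, ev_Th1 f f' (hN1 hf), ev_Th2 f f' (hN2 hf'), h2]
    refine ⟨fun x => ⟨ev f f' (t x), ?_⟩, ?_⟩
    · obtain ⟨q1, q2, q3⟩ := ht x x.2
      by_cases h : dg x ≤ d
      · have := ev_HT hf hf' (hN1 hf) (hN2 hf') q1 (q2 h)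
        simpa using this
      · rw [q3 h, map_zero]; exact zero_mem _
    · rw [hev, hF, map_sum, ← Finset.sum_coe_sort]
      simp only [L, LinearMap.sum_apply, LinearMap.comp_apply, LinearMap.proj_apply,
        Submodule.subtype_apply, LinearMap.mulRight_apply, map_mul]
  calc Module.finrank ℝ (HT (d • ω + χ)) ≤ Module.finrank ℝ (LinearMap.range L) :=
        Submodule.finrank_mono hle
    _ ≤ Module.finrank ℝ ((x : s) → HT ((d - dg x) • ω)) := LinearMap.finrank_range_le L
    _ = ∑ x : s, Module.finrank ℝ (HT ((d - dg x) • ω)) := Module.finrank_pi_fintype ℝ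
    _ ≤ ∑ x : s, C := Finset.sum_le_sum fun x _ => hC _
    _ = _ := by simp

lemma HT_mono {ω χ : Fin 3 → Fin n → ℤ} {f : Sr n} (hf : f ∈ HT ω) (h0 : f ≠ 0) :
    Module.finrank ℝ (HT χ) ≤ Module.finrank ℝ (HT (ω + χ)) := by
  let L : HT χ →ₗ[ℝ] HT (ω + χ) := ((LinearMap.mulLeft ℝ f) ∘ₗ (HT χ).subtype).codRestrict _
    (fun x => HT_mul hf x.2)
  apply LinearMap.finrank_le_finrank_of_injective (f := L)
  intro x y h
  have : f * x.1 = f * y.1 := congrArg Subtype.val h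
  exact Subtype.ext (mul_left_cancel₀ h0 this)

theorem HT_stable (ω χ : Fin 3 → Fin n → ℤ) (h1 : ∀ d : ℕ, 0 < d → Module.finrank ℝ (HT (d • ω)) = 1) :
    ∃ N : ℕ, ∀ d, N ≤ d → Module.finrank ℝ (HT (χ + d • ω)) = Module.finrank ℝ (HT (χ + N • ω)) := by
  obtain ⟨f, hf, h0⟩ : ∃ f ∈ HT ω, f ≠ 0 := by
    by_contra h
    push Not at h
    have e := h1 1 one_pos
    rw [one_smul, (Submodule.eq_bot_iff _).2 h] at e
    simp at e
  by_cases hz : ∀ d : ℕ, Module.finrank ℝ (HT (χ + d • ω)) = 0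
  · exact ⟨0, fun d _ => by rw [hz, hz]⟩
  push Not at hz
  obtain ⟨d0, hd0⟩ := hz
  obtain ⟨f', hf', h0'⟩ : ∃ f ∈ HT (χ + d0 • ω), f ≠ 0 := by
    by_contra h
    push Not at h
    apply hd0
    rw [(Submodule.eq_bot_iff _).2 h]
    simp
  obtain ⟨B, hB⟩ := HT_bound hf hf' h0 h0' (1 + Module.finrank ℝ (HT ((0 : ℕ) • ω))) (fun e => by
    rcases Nat.eq_zero_or_pos e with rfl | he
    · omega
    · rw [h1 e he]; omega)
  have hmono : Monotone (fun d : ℕ => Module.finrank ℝ (HT (χ + d • ω))) := by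
    refine monotone_nat_of_le_succ fun d => ?_
    have := HT_mono (χ := χ + d • ω) hf h0
    refine this.trans_eq ?_
    have e : ω + (χ + d • ω) = χ + (d + 1) • ω := by rw [succ_nsmul]; abel
    rw [e]
  have hB' : ∀ d : ℕ, Module.finrank ℝ (HT (χ + d • ω)) ≤ B := by
    intro d
    refine (hmono (Nat.le_add_left d d0)).trans ?_
    have := hB d
    have e : d • ω + (χ + d0 • ω) = χ + (d0 + d) • ω := by rw [add_nsmul]; abel
    rwa [e] at this
  -- bounded monotone sequence of naturals
  have hex : ∃ v, ∃ N : ℕ, Module.finrank ℝ (HT (χ + N • ω)) + v = B :=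
    ⟨B - Module.finrank ℝ (HT (χ + 0 • ω)), 0, by have := hB' 0; omega⟩
  obtain ⟨N, hN⟩ := Nat.find_spec hex
  refine ⟨N, fun d hd => ?_⟩
  have m1 := hmono hd
  have m2 := hB' d
  simp only at m1
  have := Nat.find_min' hex (m := B - Module.finrank ℝ (HT (χ + d • ω))) ⟨d, by omega⟩
  omega

end Fin3
end Agu

namespace Agu
open MvPolynomial

section Count
variable {X Y Z : Type} [Fintype X] [Fintype Y] [Fintype Z]

/-- number of elements in a fibre -/
noncomputable def cnt (F : X → Y) (y : Y) : ℕ := (Finset.univ.filter fun x => F x = y).card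

/-- indicator of being fixed -/
noncomputable def fx (g : Equiv.Perm X) (F : X → Y) : ℤ := if F ∘ g = F then 1 else 0

lemma cnt_sum (F : X → Y) : ∑ y, cnt F y = Fintype.card X := by
  unfold cnt
  rw [← Finset.card_eq_sum_card_fiberwise (f := F) (s := Finset.univ) (t := Finset.univ) (by simp)]
  rfl

lemma cnt_equiv (F : X → Y) (e : Z ≃ X) : cnt (F ∘ e) = cnt F := by
  funext y
  unfold cnt
  refine Finset.card_bij (fun x _ => e x) (by simp) (by simp) ?_
  intro b hb
  exact ⟨e.symm b, by simpa using hb, by simp⟩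

lemma exists_cnt (m : Y → ℕ) (hm : ∑ y, m y = Fintype.card X) : ∃ F : X → Y, cnt F = m := by
  have e : X ≃ Σ y, Fin (m y) := Fintype.equivOfCardEq (by simp [hm])
  refine ⟨fun x => (e x).1, ?_⟩
  funext y
  have := congrFun (cnt_equiv (fun z : (Σ y, Fin (m y)) => z.1) e) y
  rw [show (fun x => (e x).1) = (fun z : (Σ y, Fin (m y)) => z.1) ∘ e from rfl, this, cnt]
  rw [← Fintype.card_subtype, Fintype.card_congr (Equiv.sigmaSubtype (β := fun y => Fin (m y)) y)]
  simp

lemma cnt_iff (F F' : X → Y) : cnt F = cnt F' ↔ ∃ g : Equiv.Perm X, F ∘ g = F' := by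
  constructor
  · intro h
    have e : ∀ y, {a // F' a = y} ≃ {b // F b = y} := fun y => Fintype.equivOfCardEq (by
      rw [Fintype.card_subtype, Fintype.card_subtype]
      exact (congrFun h y).symm)
    exact ⟨Equiv.ofFiberEquiv e, funext fun x => Equiv.ofFiberEquiv_map e x⟩
  · rintro ⟨g, rfl⟩
    rw [cnt_equiv]

lemma sum_fx (m : Y → ℕ) (hm : ∑ y, m y = Fintype.card X) :
    ∑ F ∈ Finset.univ.filter (fun F : X → Y => cnt F = m), ∑ g, fx g F = ((Fintype.card X).factorial : ℤ) := by
  obtain ⟨F0, h0⟩ := exists_cnt m hm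
  have key : ∀ F ∈ Finset.univ.filter (fun F : X → Y => cnt F = m), ∑ g, fx g F =
      ((Finset.univ.filter (fun g : Equiv.Perm X => F0 ∘ g = F)).card : ℤ) := by
    intro F hF
    simp only [Finset.mem_filter, Finset.mem_univ, true_and] at hF
    obtain ⟨g1, rfl⟩ := (cnt_iff F0 F).1 (h0.trans hF.symm)
    rw [Finset.card_filter]
    push_cast
    rw [← Equiv.sum_comp (Equiv.mulLeft g1) (fun g : Equiv.Perm X => if F0 ∘ g = F0 ∘ g1 then (1:ℤ) else 0)]
    refine Finset.sum_congr rfl fun g _ => ?_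
    simp only [fx, Equiv.coe_mulLeft, Equiv.Perm.coe_mul, Function.comp_assoc]
    congr!
  rw [Finset.sum_congr rfl key, ← Nat.cast_sum, ← Finset.card_eq_sum_card_fiberwise
    (f := fun g : Equiv.Perm X => F0 ∘ g) (s := Finset.univ)]
  · rw [Finset.card_univ, Fintype.card_perm]
  · intro g _
    simp only [Finset.coe_filter, Finset.mem_univ, true_and, Set.mem_setOf_eq]
    rw [cnt_equiv, h0]

lemma burn (w : (Y → ℕ) → ℤ) : ∑ g : Equiv.Perm X, ∑ F : X → Y, fx g F * w (cnt F) =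
    ((Fintype.card X).factorial : ℤ) * ∑ m ∈ Finset.piAntidiag Finset.univ (Fintype.card X), w m := by
  rw [Finset.sum_comm, ← Finset.sum_fiberwise_of_maps_to (s := Finset.univ) (g := fun F : X → Y => cnt F)
    (t := Finset.piAntidiag Finset.univ (Fintype.card X)), Finset.mul_sum]
  · refine Finset.sum_congr rfl fun m hm => ?_
    rw [Finset.mem_piAntidiag] at hm
    rw [← sum_fx m hm.1, Finset.sum_mul]
    refine Finset.sum_congr rfl fun F hF => ?_
    rw [Finset.sum_mul]
    refine Finset.sum_congr rfl fun g hg => ?_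
    rw [(Finset.mem_filter.1 hF).2]
  · intro F _
    rw [Finset.mem_piAntidiag]
    exact ⟨cnt_sum F, by simp⟩

lemma cnt_comp {W : Type} [Fintype W] (φ : Y → W) (F : X → Y) (z : W) :
    cnt (φ ∘ F) z = ∑ y, if φ y = z then cnt F y else 0 := by
  simp only [cnt, Finset.card_filter, Function.comp]
  have : ∀ y, (if φ y = z then ∑ x, (if F x = y then 1 else 0) else 0) =
      ∑ x, if F x = y then (if φ (F x) = z then 1 else 0) else 0 := by
    intro y
    split_ifs with h
    · refine Finset.sum_congr rfl fun x _ => ?_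
      by_cases hx : F x = y
      · subst hx; simp [h]
      · simp [hx]
    · symm
      refine Finset.sum_eq_zero fun x _ => ?_
      by_cases hx : F x = y
      · subst hx; simp [h]
      · simp [hx]
  simp only [this]
  rw [Finset.sum_comm]
  refine Finset.sum_congr rfl fun x _ => ?_
  simp

lemma cnt_elim {V : Type} [Fintype V] (u : X → Y) (v : V → Y) (y : Y) :
    cnt (Sum.elim u v) y = cnt u y + cnt v y := by
  simp only [cnt, Finset.card_filter, Fintype.sum_sum_type, Sum.elim_inl, Sum.elim_inr]
  congr!

lemma ind_mul {p q r : Prop} {_ : Decidable p} {_ : Decidable q} {_ : Decidable r} (h : p ↔ q ∧ r) :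
    (if p then (1 : ℤ) else 0) = (if q then 1 else 0) * (if r then 1 else 0) := by
  by_cases hq : q <;> by_cases hr : r <;> simp [h, hq, hr]

lemma fx_elim {V : Type} [Fintype V] (g : Equiv.Perm X) (h : Equiv.Perm V) (f : X ⊕ V → Y) :
    fx (Equiv.sumCongr g h) f = fx g (f ∘ Sum.inl) * fx h (f ∘ Sum.inr) := by
  unfold fx
  apply ind_mul
  constructor
  · intro e
    exact ⟨funext fun x => congrFun e (Sum.inl x), funext fun x => congrFun e (Sum.inr x)⟩
  · rintro ⟨e1, e2⟩
    funext x
    rcases x with x | x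
    exacts [congrFun e1 x, congrFun e2 x]

lemma fx_prod (g : Equiv.Perm X) (f : X → Y) (f' : X → Z) :
    fx g (fun x => (f x, f' x)) = fx g f * fx g f' := by
  unfold fx
  apply ind_mul
  simp only [funext_iff, Function.comp, Prod.mk.injEq, forall_and]

end Count
end Agu

namespace Agu
open MvPolynomial

section Yc
variable {n : ℕ}

noncomputable def mt (c : Fin n → ℕ) (a : Fin n → ℤ) : ℤ := if ∀ i, (c i : ℤ) = a i then 1 else 0

noncomputable def yc (X : Type) [Fintype X] (a : Fin n → ℤ) (g : Equiv.Perm X) : ℤ :=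
  ∑ f : X → Fin n, fx g f * mt (cnt f) a

variable {P Q R : Type} [Fintype P] [Fintype Q] [Fintype R]

def tri (n : ℕ) (P Q R : Type) : ((P → Fin n × Fin n) × (Q → Fin n × Fin n × Fin n) × (R → Fin n × Fin n)) ≃
    ((P ⊕ Q → Fin n) × (Q ⊕ R → Fin n) × (P ⊕ (Q ⊕ R) → Fin n)) where
  toFun t := (Sum.elim (fun x => (t.1 x).1) (fun x => (t.2.1 x).1),
    Sum.elim (fun x => (t.2.1 x).2.1) (fun x => (t.2.2 x).1),
    Sum.elim (fun x => (t.1 x).2) (Sum.elim (fun x => (t.2.1 x).2.2) (fun x => (t.2.2 x).2)))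
  invFun s := (fun x => (s.1 (.inl x), s.2.2 (.inl x)),
    fun x => (s.1 (.inr x), s.2.1 (.inl x), s.2.2 (.inr (.inl x))),
    fun x => (s.2.1 (.inr x), s.2.2 (.inr (.inr x))))
  left_inv t := rfl
  right_inv s := by
    refine Prod.ext (funext ?_) (Prod.ext (funext ?_) (funext ?_))
    · rintro (x | x) <;> rfl
    · rintro (x | x) <;> rfl
    · rintro (x | x | x) <;> rfl

noncomputable def comb (a : Fin n × Fin n → ℕ) (b : Fin n × Fin n × Fin n → ℕ) (c : Fin n × Fin n → ℕ) :
    Io n →₀ ℕ := Finsupp.equivFunOnFinite.symm (Sum.elim a (Sum.elim b c))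

lemma mg_comb (a : Fin n × Fin n → ℕ) (b : Fin n × Fin n × Fin n → ℕ) (c : Fin n × Fin n → ℕ) (i : Fin n) :
    mg (comb a b c) 0 i = (∑ y, if y.1 = i then a y else 0) + (∑ y, if y.1 = i then b y else 0) ∧
    mg (comb a b c) 1 i = (∑ y, if y.2.1 = i then b y else 0) + (∑ y, if y.1 = i then c y else 0) ∧
    mg (comb a b c) 2 i = (∑ y, if y.2 = i then a y else 0) + ((∑ y, if y.2.2 = i then b y else 0) +
      (∑ y, if y.2 = i then c y else 0)) := by
  unfold mg comb
  simp only [Fintype.sum_sum_type, co]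
  refine ⟨?_, ?_, ?_⟩ <;> simp

lemma mt3 (U : P → Fin n × Fin n) (V : Q → Fin n × Fin n × Fin n) (W : R → Fin n × Fin n)
    (a b c : Fin n → ℤ) :
    mt (cnt (tri n P Q R (U, V, W)).1) a * mt (cnt (tri n P Q R (U, V, W)).2.1) b *
      mt (cnt (tri n P Q R (U, V, W)).2.2) c =
    if ∀ β i, (mg (comb (cnt U) (cnt V) (cnt W)) β i : ℤ) = ![a, b, c] β i then 1 else 0 := by
  have h1 : ∀ i, cnt (tri n P Q R (U, V, W)).1 i = mg (comb (cnt U) (cnt V) (cnt W)) 0 i := by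
    intro i
    rw [(mg_comb _ _ _ i).1]
    change cnt (Sum.elim ((fun y => y.1) ∘ U) ((fun y => y.1) ∘ V)) i = _
    rw [cnt_elim, cnt_comp, cnt_comp]
    congr!
  have h2 : ∀ i, cnt (tri n P Q R (U, V, W)).2.1 i = mg (comb (cnt U) (cnt V) (cnt W)) 1 i := by
    intro i
    rw [(mg_comb _ _ _ i).2.1]
    change cnt (Sum.elim ((fun y => y.2.1) ∘ V) ((fun y => y.1) ∘ W)) i = _
    rw [cnt_elim, cnt_comp, cnt_comp]
    congr!
  have h3 : ∀ i, cnt (tri n P Q R (U, V, W)).2.2 i = mg (comb (cnt U) (cnt V) (cnt W)) 2 i := by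
    intro i
    rw [(mg_comb _ _ _ i).2.2]
    change cnt (Sum.elim ((fun y => y.2) ∘ U) (Sum.elim ((fun y => y.2.2) ∘ V) ((fun y => y.2) ∘ W))) i = _
    rw [cnt_elim, cnt_elim, cnt_comp, cnt_comp, cnt_comp]
    congr!
  simp only [mt, h1, h2, h3]
  rw [← @ind_mul _ _ _ (Classical.propDecidable _) _ _ Iff.rfl,
    ← @ind_mul _ _ _ (Classical.propDecidable _) _ _ Iff.rfl]
  have : (∀ β i, (mg (comb (cnt U) (cnt V) (cnt W)) β i : ℤ) = ![a, b, c] β i) ↔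
      ((∀ i, (mg (comb (cnt U) (cnt V) (cnt W)) 0 i : ℤ) = a i) ∧
      (∀ i, (mg (comb (cnt U) (cnt V) (cnt W)) 1 i : ℤ) = b i)) ∧
      (∀ i, (mg (comb (cnt U) (cnt V) (cnt W)) 2 i : ℤ) = c i) := by
    constructor
    · intro h
      exact ⟨⟨h 0, h 1⟩, h 2⟩
    · rintro ⟨⟨h0, h1⟩, h2⟩ β
      fin_cases β
      exacts [h0, h1, h2]
  simp only [this]
  congr!

lemma fx3 (U : P → Fin n × Fin n) (V : Q → Fin n × Fin n × Fin n) (W : R → Fin n × Fin n)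
    (g : Equiv.Perm P) (h : Equiv.Perm Q) (k : Equiv.Perm R) :
    fx (Equiv.sumCongr g h) (tri n P Q R (U, V, W)).1 * fx (Equiv.sumCongr h k) (tri n P Q R (U, V, W)).2.1 *
      fx (Equiv.sumCongr g (Equiv.sumCongr h k)) (tri n P Q R (U, V, W)).2.2 = fx g U * fx h V * fx k W := by
  have e1 := fx_prod g (fun x => (U x).1) (fun x => (U x).2)
  have e2 := fx_prod h (fun x => (V x).1) (fun x => (V x).2)
  have e3 := fx_prod h (fun x => (V x).2.1) (fun x => (V x).2.2)
  have e4 := fx_prod k (fun x => (W x).1) (fun x => (W x).2)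
  change fx g U = _ at e1
  change fx h V = fx h _ * fx h (fun x => (V x).2) at e2
  change fx h (fun x => (V x).2) = _ at e3
  change fx k W = _ at e4
  rw [fx_elim, fx_elim, fx_elim, fx_elim]
  change fx g (fun x => (U x).1) * fx h (fun x => (V x).1) * (fx h (fun x => (V x).2.1) *
    fx k (fun x => (W x).1)) * (fx g (fun x => (U x).2) * (fx h (fun x => (V x).2.2) *
    fx k (fun x => (W x).2))) = _
  rw [e1, e2, e3, e4]
  ring

lemma yc3 (a b c : Fin n → ℤ) (g : Equiv.Perm P) (h : Equiv.Perm Q) (k : Equiv.Perm R) :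
    yc (P ⊕ Q) a (Equiv.sumCongr g h) * yc (Q ⊕ R) b (Equiv.sumCongr h k) *
      yc (P ⊕ (Q ⊕ R)) c (Equiv.sumCongr g (Equiv.sumCongr h k)) =
    ∑ U : P → Fin n × Fin n, ∑ V : Q → Fin n × Fin n × Fin n, ∑ W : R → Fin n × Fin n,
      fx g U * (fx h V * (fx k W *
      if ∀ β i, (mg (comb (cnt U) (cnt V) (cnt W)) β i : ℤ) = ![a, b, c] β i then 1 else 0)) := by
  have e : ∀ U V W, fx g U * (fx h V * (fx k W *
      if ∀ β i, (mg (comb (cnt U) (cnt V) (cnt W)) β i : ℤ) = ![a, b, c] β i then 1 else 0)) =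
      (fx (Equiv.sumCongr g h) (tri n P Q R (U, V, W)).1 * mt (cnt (tri n P Q R (U, V, W)).1) a) *
      ((fx (Equiv.sumCongr h k) (tri n P Q R (U, V, W)).2.1 * mt (cnt (tri n P Q R (U, V, W)).2.1) b) *
      (fx (Equiv.sumCongr g (Equiv.sumCongr h k)) (tri n P Q R (U, V, W)).2.2 *
        mt (cnt (tri n P Q R (U, V, W)).2.2) c)) := by
    intro U V W
    rw [← mt3]
    rw [← mul_assoc, ← mul_assoc, ← fx3]
    ring
  simp only [e]
  simp only [yc]
  simp only [← Fintype.sum_prod_type']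
  rw [Equiv.sum_comp (tri n P Q R) (fun t : (P ⊕ Q → Fin n) × (Q ⊕ R → Fin n) × (P ⊕ (Q ⊕ R) → Fin n) =>
    fx (Equiv.sumCongr g h) t.1 * mt (cnt t.1) a *
      (fx (Equiv.sumCongr h k) t.2.1 * mt (cnt t.2.1) b *
        (fx (Equiv.sumCongr g (Equiv.sumCongr h k)) t.2.2 * mt (cnt t.2.2) c)))]
  rw [Fintype.sum_prod_type, mul_assoc, Finset.sum_mul]
  refine Finset.sum_congr (by congr!) fun f1 _ => ?_
  rw [Fintype.sum_prod_type, Finset.sum_mul, Finset.mul_sum]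
  refine Finset.sum_congr (by congr!) fun f2 _ => ?_
  rw [Finset.mul_sum, Finset.mul_sum]
  congr!

lemma re6 {A B C A' B' C' : Type} [Fintype A] [Fintype B] [Fintype C] [Fintype A'] [Fintype B'] [Fintype C']
    (F : A → B → C → A' → B' → C' → ℤ) : ∑ a, ∑ b, ∑ c, ∑ a', ∑ b', ∑ c', F a b c a' b' c' =
      ∑ a, ∑ a', ∑ b, ∑ b', ∑ c, ∑ c', F a b c a' b' c' := by
  refine Finset.sum_congr rfl fun a _ => ?_
  have : ∀ b, ∑ c, ∑ a', ∑ b', ∑ c', F a b c a' b' c' = ∑ a', ∑ b', ∑ c, ∑ c', F a b c a' b' c' := by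
    intro b
    rw [Finset.sum_comm]
    exact Finset.sum_congr rfl fun a' _ => Finset.sum_comm
  simp only [this]
  exact Finset.sum_comm

set_option maxHeartbeats 1000000 in
theorem yc_sum (a b c : Fin n → ℤ) (ha : ∑ i, a i = Fintype.card P + Fintype.card Q)
    (hb : ∑ i, b i = Fintype.card Q + Fintype.card R)
    (hc : ∑ i, c i = Fintype.card P + Fintype.card Q + Fintype.card R) :
    ∑ g : Equiv.Perm P, ∑ h : Equiv.Perm Q, ∑ k : Equiv.Perm R,
      yc (P ⊕ Q) a (Equiv.sumCongr g h) * yc (Q ⊕ R) b (Equiv.sumCongr h k) *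
      yc (P ⊕ (Q ⊕ R)) c (Equiv.sumCongr g (Equiv.sumCongr h k)) =
    (Fintype.card P).factorial * ((Fintype.card Q).factorial * ((Fintype.card R).factorial * (Nm ![a, b, c] : ℤ))) := by
  simp only [yc3]
  rw [re6]
  simp only [← Finset.mul_sum]
  rw [burn (fun m : Fin n × Fin n → ℕ => ∑ h : Equiv.Perm Q, ∑ V : Q → Fin n × Fin n × Fin n,
       fx h V * ∑ k : Equiv.Perm R, ∑ W : R → Fin n × Fin n, fx k W *
      if ∀ β i, (mg (comb m (cnt V) (cnt W)) β i : ℤ) = ![a, b, c] β i then 1 else 0)]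
  have e2 : ∀ m : Fin n × Fin n → ℕ, ∑ h : Equiv.Perm Q, ∑ V : Q → Fin n × Fin n × Fin n,
       fx h V * ∑ k : Equiv.Perm R, ∑ W : R → Fin n × Fin n, fx k W *
      (if ∀ β i, (mg (comb m (cnt V) (cnt W)) β i : ℤ) = ![a, b, c] β i then 1 else 0) =
      (Fintype.card Q).factorial * ((Fintype.card R).factorial *
        ∑ m' ∈ Finset.piAntidiag Finset.univ (Fintype.card Q), ∑ m'' ∈ Finset.piAntidiag Finset.univ (Fintype.card R),
          if ∀ β i, (mg (comb m m' m'') β i : ℤ) = ![a, b, c] β i then 1 else 0) := by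
    intro m
    rw [burn (fun m' : Fin n × Fin n × Fin n → ℕ => ∑ k : Equiv.Perm R, ∑ W : R → Fin n × Fin n, fx k W *
      if ∀ β i, (mg (comb m m' (cnt W)) β i : ℤ) = ![a, b, c] β i then 1 else 0)]
    congr 1
    rw [Finset.mul_sum]
    refine Finset.sum_congr (by congr!) fun m' _ => ?_
    rw [burn (fun m'' : Fin n × Fin n → ℕ =>
      if ∀ β i, (mg (comb m m' m'') β i : ℤ) = ![a, b, c] β i then 1 else 0)]
    congr!
  simp only [e2]
  simp only [← Finset.mul_sum]
  congr 3
  -- final identification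
  rw [Nm, Nat.subtype_card (s := ((Finset.piAntidiag Finset.univ (Fintype.card P) ×ˢ
    (Finset.piAntidiag Finset.univ (Fintype.card Q) ×ˢ Finset.piAntidiag Finset.univ (Fintype.card R))).filter
      (fun t : ((Fin n × Fin n → ℕ) × (Fin n × Fin n × Fin n → ℕ) × (Fin n × Fin n → ℕ)) =>
        ∀ β i, (mg (comb t.1 t.2.1 t.2.2) β i : ℤ) = ![a, b, c] β i)).map
      ⟨fun t => comb t.1 t.2.1 t.2.2, ?_⟩)]
  · rw [Finset.card_map, Finset.card_filter, Finset.sum_product]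
    push_cast
    refine Finset.sum_congr (by congr!) fun m _ => ?_
    rw [Finset.sum_product]
  · intro m
    simp only [Finset.mem_map, Finset.mem_filter, Finset.mem_product, Finset.mem_piAntidiag,
      Function.Embedding.coeFn_mk]
    constructor
    · rintro ⟨t, ht, rfl⟩
      exact ht.2
    · intro hm
      have hcomb : comb (fun y => m (Sum.inl y)) (fun y => m (Sum.inr (Sum.inl y)))
          (fun y => m (Sum.inr (Sum.inr y))) = m := by
        ext s
        rcases s with s | s | s <;> rfl
      have t0 : ∀ i, (mg m 0 i : ℤ) = a i := fun i => hm 0 i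
      have t1 : ∀ i, (mg m 1 i : ℤ) = b i := fun i => hm 1 i
      have t2 : ∀ i, (mg m 2 i : ℤ) = c i := fun i => hm 2 i
      have key : ∀ (Y : Type) [Fintype Y] (φ : Y → Fin n) (m : Y → ℕ),
          ∑ i, ∑ y, (if φ y = i then m y else 0) = ∑ y, m y := by
        intro Y _ φ m
        rw [Finset.sum_comm]
        refine Finset.sum_congr rfl fun y _ => ?_
        simp
      refine ⟨⟨fun y => m (Sum.inl y), fun y => m (Sum.inr (Sum.inl y)), fun y => m (Sum.inr (Sum.inr y))⟩,
        ⟨⟨?_, ?_, ?_⟩, ?_⟩, hcomb⟩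
      rotate_left 3
      · rw [hcomb]; exact hm
      all_goals
        refine ⟨?_, by simp⟩
        rw [← Finset.sum_congr rfl fun i _ => t0 i] at ha
        rw [← Finset.sum_congr rfl fun i _ => t1 i] at hb
        rw [← Finset.sum_congr rfl fun i _ => t2 i] at hc
        norm_cast at ha hb hc
        rw [← hcomb] at ha hb hc
        simp only [fun i => (mg_comb (fun y => m (Sum.inl y)) (fun y => m (Sum.inr (Sum.inl y)))
          (fun y => m (Sum.inr (Sum.inr y))) i).1] at ha
        simp only [fun i => (mg_comb (fun y => m (Sum.inl y)) (fun y => m (Sum.inr (Sum.inl y)))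
          (fun y => m (Sum.inr (Sum.inr y))) i).2.1] at hb
        simp only [fun i => (mg_comb (fun y => m (Sum.inl y)) (fun y => m (Sum.inr (Sum.inl y)))
          (fun y => m (Sum.inr (Sum.inr y))) i).2.2] at hc
        simp only [Finset.sum_add_distrib, key] at ha hb hc
        simp only
        omega
  · intro t t' h
    have : ∀ s, comb t.1 t.2.1 t.2.2 s = comb t'.1 t'.2.1 t'.2.2 s := fun s => DFunLike.congr_fun h s
    refine Prod.ext (funext fun y => this (Sum.inl y)) (Prod.ext (funext fun y => this (Sum.inr (Sum.inl y)))
      (funext fun y => this (Sum.inr (Sum.inr y))))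

end Yc
end Agu

namespace Agu
open Partition'

section Irr

/-- parts of a partition -/
def prt (l : Partition') (i : ℕ) : ℕ := l.1 i

lemma prt_anti (l : Partition') : Antitone (prt l) := fun _ _ h => l.2 h

lemma cnt_zero {X Y : Type} [Fintype X] [Fintype Y] (F : X → Y) (y : Y) : cnt F y = 0 ↔ ∀ x, F x ≠ y := by
  unfold cnt
  rw [Finset.card_eq_zero, Finset.filter_eq_empty_iff]
  simp

lemma cnt_card {X Y : Type} [Fintype X] [Fintype Y] (F : X → Y) (y : Y) : Nat.card {x // F x = y} = cnt F y := by
  unfold cnt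
  rw [Nat.card_eq_fintype_card, Fintype.card_subtype]

lemma mt_neg {n : ℕ} (c : Fin n → ℕ) (a : Fin n → ℤ) (i : Fin n) (hi : a i < 0) : mt c a = 0 := by
  unfold mt
  rw [if_neg]
  intro h
  have := h i
  omega

lemma yc_neg {n : ℕ} {X : Type} [Fintype X] (a : Fin n → ℤ) (g : Equiv.Perm X) (i : Fin n) (hi : a i < 0) :
    yc X a g = 0 := by
  unfold yc
  refine Finset.sum_eq_zero fun f _ => ?_
  rw [mt_neg _ _ i hi, mul_zero]

lemma fx_equiv {X Y Z : Type} [Fintype X] [Fintype Y] [Fintype Z] (e : X ≃ Y) (g : Equiv.Perm X) (f : Y → Z) :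
    fx g (f ∘ e) = fx (e.permCongr g) f := by
  unfold fx
  have : (f ∘ e) ∘ g = f ∘ e ↔ f ∘ (e.permCongr g) = f := by
    constructor
    · intro h
      funext y
      have := congrFun h (e.symm y)
      simpa using this
    · intro h
      funext x
      have := congrFun h (e x)
      simpa using this
  simp only [this]

lemma yc_equiv {n : ℕ} {X Y : Type} [Fintype X] [Fintype Y] (e : X ≃ Y) (a : Fin n → ℤ) (g : Equiv.Perm X) :
    yc Y a (e.permCongr g) = yc X a g := by
  unfold yc
  rw [← Equiv.sum_comp (Equiv.arrowCongr e.symm (Equiv.refl (Fin n)))]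
  refine Finset.sum_congr rfl fun f _ => ?_
  have : (Equiv.arrowCongr e.symm (Equiv.refl (Fin n))) f = f ∘ e := by
    funext x; simp
  rw [this, cnt_equiv, fx_equiv]

lemma youngCount_eq (n : ℕ) (a : Fin n → ℤ) (g : Equiv.Perm (Fin n)) : youngCount n a g = yc (Fin n) a g := by
  unfold youngCount
  split_ifs with h
  · rw [Nat.card_eq_fintype_card, Fintype.card_subtype, Finset.card_filter]
    push_cast
    unfold yc
    refine Finset.sum_congr (by congr!) fun f _ => ?_
    unfold fx mt
    apply ind_mul
    refine and_congr Iff.rfl (forall_congr' fun i => ?_)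
    rw [cnt_card]
    have := h i
    omega
  · push Not at h
    obtain ⟨i, hi⟩ := h
    rw [yc_neg a g i hi]

/-- the irreducible character on permutations of any finite type, computed with `n` rows -/
noncomputable def irr (n : ℕ) (X : Type) [Fintype X] (l : Partition') (g : Equiv.Perm X) : ℤ :=
  alt (fun i : Fin n => (prt l i : ℤ)) (fun a => yc X a g)

lemma irrChar_eq (n : ℕ) (l : Partition') (g : Equiv.Perm (Fin n)) : irrChar n l g = irr n (Fin n) l g := by
  unfold irrChar irr alt
  refine Finset.sum_congr rfl fun σ _ => ?_
  rw [youngCount_eq]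
  rfl

lemma irr_equiv {n : ℕ} {X Y : Type} [Fintype X] [Fintype Y] (e : X ≃ Y) (l : Partition') (g : Equiv.Perm X) :
    irr n Y l (e.permCongr g) = irr n X l g := by
  unfold irr
  simp only [yc_equiv]

lemma yc_succ {n : ℕ} {X : Type} [Fintype X] (a : Fin (n + 1) → ℤ) (g : Equiv.Perm X) (ha : a (Fin.last n) = 0) :
    yc X a g = yc X (fun i : Fin n => a i.castSucc) g := by
  symm
  unfold yc
  refine Fintype.sum_of_injective (fun f : X → Fin n => fun x => (f x).castSucc) ?_ _ _ ?_ ?_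
  · intro f f' h
    funext x
    exact Fin.castSucc_injective _ (congrFun h x)
  · intro f hf
    have : ∃ x, f x = Fin.last n := by
      by_contra hcon
      push Not at hcon
      apply hf
      refine ⟨fun x => (f x).castPred (hcon x), ?_⟩
      funext x
      simp
    obtain ⟨x, hx⟩ := this
    have h0 : mt (cnt f) a = 0 := by
      unfold mt
      rw [if_neg]
      intro h
      have h1 := h (Fin.last n)
      rw [ha] at h1
      have h2 : cnt f (Fin.last n) = 0 := by exact_mod_cast h1
      exact (cnt_zero _ _).1 h2 x hx
    rw [h0, mul_zero]
  · intro f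
    congr 1
    · unfold fx
      have : f ∘ g = f ↔ (fun x => (f x).castSucc) ∘ g = (fun x => (f x).castSucc) := by
        simp only [funext_iff, Function.comp, Fin.castSucc_inj]
      simp only [this]
      congr!
    · unfold mt
      have c1 : ∀ i : Fin n, cnt (fun x => (f x).castSucc) i.castSucc = cnt f i := by
        intro i
        unfold cnt
        simp only [Fin.castSucc_inj]
        congr!
      have c2 : cnt (fun x => (f x).castSucc) (Fin.last n) = 0 := by
        exact (cnt_zero _ _).2 fun x => (Fin.castSucc_lt_last (f x)).ne
      have : (∀ i : Fin n, (cnt f i : ℤ) = a i.castSucc) ↔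
          ∀ i : Fin (n + 1), (cnt (fun x => (f x).castSucc) i : ℤ) = a i := by
        rw [Fin.forall_fin_succ']
        simp only [c1, c2, ha]
        simp
      simp only [this]

lemma irr_succ {n : ℕ} {X : Type} [Fintype X] (l : Partition') (hl : prt l n = 0) (g : Equiv.Perm X) :
    irr (n + 1) X l g = irr n X l g := by
  symm
  unfold irr alt
  let E : Equiv.Perm (Fin n) → Equiv.Perm (Fin (n + 1)) := fun τ =>
    finSuccEquivLast.symm.permCongr (Equiv.optionCongr τ)
  have E1 : ∀ τ i, E τ (Fin.castSucc i) = (τ i).castSucc := by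
    intro τ i
    simp [E]
  have E2 : ∀ τ, E τ (Fin.last n) = Fin.last n := by
    intro τ
    simp [E]
  refine Fintype.sum_of_injective E ?_ _ _ ?_ ?_
  · intro τ τ' h
    exact Equiv.optionCongr_injective (Equiv.injective _ h)
  · intro σ hσ
    have hne : σ (Fin.last n) ≠ Fin.last n := by
      intro h
      apply hσ
      have hne : ∀ i : Fin n, σ i.castSucc ≠ Fin.last n := by
        intro i hi
        rw [← h] at hi
        exact (Fin.castSucc_lt_last i).ne (σ.injective hi)
      have hinj : Function.Injective (fun i : Fin n => (σ i.castSucc).castPred (hne i)) := by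
        intro i j hij
        simp only [Fin.castPred_inj] at hij
        exact Fin.castSucc_injective _ (σ.injective hij)
      refine ⟨Equiv.ofBijective _ (Finite.injective_iff_bijective.1 hinj), ?_⟩
      ext i
      refine Fin.lastCases ?_ (fun i => ?_) i
      · rw [E2, h]
      · rw [E1]
        simp
    beta_reduce
    rw [yc_neg _ _ (Fin.last n), mul_zero]
    have : σ (Fin.last n) < Fin.last n := lt_of_le_of_ne (Fin.le_last _) hne
    have : (σ (Fin.last n) : ℕ) < n := this
    simp only [shf, Fin.val_last, hl]
    omega
  · intro τ
    beta_reduce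
    rw [yc_succ (shf _ (E τ))]
    · congr 3
      · simp only [E]
        rw [Equiv.Perm.sign_permCongr, Equiv.optionCongr_sign]
      · funext i
        simp only [shf, E1, Fin.val_castSucc]
    · simp [shf, E2, hl]

lemma irr_le {n m : ℕ} {X : Type} [Fintype X] (l : Partition') (hl : prt l n = 0) (hnm : n ≤ m) (g : Equiv.Perm X) :
    irr m X l g = irr n X l g := by
  induction m, hnm using Nat.le_induction with
  | base => rfl
  | succ m hm ih =>
    rw [irr_succ l (Nat.le_zero.1 (hl ▸ prt_anti l hm)), ih]

lemma size_eq {n : ℕ} (l : Partition') (hl : prt l n = 0) : size l = ∑ i : Fin n, prt l i := by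
  rw [Fin.sum_univ_eq_sum_range (prt l) n]
  unfold size
  refine Finsupp.sum_of_support_subset l.1 (s := Finset.range n) ?_ _ (fun _ _ => rfl)
  intro i hi
  rw [Finset.mem_range]
  by_contra hcon
  push Not at hcon
  have h1 : prt l i ≤ prt l n := prt_anti l hcon
  rw [hl] at h1
  exact (Finsupp.mem_support_iff.1 hi) (Nat.le_zero.1 h1)

lemma exists_prt (l : Partition') : ∃ n, prt l n = 0 := by
  obtain ⟨n, hn⟩ := Infinite.exists_notMem_finset l.1.support
  exact ⟨n, Finsupp.notMem_support_iff.1 hn⟩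

lemma apply_size (l : Partition') : prt l (size l) = 0 := by
  by_contra hcon
  obtain ⟨n, hn⟩ := exists_prt l
  have hlt : size l < n := by
    by_contra h
    push Not at h
    have := prt_anti l h
    omega
  have h1 : size l + 1 ≤ size l := by
    calc size l + 1 = ∑ i ∈ Finset.range (size l + 1), 1 := by simp
      _ ≤ ∑ i ∈ Finset.range (size l + 1), prt l i := by
        refine Finset.sum_le_sum fun i hi => ?_
        have := prt_anti l (Nat.lt_succ_iff.1 (Finset.mem_range.1 hi))
        omega
      _ ≤ ∑ i ∈ Finset.range n, prt l i :=
        Finset.sum_le_sum_of_subset (Finset.range_subset_range.2 hlt)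
      _ = size l := by rw [size_eq l hn, Fin.sum_univ_eq_sum_range (prt l) n]
  omega

lemma irr_eq {n m : ℕ} {X : Type} [Fintype X] (l : Partition') (hl : prt l n = 0) (hm : prt l m = 0) (g : Equiv.Perm X) :
    irr m X l g = irr n X l g := by
  rcases le_total n m with h | h
  · exact irr_le l hl h g
  · exact (irr_le l hm h g).symm

end Irr
end Agu

namespace Agu
open Partition'

section Tt

lemma alt_sum {n : ℕ} {ι : Type} (s : Finset ι) (κ : Fin n → ℤ) (φ : ι → (Fin n → ℤ) → ℤ) :
    alt κ (fun a => ∑ i ∈ s, φ i a) = ∑ i ∈ s, alt κ (φ i) := by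
  unfold alt
  rw [Finset.sum_comm]
  refine Finset.sum_congr rfl fun σ _ => ?_
  rw [Finset.mul_sum]

lemma alt_mul_left {n : ℕ} (κ : Fin n → ℤ) (φ : (Fin n → ℤ) → ℤ) (c : ℤ) :
    alt κ (fun a => c * φ a) = c * alt κ φ := by
  unfold alt
  rw [Finset.mul_sum]
  exact Finset.sum_congr rfl fun σ _ => by ring

lemma alt_mul_right {n : ℕ} (κ : Fin n → ℤ) (φ : (Fin n → ℤ) → ℤ) (c : ℤ) :
    alt κ (fun a => φ a * c) = alt κ φ * c := by
  unfold alt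
  rw [Finset.sum_mul]
  exact Finset.sum_congr rfl fun σ _ => by ring

lemma alt_congr {n : ℕ} (κ : Fin n → ℤ) (φ ψ : (Fin n → ℤ) → ℤ) (h : ∀ a, ∑ i, a i = ∑ i, κ i → φ a = ψ a) :
    alt κ φ = alt κ ψ := by
  unfold alt
  refine Finset.sum_congr rfl fun σ _ => ?_
  rw [h _ (sum_shf κ σ)]

noncomputable def Irr (X : Type) [Fintype X] (l : Partition') (g : Equiv.Perm X) : ℤ := irr (size l) X l g

lemma Irr_eq {n : ℕ} {X : Type} [Fintype X] (l : Partition') (hl : prt l n = 0) (g : Equiv.Perm X) :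
    Irr X l g = irr n X l g := irr_eq l hl (apply_size l) g

lemma Irr_equiv {X Y : Type} [Fintype X] [Fintype Y] (e : X ≃ Y) (l : Partition') (g : Equiv.Perm X) :
    Irr Y l (e.permCongr g) = Irr X l g := irr_equiv e l g

noncomputable def wt3 (n : ℕ) (l m nu : Partition') : Fin 3 → Fin n → ℕ :=
  ![fun i => prt l i, fun i => prt m i, fun i => prt nu i]

noncomputable def bb (n : ℕ) (l m nu : Partition') : ℕ :=
  Module.finrank ℝ (HT (fun b i => ((wt3 n l m nu b i : ℕ) : ℤ)))

theorem T_thm {P Q R : Type} [Fintype P] [Fintype Q] [Fintype R] {n : ℕ} (l m nu : Partition')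
    (hl : prt l n = 0) (hm : prt m n = 0) (hnu : prt nu n = 0)
    (sl : size l = Fintype.card P + Fintype.card Q) (sm : size m = Fintype.card Q + Fintype.card R)
    (snu : size nu = Fintype.card P + Fintype.card Q + Fintype.card R) :
    ∑ g : Equiv.Perm P, ∑ h : Equiv.Perm Q, ∑ k : Equiv.Perm R,
      Irr (P ⊕ Q) l (Equiv.sumCongr g h) * Irr (Q ⊕ R) m (Equiv.sumCongr h k) *
      Irr (P ⊕ (Q ⊕ R)) nu (Equiv.sumCongr g (Equiv.sumCongr h k)) =
    (Fintype.card P).factorial * ((Fintype.card Q).factorial * ((Fintype.card R).factorial * (bb n l m nu : ℤ))) := by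
  simp only [Irr_eq l hl, Irr_eq m hm, Irr_eq nu hnu]
  unfold irr
  simp only [← alt_mul_left, ← alt_mul_right]
  simp only [← alt_sum]
  have key := finrank_HT (wt3 n l m nu) (by
    intro b
    fin_cases b
    · exact fun i j h => prt_anti l h
    · exact fun i j h => prt_anti m h
    · exact fun i j h => prt_anti nu h)
  unfold bb
  rw [key]
  simp only [← alt_mul_left]
  have sz : ∀ l : Partition', prt l n = 0 → ∑ i : Fin n, (prt l i : ℤ) = size l := by
    intro l hl
    rw [size_eq l hl]
    push_cast; rfl
  change alt (fun i : Fin n => (prt nu i : ℤ)) _ = alt (fun i : Fin n => (prt nu i : ℤ)) _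
  refine alt_congr _ _ _ fun c hc => ?_
  change alt (fun i : Fin n => (prt m i : ℤ)) _ = alt (fun i : Fin n => (prt m i : ℤ)) _
  refine alt_congr _ _ _ fun b hb => ?_
  change alt (fun i : Fin n => (prt l i : ℤ)) _ = alt (fun i : Fin n => (prt l i : ℤ)) _
  refine alt_congr _ _ _ fun a ha => ?_
  rw [sz _ hl] at ha
  rw [sz _ hm] at hb
  rw [sz _ hnu] at hc
  exact yc_sum a b c (by rw [ha, sl]; push_cast; rfl) (by rw [hb, sm]; push_cast; rfl) (by rw [hc, snu]; push_cast; rfl)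

end Tt
end Agu

namespace Agu
open Partition'

section Spec
variable {X Y P Q R : Type} [Fintype X] [Fintype Y] [Fintype P] [Fintype Q] [Fintype R]

lemma Irr_emptySum (l : Partition') (g : Equiv.Perm Empty) (h : Equiv.Perm X) :
    Irr (Empty ⊕ X) l (Equiv.sumCongr g h) = Irr X l h := by
  rw [← Irr_equiv (Equiv.emptySum Empty X)]
  congr 1

lemma Irr_sumEmpty (l : Partition') (g : Equiv.Perm Empty) (h : Equiv.Perm X) :
    Irr (X ⊕ Empty) l (Equiv.sumCongr h g) = Irr X l h := by
  rw [← Irr_equiv (Equiv.sumEmpty X Empty)]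
  congr 1

lemma exists_n3 (l m nu : Partition') : ∃ n, prt l n = 0 ∧ prt m n = 0 ∧ prt nu n = 0 := by
  refine ⟨size l + size m + size nu, ?_, ?_, ?_⟩
  · have := prt_anti l (show size l ≤ size l + size m + size nu by omega)
    rw [apply_size] at this; omega
  · have := prt_anti m (show size m ≤ size l + size m + size nu by omega)
    rw [apply_size] at this; omega
  · have := prt_anti nu (show size nu ≤ size l + size m + size nu by omega)
    rw [apply_size] at this; omega

lemma kron_ex (l m nu : Partition') (hl : size l = Fintype.card X) (hm : size m = Fintype.card X)
    (hnu : size nu = Fintype.card X) : ∃ b : ℕ,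
      ∑ g : Equiv.Perm X, Irr X l g * Irr X m g * Irr X nu g = (Fintype.card X).factorial * (b : ℤ) := by
  obtain ⟨n, h1, h2, h3⟩ := exists_n3 l m nu
  have := T_thm (P := Empty) (Q := X) (R := Empty) l m nu h1 h2 h3 (by simp [hl]) (by simp [hm]) (by simp [hnu])
  refine ⟨bb n l m nu, ?_⟩
  simp only [Irr_emptySum, Irr_sumEmpty] at this
  simpa using this

lemma irrChar_Irr (n : ℕ) (l : Partition') (hl : size l = n) (g : Equiv.Perm (Fin n)) :
    irrChar n l g = Irr (Fin n) l g := by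
  subst hl
  rw [irrChar_eq, Irr]

lemma kron_spec (l m nu : Partition') (hl : size l = Fintype.card X) (hm : size m = Fintype.card X)
    (hnu : size nu = Fintype.card X) :
      ∑ g : Equiv.Perm X, Irr X l g * Irr X m g * Irr X nu g = (Fintype.card X).factorial * (kron l m nu : ℤ) := by
  obtain ⟨b, hb⟩ := kron_ex l m nu hl hm hnu
  rw [hb]
  have e : X ≃ Fin (size nu) := Fintype.equivFinOfCardEq hnu.symm
  congr 2
  unfold kron
  rw [if_pos ⟨by omega, by omega⟩]
  rw [← Equiv.sum_comp e.permCongr]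
  have e1 : ∀ l, size l = size nu → ∀ g, irrChar (size nu) l (e.permCongr g) = Irr X l g := by
    intro l hl g
    rw [irrChar_Irr _ l hl, Irr_equiv]
  simp only [e1 l (by omega), e1 m (by omega), e1 nu rfl]
  rw [hb, hnu, Int.mul_ediv_cancel_left _ (by positivity)]
  simp

lemma lr_ex (l m nu : Partition') (hl : size l = Fintype.card P) (hm : size m = Fintype.card Q)
    (hnu : size nu = Fintype.card P + Fintype.card Q) : ∃ b : ℕ,
      ∑ g : Equiv.Perm P, ∑ h : Equiv.Perm Q, Irr P l g * Irr Q m h * Irr (P ⊕ Q) nu (Equiv.sumCongr g h) =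
        (Fintype.card P).factorial * ((Fintype.card Q).factorial * (b : ℤ)) := by
  obtain ⟨n, h1, h2, h3⟩ := exists_n3 l m nu
  have := T_thm (P := P) (Q := Empty) (R := Q) l m nu h1 h2 h3 (by simp [hl]) (by simp [hm]) (by simp [hnu])
  refine ⟨bb n l m nu, ?_⟩
  simp only [Irr_emptySum, Irr_sumEmpty] at this
  have e : ∀ (g : Equiv.Perm P) (h : Equiv.Perm Empty) (k : Equiv.Perm Q),
      Irr (P ⊕ (Empty ⊕ Q)) nu (Equiv.sumCongr g (Equiv.sumCongr h k)) = Irr (P ⊕ Q) nu (Equiv.sumCongr g k) := by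
    intro g h k
    rw [← Irr_equiv (Equiv.sumCongr (Equiv.refl P) (Equiv.emptySum Empty Q))]
    congr 1
    ext x
    rcases x with x | x <;> simp [Equiv.permCongr_apply]
  simp only [e] at this
  simpa using this

lemma lr_spec (l m nu : Partition') (hl : size l = Fintype.card P) (hm : size m = Fintype.card Q)
    (hnu : size nu = Fintype.card P + Fintype.card Q) :
      ∑ g : Equiv.Perm P, ∑ h : Equiv.Perm Q, Irr P l g * Irr Q m h * Irr (P ⊕ Q) nu (Equiv.sumCongr g h) =
        (Fintype.card P).factorial * ((Fintype.card Q).factorial * (lr l m nu : ℤ)) := by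
  obtain ⟨b, hb⟩ := lr_ex l m nu hl hm hnu
  rw [hb]
  have e : P ≃ Fin (size l) := Fintype.equivFinOfCardEq hl.symm
  have f : Q ≃ Fin (size m) := Fintype.equivFinOfCardEq hm.symm
  congr 3
  unfold lr
  rw [if_pos (by omega), ← Equiv.sum_comp e.permCongr]
  have key : ∀ g : Equiv.Perm P, ∑ h, irrChar (size l) l (e.permCongr g) * irrChar (size m) m h *
      irrChar (size l + size m) nu (sumEmb (e.permCongr g) h) =
      ∑ h : Equiv.Perm Q, Irr P l g * Irr Q m h * Irr (P ⊕ Q) nu (Equiv.sumCongr g h) := by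
    intro g
    rw [← Equiv.sum_comp f.permCongr]
    refine Finset.sum_congr rfl fun h _ => ?_
    rw [irrChar_Irr _ l rfl, irrChar_Irr _ m rfl, irrChar_Irr _ nu (by omega), Irr_equiv, Irr_equiv]
    congr 1
    rw [sumEmb, Irr_equiv, ← Irr_equiv (Equiv.sumCongr e f)]
    congr 1
    ext x
    rcases x with x | x <;> simp [Equiv.permCongr_apply]
  rw [Finset.sum_congr rfl fun g _ => key g, hb, hl, hm, ← mul_assoc,
    Int.mul_ediv_cancel_left _ (by positivity)]
  simp

end Spec
end Agu

namespace Agu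
open MvPolynomial

section JT
variable {n : ℕ}

noncomputable def Hs (n : ℕ) : PowerSeries (MvPolynomial (Fin n) ℤ) :=
  ∏ j : Fin n, PowerSeries.mk (fun m => (X j : MvPolynomial (Fin n) ℤ) ^ m)

noncomputable def hz (n : ℕ) (m : ℤ) : MvPolynomial (Fin n) ℤ :=
  if 0 ≤ m then PowerSeries.coeff m.toNat (Hs n) else 0

noncomputable def Np (k : Fin n) : Polynomial (MvPolynomial (Fin n) ℤ) :=
  ∏ j ∈ Finset.univ.erase k, (1 - Polynomial.C (X j) * Polynomial.X)

lemma Np_deg (k : Fin n) (j : ℕ) (hj : n ≤ j) : (Np k).coeff j = 0 := by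
  apply Polynomial.coeff_eq_zero_of_natDegree_lt
  have h1 : (Np k).natDegree ≤ ∑ j ∈ Finset.univ.erase k, 1 := by
    refine (Polynomial.natDegree_prod_le _ _).trans (Finset.sum_le_sum fun i _ => ?_)
    refine (Polynomial.natDegree_sub_le _ _).trans ?_
    rw [max_le_iff]
    refine ⟨by simp, (Polynomial.natDegree_C_mul_le _ _).trans Polynomial.natDegree_X_le⟩
  have := k.2
  simp at h1
  omega

lemma geo (x : MvPolynomial (Fin n) ℤ) :
    (1 - PowerSeries.C x * PowerSeries.X) * PowerSeries.mk (fun m => x ^ m) = 1 := by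
  ext m
  rw [sub_mul, one_mul, mul_assoc]
  cases m with
  | zero => simp
  | succ m =>
    rw [map_sub, PowerSeries.coeff_C_mul, PowerSeries.coeff_succ_X_mul]
    simp [PowerSeries.coeff_one, pow_succ']

lemma Np_Hs (k : Fin n) : (Np k : PowerSeries (MvPolynomial (Fin n) ℤ)) * Hs n =
    PowerSeries.mk (fun m => (X k : MvPolynomial (Fin n) ℤ) ^ m) := by
  have h1 : (Np k : PowerSeries (MvPolynomial (Fin n) ℤ)) =
      ∏ j ∈ Finset.univ.erase k, (1 - PowerSeries.C (X j) * PowerSeries.X) := by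
    rw [Np, ← Polynomial.coeToPowerSeries.ringHom_apply, map_prod]
    simp
  rw [h1, Hs, ← Finset.mul_prod_erase _ _ (Finset.mem_univ k), mul_left_comm, ← Finset.prod_mul_distrib,
    Finset.prod_congr rfl fun j _ => geo (X j)]
  simp

lemma HN (k : Fin n) (l : ℕ) : ∑ j ∈ Finset.range n, hz n ((l : ℤ) - j) * (Np k).coeff j = X k ^ l := by
  have h := congrArg (PowerSeries.coeff l) (Np_Hs k)
  rw [PowerSeries.coeff_mul, PowerSeries.coeff_mk, Finset.Nat.sum_antidiagonal_eq_sum_range_succ_mk] at h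
  rw [← h]
  simp only [Polynomial.coeff_coe]
  have e1 : ∑ j ∈ Finset.range n, hz n ((l : ℤ) - j) * (Np k).coeff j =
      ∑ j ∈ Finset.range (n + (l + 1)), hz n ((l : ℤ) - j) * (Np k).coeff j := by
    refine Finset.sum_subset (Finset.range_subset_range.2 (by omega)) fun j _ hj => ?_
    rw [Np_deg k j (by simpa using hj), mul_zero]
  have e2 : ∑ j ∈ Finset.range (l + 1), (Np k).coeff j * PowerSeries.coeff (l - j) (Hs n) =
      ∑ j ∈ Finset.range (l + 1), hz n ((l : ℤ) - j) * (Np k).coeff j := by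
    refine Finset.sum_congr rfl fun j hj => ?_
    have := Finset.mem_range.1 hj
    rw [hz, if_pos (by omega), mul_comm, show ((l : ℤ) - j).toNat = l - j by omega]
  rw [e1, e2]
  symm
  refine Finset.sum_subset (Finset.range_subset_range.2 (by omega)) fun j _ hj => ?_
  have : ¬ j < l + 1 := by simpa using hj
  rw [hz, if_neg (by omega), zero_mul]

noncomputable def Hm (κ : Fin n → ℕ) : Matrix (Fin n) (Fin n) (MvPolynomial (Fin n) ℤ) :=
  fun i j => hz n ((κ i : ℤ) + (j : ℕ) - (i : ℕ))

noncomputable def Nmat (n : ℕ) : Matrix (Fin n) (Fin n) (MvPolynomial (Fin n) ℤ) :=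
  fun j k => (Np k).coeff (n - 1 - j)

noncomputable def Am (κ : Fin n → ℕ) : Matrix (Fin n) (Fin n) (MvPolynomial (Fin n) ℤ) :=
  fun i k => X k ^ (κ i + (n - 1 - (i : ℕ)))

lemma Hm_mul (κ : Fin n → ℕ) : Hm κ * Nmat n = Am κ := by
  ext1 i k
  rw [Matrix.mul_apply, Am, ← HN, Finset.sum_range, ← Equiv.sum_comp Fin.revPerm]
  refine Finset.sum_congr rfl fun j _ => ?_
  have h1 := j.2
  have h2 := i.2
  simp only [Hm, Nmat, Fin.revPerm_apply, Fin.val_rev]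
  congr 2
  · push_cast
    omega
  · omega

lemma Hm_det (κ : Fin n → ℕ) : (Hm κ).det = alt (fun i => (κ i : ℤ)) (fun a => ∏ i, hz n (a i)) := by
  rw [← Matrix.det_transpose, Matrix.det_apply']
  rfl

lemma hz_zero : hz n 0 = 1 := by
  rw [hz, if_pos le_rfl, Hs]
  simp

lemma Hm_zero : (Hm (fun _ : Fin n => 0)).det = 1 := by
  rw [Matrix.det_of_isUpperTriangular]
  · refine Finset.prod_eq_one fun i _ => ?_
    rw [Hm]
    simp [hz_zero]
  · intro i j hij
    have : (j : ℕ) < i := hij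
    rw [Hm, hz, if_neg]
    push_cast
    omega

lemma Nmat_det : (Nmat n).det = ((Equiv.Perm.sign (Fin.revPerm : Equiv.Perm (Fin n)) : ℤ) : MvPolynomial (Fin n) ℤ) *
    vd n ℤ := by
  have h := congrArg Matrix.det (Hm_mul (fun _ : Fin n => 0))
  rw [Matrix.det_mul, Hm_zero, one_mul] at h
  rw [h, vd, ← Matrix.det_transpose (Matrix.vandermonde _), ← Matrix.det_permute]
  congr 1
  ext1 i k
  have := i.2
  simp only [Am, Matrix.submatrix_apply, Matrix.transpose_apply, Matrix.vandermonde_apply, Fin.revPerm_apply,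
    Fin.val_rev, id]
  congr 1
  omega

lemma sign_sq (σ : Equiv.Perm (Fin n)) {K : Type} [CommRing K] :
    ((Equiv.Perm.sign σ : ℤ) : K) * ((Equiv.Perm.sign σ : ℤ) : K) = 1 := by
  rw [← Int.cast_mul, ← Units.val_mul, Int.units_mul_self]
  simp

noncomputable def sch (κ : Fin n → ℕ) : MvPolynomial (Fin n) ℤ :=
  alt (fun i => (κ i : ℤ)) (fun a => ∏ i, hz n (a i))

lemma vd_sch (κ : Fin n → ℕ) : vd n ℤ * sch κ =
    ((Equiv.Perm.sign (Fin.revPerm : Equiv.Perm (Fin n)) : ℤ) : MvPolynomial (Fin n) ℤ) * (Am κ).det := by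
  rw [← Hm_mul κ, Matrix.det_mul, Nmat_det, Hm_det, ← sch]
  rw [show ∀ a b c : MvPolynomial (Fin n) ℤ, a * (b * (a * c)) = (a * a) * (b * c) by intros; ring, sign_sq]
  ring

lemma dl_anti (κ : Fin n → ℕ) (hκ : Antitone κ) : StrictAnti (dl κ) := by
  intro i j hij
  have h1 := hκ hij.le
  have h2 := j.2
  have : (i : ℕ) < j := hij
  simp only [dl, Finsupp.equivFunOnFinite_symm_apply_apply]
  omega

lemma coeff_Am (κ μ : Fin n → ℕ) (hκ : Antitone κ) (hμ : Antitone μ) :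
    coeff (dl μ) (Am κ).det = if κ = μ then 1 else 0 := by
  rw [Matrix.det_apply', coeff_sum]
  have h1 : ∀ σ : Equiv.Perm (Fin n), ∏ i, Am κ (σ i) i =
      monomial (Finsupp.equivFunOnFinite.symm fun i => dl κ (σ i)) (1 : ℤ) := by
    intro σ
    rw [monomial_eq, Finsupp.prod_fintype _ _ (by simp)]
    simp [Am, dl]
  have h2 : ∀ σ : Equiv.Perm (Fin n), (Finsupp.equivFunOnFinite.symm fun i => dl κ (σ i)) = dl μ ↔
      σ = 1 ∧ κ = μ := by
    intro σ
    constructor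
    · intro h
      have h' : ∀ i, dl κ (σ i) = dl μ i := fun i => DFunLike.congr_fun h i
      have hs : StrictMono σ := by
        intro i j hij
        have := dl_anti μ hμ hij
        rw [← h', ← h'] at this
        exact (dl_anti κ hκ).lt_iff_gt.1 this
      have : σ = 1 := by
        have := Subsingleton.elim (StrictMono.orderIsoOfSurjective σ hs σ.surjective) (OrderIso.refl _)
        ext i
        exact congrArg Fin.val (DFunLike.congr_fun this i)
      refine ⟨this, ?_⟩
      subst this
      funext i
      have := h' i
      simp [dl] at this
      exact this
    · rintro ⟨rfl, rfl⟩
      ext i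
      simp
  have h3 : ∀ σ : Equiv.Perm (Fin n), coeff (dl μ) (((Equiv.Perm.sign σ : ℤ) : MvPolynomial (Fin n) ℤ) *
      ∏ i, Am κ (σ i) i) = if σ = 1 then (if κ = μ then 1 else 0) else 0 := by
    intro σ
    rw [h1, ← map_intCast (C : ℤ →+* MvPolynomial (Fin n) ℤ), coeff_C_mul, coeff_monomial]
    simp only [h2]
    by_cases hs : σ = 1
    · subst hs
      simp
    · simp [hs]
  rw [Finset.sum_congr rfl fun σ _ => h3 σ]
  simp

theorem alt_sch (κ μ : Fin n → ℕ) (hκ : Antitone κ) (hμ : Antitone μ) :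
    alt (fun i => (μ i : ℤ)) (cf (sch κ)) = if κ = μ then 1 else 0 := by
  have h := coeff_vd_mul μ (sch κ)
  rw [vd_sch, ← map_intCast (C : ℤ →+* MvPolynomial (Fin n) ℤ), coeff_C_mul, coeff_Am κ μ hκ hμ] at h
  have h2 := congrArg (fun z => ((Equiv.Perm.sign (Fin.revPerm : Equiv.Perm (Fin n)) : ℤ) : ℤ) * z) h
  have sg := sign_sq (K := ℤ) (Fin.revPerm : Equiv.Perm (Fin n))
  simp only [Int.cast_id] at h2 sg
  rw [← mul_assoc, ← mul_assoc, sg, one_mul, one_mul] at h2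
  exact h2.symm

lemma cf_alt (κ : Fin n → ℤ) (φ : (Fin n → ℤ) → MvPolynomial (Fin n) ℤ) (b : Fin n → ℤ) :
    cf (alt κ φ) b = alt κ (fun a => cf (φ a) b) := by
  unfold cf
  split_ifs
  · unfold alt
    rw [coeff_sum]
    refine Finset.sum_congr rfl fun σ _ => ?_
    rw [← map_intCast (C : ℤ →+* MvPolynomial (Fin n) ℤ), coeff_C_mul]
  · simp [alt]

end JT
end Agu

namespace Agu
open MvPolynomial Partition'

section Ortho
variable {n : ℕ}

noncomputable def rw2 (m : Fin n × Fin n → ℕ) (i : Fin n) : ℕ := ∑ j, m (i, j)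
noncomputable def cl2 (m : Fin n × Fin n → ℕ) (j : Fin n) : ℕ := ∑ i, m (i, j)

lemma yc2 {X : Type} [Fintype X] (a b : Fin n → ℤ) :
    ∑ g : Equiv.Perm X, yc X a g * yc X b g = (Fintype.card X).factorial *
      ∑ m ∈ Finset.piAntidiag Finset.univ (Fintype.card X), mt (rw2 m) a * mt (cl2 m) b := by
  trans
  swap
  · refine (burn (X := X) (Y := Fin n × Fin n) (fun m => mt (rw2 m) a * mt (cl2 m) b)).trans ?_
    congr!
  refine Finset.sum_congr rfl fun g _ => ?_
  unfold yc
  rw [Finset.sum_mul_sum, ← Fintype.sum_prod_type', ← Equiv.sum_comp (Equiv.arrowProdEquivProdArrow X (fun _ => Fin n) (fun _ => Fin n))]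
  refine Finset.sum_congr (by congr!) fun F _ => ?_
  have e1 : rw2 (cnt F) = cnt (fun x => (F x).1) := by
    funext i
    have := cnt_comp (fun y : Fin n × Fin n => y.1) F i
    change cnt (fun x => (F x).1) i = _ at this
    rw [this, rw2, Fintype.sum_prod_type, Finset.sum_comm]
    refine Finset.sum_congr rfl fun j _ => ?_
    dsimp only
    refine Eq.symm ((Finset.sum_eq_single i ?_ ?_).trans ?_)
    · intro x _ hx
      exact if_neg hx
    · exact fun h => absurd (Finset.mem_univ i) h
    · exact if_pos rfl
  have e2 : cl2 (cnt F) = cnt (fun x => (F x).2) := by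
    funext i
    have := cnt_comp (fun y : Fin n × Fin n => y.2) F i
    change cnt (fun x => (F x).2) i = _ at this
    rw [this, cl2, Fintype.sum_prod_type]
    refine Finset.sum_congr rfl fun j _ => ?_
    dsimp only
    refine Eq.symm ((Finset.sum_eq_single i ?_ ?_).trans ?_)
    · intro x _ hx
      exact if_neg hx
    · exact fun h => absurd (Finset.mem_univ i) h
    · exact if_pos rfl
  have e3 := fx_prod g (fun x => (F x).1) (fun x => (F x).2)
  change fx g F = _ at e3
  rw [e1, e2, e3]
  change fx g (fun x => (F x).1) * mt (cnt fun x => (F x).1) a * (fx g (fun x => (F x).2) * mt (cnt fun x => (F x).2) b) = _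
  ring

lemma hz_nat (m : ℕ) : hz n (m : ℤ) = ∑ l ∈ Finset.finsuppAntidiag Finset.univ m, monomial l (1 : ℤ) := by
  rw [hz, if_pos (by omega), Hs, PowerSeries.coeff_prod]
  refine Finset.sum_congr (by congr!) fun l _ => ?_
  rw [monomial_eq, Finsupp.prod_fintype _ _ (by simp)]
  simp

lemma mt_mul (c c' : Fin n → ℕ) (a b : Fin n → ℤ) :
    mt c a * mt c' b = if (∀ i, (c i : ℤ) = a i) ∧ (∀ i, (c' i : ℤ) = b i) then 1 else 0 := by
  unfold mt
  exact (ind_mul Iff.rfl).symm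

lemma cf_prod (a b : Fin n → ℤ) (N : ℕ) (ha : ∑ i, a i = N) : cf (∏ i, hz n (a i)) b =
    ∑ m ∈ Finset.piAntidiag (Finset.univ : Finset (Fin n × Fin n)) N, mt (rw2 m) a * mt (cl2 m) b := by
  by_cases h : (∀ i, 0 ≤ a i) ∧ ∀ i, 0 ≤ b i
  · obtain ⟨h1, h2⟩ := h
    lift a to Fin n → ℕ using h1
    lift b to Fin n → ℕ using h2
    rw [cf, if_pos (by intro i; omega)]
    simp only [hz_nat, Finset.prod_univ_sum, mt_mul]
    rw [coeff_sum]
    have e1 : ∀ x : Fin n → Fin n →₀ ℕ, ∏ i, monomial (x i) (1 : ℤ) = monomial (∑ i, x i) (1 : ℤ) := by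
      intro x
      rw [← monomial_sum_one]
    simp only [e1, coeff_monomial]
    rw [← Finset.sum_filter, ← Finset.sum_filter, Finset.sum_const, Finset.sum_const]
    congr 1
    refine Finset.card_nbij' (fun x => fun y => x y.1 y.2)
      (fun m => fun i => Finsupp.equivFunOnFinite.symm fun j => m (i, j)) ?_ ?_ ?_ ?_
    · intro x hx
      simp only [Finset.coe_filter, Set.mem_setOf_eq, Fintype.mem_piFinset, Finset.mem_finsuppAntidiag,
        Finset.mem_piAntidiag] at hx ⊢
      have r1 : ∀ i, ∑ j, x i j = a i := fun i => (hx.1 i).1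
      have r2 : ∀ j, ∑ i, x i j = b j := by
        intro j
        have := DFunLike.congr_fun hx.2 j
        simpa [Finsupp.finset_sum_apply] using this
      refine ⟨⟨?_, by simp⟩, ?_, ?_⟩
      · rw [Fintype.sum_prod_type]
        simp only [r1]
        beta_reduce at ha
        exact_mod_cast ha
      · intro i
        rw [rw2]
        simp only [r1]
      · intro i
        rw [cl2]
        simp only [r2]
    · intro m hm
      simp only [Finset.coe_filter, Set.mem_setOf_eq, Fintype.mem_piFinset, Finset.mem_finsuppAntidiag,
        Finset.mem_piAntidiag] at hm ⊢
      obtain ⟨-, r1, r2⟩ := hm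
      refine ⟨fun i => ⟨?_, by simp⟩, ?_⟩
      · have := r1 i
        rw [rw2] at this
        simpa using (by exact_mod_cast this : ∑ j, m (i, j) = a i)
      · ext j
        have := r2 j
        rw [cl2] at this
        simpa [Finsupp.finset_sum_apply] using (by exact_mod_cast this : ∑ i, m (i, j) = b j)
    · intro x hx
      funext i
      ext j
      simp
    · intro m hm
      funext y
      simp
  · have hr : ∑ m ∈ Finset.piAntidiag (Finset.univ : Finset (Fin n × Fin n)) N, mt (rw2 m) a * mt (cl2 m) b = 0 := by
      refine Finset.sum_eq_zero fun m _ => ?_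
      rw [mt_mul, if_neg]
      rintro ⟨h1, h2⟩
      apply h
      exact ⟨fun i => by rw [← h1 i]; positivity, fun i => by rw [← h2 i]; positivity⟩
    rw [hr]
    by_cases h1 : ∀ i, 0 ≤ b i
    · have : ∃ i, a i < 0 := by
        by_contra hcon
        push Not at hcon
        exact h ⟨hcon, h1⟩
      obtain ⟨i, hi⟩ := this
      have hz0 : hz n (a i) = 0 := by rw [hz, if_neg (by omega)]
      rw [Finset.prod_eq_zero (Finset.mem_univ i) hz0, cf]
      simp
    · rw [cf, if_neg h1]

lemma prt_ext (l m : Partition') (h : ∀ i, prt l i = prt m i) : l = m :=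
  Subtype.ext (Finsupp.ext h)

theorem ortho {X : Type} [Fintype X] (l m : Partition') (hl : size l = Fintype.card X)
    (hm : size m = Fintype.card X) :
    ∑ g : Equiv.Perm X, Irr X l g * Irr X m g = (Fintype.card X).factorial * (if l = m then 1 else 0 : ℤ) := by
  obtain ⟨n, h1, h2, -⟩ := exists_n3 l m m
  simp only [Irr_eq l h1, Irr_eq m h2]
  unfold irr
  simp only [← alt_mul_left, ← alt_mul_right]
  simp only [← alt_sum, yc2]
  have hs : ∑ i : Fin n, (prt l i : ℤ) = (Fintype.card X : ℕ) := by
    rw [← hl, size_eq l h1]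
    push_cast; rfl
  have e : alt (fun i : Fin n => (prt m i : ℤ)) (fun b => alt (fun i : Fin n => (prt l i : ℤ)) fun a =>
      ((Fintype.card X).factorial : ℤ) *
      ∑ m ∈ Finset.piAntidiag Finset.univ (Fintype.card X), mt (rw2 m) a * mt (cl2 m) b) =
      ((Fintype.card X).factorial : ℤ) * alt (fun i : Fin n => (prt m i : ℤ)) (cf (sch fun i : Fin n => prt l i)) := by
    rw [← alt_mul_left]
    refine alt_congr _ _ _ fun b _ => ?_
    rw [sch, cf_alt, ← alt_mul_left]
    refine alt_congr _ _ _ fun a ha => ?_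
    rw [cf_prod a b (Fintype.card X) (ha.trans hs)]
  rw [e, alt_sch _ _ (fun i j h => prt_anti l h) (fun i j h => prt_anti m h)]
  congr 1
  have : (fun i : Fin n => prt l i) = (fun i : Fin n => prt m i) ↔ l = m := by
    constructor
    · intro h
      apply prt_ext
      intro i
      by_cases hi : i < n
      · exact congrFun h ⟨i, hi⟩
      · have := prt_anti l (not_lt.1 hi)
        have := prt_anti m (not_lt.1 hi)
        omega
    · rintro rfl; rfl
  simp only [this]

end Ortho
end Agu

namespace Agu
open Partition'

section Complete

def Pn (N : ℕ) : Type := {τ : Partition' // size τ = N}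

lemma prt_le (l : Partition') (i : ℕ) : prt l i ≤ size l := by
  have h : prt l (size l + i + 1) = 0 := by
    have := prt_anti l (show size l ≤ size l + i + 1 by omega)
    rw [apply_size] at this; omega
  rw [size_eq l h]
  exact Finset.single_le_sum (f := fun j : Fin (size l + i + 1) => prt l j) (fun _ _ => Nat.zero_le _)
    (Finset.mem_univ (⟨i, by omega⟩ : Fin (size l + i + 1)))

instance Pn_finite (N : ℕ) : Finite (Pn N) := by
  refine Finite.of_injective (β := Fin N → Fin (N + 1))
    (fun τ i => ⟨prt τ.1 i, by have := prt_le τ.1 i; have := τ.2; omega⟩) ?_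
  intro τ τ' h
  apply Subtype.ext
  apply prt_ext
  intro i
  by_cases hi : i < N
  · have := congrFun h ⟨i, hi⟩
    simpa using this
  · have h1 := prt_anti τ.1 (not_lt.1 hi)
    have h2 := prt_anti τ'.1 (not_lt.1 hi)
    have h3 := apply_size τ.1
    have h4 := apply_size τ'.1
    rw [τ.2] at h3
    rw [τ'.2] at h4
    omega

noncomputable instance Pn_fintype (N : ℕ) : Fintype (Pn N) := Fintype.ofFinite _

/-- the conjugate of a multiset of parts -/
noncomputable def conjM (s : Multiset ℕ) (i : ℕ) : ℕ := Multiset.countP (fun p => i < p) s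

lemma conjM_anti (s : Multiset ℕ) : Antitone (conjM s) := by
  intro i j h
  unfold conjM
  simp only [Multiset.countP_eq_card_filter]
  exact Multiset.card_le_card (Multiset.monotone_filter_right s fun p hp => lt_of_le_of_lt h hp)

lemma conjM_sum (s : Multiset ℕ) (N : ℕ) (h : ∀ p ∈ s, p ≤ N) : ∑ i ∈ Finset.range N, conjM s i = s.sum := by
  induction s using Multiset.induction with
  | empty => simp [conjM]
  | cons a s ih =>
    have := ih fun p hp => h p (Multiset.mem_cons_of_mem hp)
    rw [Multiset.sum_cons, ← this]
    unfold conjM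
    simp only [Multiset.countP_cons, Finset.sum_add_distrib]
    rw [add_comm]
    congr 1
    have ha := h a (Multiset.mem_cons_self a s)
    rw [← Finset.card_filter]
    rw [show (Finset.range N).filter (fun i => i < a) = Finset.range a from ?_, Finset.card_range]
    ext i
    simp
    omega

lemma conjM_count (s : Multiset ℕ) (p : ℕ) : conjM s p = conjM s (p + 1) + s.count (p + 1) := by
  induction s using Multiset.induction with
  | empty => simp [conjM]
  | cons a s ih =>
    unfold conjM at *
    simp only [Multiset.countP_cons, Multiset.count_cons, ih]
    split_ifs <;> omega

noncomputable def conjP {N : ℕ} (p : N.Partition) : Pn N := by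
  have hle : ∀ x ∈ p.parts, x ≤ N := fun x hx => by
    have := Multiset.le_sum_of_mem hx
    rwa [p.parts_sum] at this
  have h0 : ∀ i, N ≤ i → conjM p.parts i = 0 := by
    intro i hi
    unfold conjM
    rw [Multiset.countP_eq_zero]
    intro x hx
    have := hle x hx
    omega
  let f : ℕ →₀ ℕ := Finsupp.onFinset (Finset.range N) (conjM p.parts) (by
    intro i hi
    by_contra hcon
    exact hi (h0 i (by simpa using hcon)))
  let l : Partition' := ⟨f, fun i j h => conjM_anti _ h⟩
  refine ⟨l, ?_⟩
  have hN : prt l N = 0 := h0 N le_rfl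
  rw [size_eq l hN, Fin.sum_univ_eq_sum_range (prt l) N]
  exact (conjM_sum p.parts N hle).trans p.parts_sum

lemma prt_conjP {N : ℕ} (p : N.Partition) (i : ℕ) : prt (conjP p).1 i = conjM p.parts i := rfl

lemma conjP_inj {N : ℕ} : Function.Injective (conjP : N.Partition → Pn N) := by
  intro p q h
  apply Nat.Partition.ext
  ext x
  have hc : ∀ i, conjM p.parts i = conjM q.parts i := fun i => by rw [← prt_conjP, ← prt_conjP, h]
  cases x with
  | zero =>
    rw [Multiset.count_eq_zero_of_notMem fun h => (p.parts_pos h).ne rfl,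
      Multiset.count_eq_zero_of_notMem fun h => (q.parts_pos h).ne rfl]
  | succ x =>
    have h1 := conjM_count p.parts x
    have h2 := conjM_count q.parts x
    rw [hc, hc] at h1
    omega

variable {X : Type} [Fintype X]

lemma Irr_conj (l : Partition') (g h : Equiv.Perm X) (hgh : IsConj g h) : Irr X l g = Irr X l h := by
  obtain ⟨c, rfl⟩ := isConj_iff.1 hgh
  rw [← Irr_equiv c l g]
  congr 1

noncomputable def irrQ (τ : Pn (Fintype.card X)) : Equiv.Perm X → ℚ := fun g => (Irr X τ.1 g : ℚ)

lemma orthoQ (τ τ' : Pn (Fintype.card X)) : ∑ g, irrQ τ g * irrQ τ' g =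
    ((Fintype.card X).factorial : ℚ) * (if τ = τ' then 1 else 0) := by
  have := ortho (X := X) τ.1 τ'.1 τ.2 τ'.2
  have h2 := congrArg (Int.cast : ℤ → ℚ) this
  push_cast at h2
  unfold irrQ
  rw [h2]
  congr 1
  have : τ.1 = τ'.1 ↔ τ = τ' := Subtype.ext_iff.symm
  simp only [this]

lemma coefQ (c : Pn (Fintype.card X) → ℚ) (τ : Pn (Fintype.card X)) :
    ∑ g, (∑ t, c t • irrQ t) g * irrQ τ g = ((Fintype.card X).factorial : ℚ) * c τ := by
  simp only [Finset.sum_apply, Pi.smul_apply, smul_eq_mul, Finset.sum_mul]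
  rw [Finset.sum_comm]
  simp only [mul_assoc, ← Finset.mul_sum, orthoQ]
  rw [Finset.sum_eq_single τ]
  · simp; ring
  · intro t _ ht
    simp [ht]
  · simp

lemma irrQ_li : LinearIndependent ℚ (irrQ (X := X)) := by
  rw [Fintype.linearIndependent_iff]
  intro c hc τ
  have := coefQ c τ
  rw [hc] at this
  simp at this
  rcases this with h | h
  · exact absurd h (Nat.factorial_ne_zero _)
  · exact h

/-- functions factoring through the cycle type -/
noncomputable def Cls (X : Type) [Fintype X] : ((Fintype.card X).Partition → ℚ) →ₗ[ℚ] (Equiv.Perm X → ℚ) where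
  toFun φ := fun g => φ g.partition
  map_add' _ _ := rfl
  map_smul' _ _ := rfl

lemma mem_Cls (φ : Equiv.Perm X → ℚ) (hφ : ∀ g h, IsConj g h → φ g = φ h) : φ ∈ LinearMap.range (Cls X) := by
  refine ⟨fun p => if h : ∃ g : Equiv.Perm X, g.partition = p then φ h.choose else 0, ?_⟩
  funext g
  have h : ∃ g' : Equiv.Perm X, g'.partition = g.partition := ⟨g, rfl⟩
  change (if h : ∃ g' : Equiv.Perm X, g'.partition = g.partition then φ h.choose else 0) = _
  rw [dif_pos h]
  exact hφ _ _ (Equiv.Perm.partition_eq_of_isConj.2 h.choose_spec)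

lemma span_irrQ : Submodule.span ℚ (Set.range (irrQ (X := X))) = LinearMap.range (Cls X) := by
  apply Submodule.eq_of_le_of_finrank_le
  · rw [Submodule.span_le]
    rintro _ ⟨τ, rfl⟩
    apply mem_Cls
    intro g h hgh
    unfold irrQ
    rw [Irr_conj _ g h hgh]
  · rw [finrank_span_eq_card irrQ_li]
    refine (LinearMap.finrank_range_le _).trans ?_
    rw [Module.finrank_fintype_fun_eq_card]
    exact Fintype.card_le_of_injective _ conjP_inj

theorem complete (φ : Equiv.Perm X → ℤ) (hφ : ∀ g h, IsConj g h → φ g = φ h) (g : Equiv.Perm X) :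
    ((Fintype.card X).factorial : ℤ) * φ g =
      ∑ τ : Pn (Fintype.card X), (∑ x, φ x * Irr X τ.1 x) * Irr X τ.1 g := by
  have h1 : (fun g => (φ g : ℚ)) ∈ Submodule.span ℚ (Set.range (irrQ (X := X))) := by
    rw [span_irrQ]
    apply mem_Cls
    intro g h hgh
    rw [hφ g h hgh]
  obtain ⟨c, hc⟩ := (Submodule.mem_span_range_iff_exists_fun ℚ).1 h1
  have h2 : ∀ τ : Pn (Fintype.card X), ((∑ x, φ x * Irr X τ.1 x : ℤ) : ℚ) = ((Fintype.card X).factorial : ℚ) * c τ := by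
    intro τ
    rw [← coefQ c τ, hc]
    push_cast
    rfl
  have h3 : (φ g : ℚ) = ∑ τ, c τ * Irr X τ.1 g := by
    have := congrFun hc g
    rw [← this]
    simp [irrQ]
  have : (((Fintype.card X).factorial * φ g : ℤ) : ℚ) =
      ((∑ τ : Pn (Fintype.card X), (∑ x, φ x * Irr X τ.1 x) * Irr X τ.1 g : ℤ) : ℚ) := by
    rw [Int.cast_sum]
    simp only [Int.cast_mul, h2]
    rw [h3, Finset.mul_sum]
    refine Finset.sum_congr rfl fun τ _ => ?_
    push_cast
    ring
  exact_mod_cast this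

end Complete
end Agu

namespace Agu
open Partition'

section Expand
variable {X P Q R : Type} [Fintype X] [Fintype P] [Fintype Q] [Fintype R]

lemma fac_ne (N : ℕ) : (N.factorial : ℤ) ≠ 0 := by exact_mod_cast Nat.factorial_ne_zero N

lemma exp_kron (β η : Partition') (hβ : size β = Fintype.card X) (hη : size η = Fintype.card X) (h : Equiv.Perm X) :
    Irr X β h * Irr X η h = ∑ δ : Pn (Fintype.card X), (kron β η δ.1 : ℤ) * Irr X δ.1 h := by
  apply mul_left_cancel₀ (fac_ne (Fintype.card X))
  rw [complete (fun h => Irr X β h * Irr X η h) (by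
    intro g h hgh
    rw [Irr_conj β g h hgh, Irr_conj η g h hgh]), Finset.mul_sum]
  refine Finset.sum_congr rfl fun δ _ => ?_
  rw [kron_spec β η δ.1 hβ hη δ.2]
  ring

lemma sum_conj (μ : Partition') (g g' : Equiv.Perm P) (h h' : Equiv.Perm Q) (hg : IsConj g g') (hh : IsConj h h') :
    Irr (P ⊕ Q) μ (Equiv.sumCongr g h) = Irr (P ⊕ Q) μ (Equiv.sumCongr g' h') := by
  obtain ⟨c, rfl⟩ := isConj_iff.1 hg
  obtain ⟨d, rfl⟩ := isConj_iff.1 hh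
  rw [← Irr_equiv (Equiv.sumCongr c d)]
  congr 1
  ext x
  rcases x with x | x <;> simp [Equiv.permCongr_apply]

lemma exp_lr (μ : Partition') (hμ : size μ = Fintype.card P + Fintype.card Q) (g : Equiv.Perm P) (h : Equiv.Perm Q) :
    Irr (P ⊕ Q) μ (Equiv.sumCongr g h) = ∑ η : Pn (Fintype.card P), ∑ ρ : Pn (Fintype.card Q),
      (lr η.1 ρ.1 μ : ℤ) * (Irr P η.1 g * Irr Q ρ.1 h) := by
  have h1 := complete (fun g => Irr (P ⊕ Q) μ (Equiv.sumCongr g h)) (fun g g' hg => sum_conj μ g g' h h hg (IsConj.refl h)) g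
  have h2 : ∀ η : Pn (Fintype.card P), ∑ x, Irr (P ⊕ Q) μ (Equiv.sumCongr x h) * Irr P η.1 x =
      (Fintype.card P).factorial * ∑ ρ : Pn (Fintype.card Q), (lr η.1 ρ.1 μ : ℤ) * Irr Q ρ.1 h := by
    intro η
    apply mul_left_cancel₀ (fac_ne (Fintype.card Q))
    rw [complete (fun h => ∑ x, Irr (P ⊕ Q) μ (Equiv.sumCongr x h) * Irr P η.1 x) (by
      intro h h' hh
      refine Finset.sum_congr rfl fun x _ => ?_
      rw [sum_conj μ x x h h' (IsConj.refl x) hh])]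
    rw [← mul_assoc, Finset.mul_sum]
    refine Finset.sum_congr rfl fun ρ _ => ?_
    have h3 : ∑ y, (∑ x, Irr (P ⊕ Q) μ (Equiv.sumCongr x y) * Irr P η.1 x) * Irr Q ρ.1 y =
        (Fintype.card P).factorial * ((Fintype.card Q).factorial * (lr η.1 ρ.1 μ : ℤ)) := by
      rw [← lr_spec η.1 ρ.1 μ η.2 ρ.2 hμ, Finset.sum_comm]
      refine Finset.sum_congr rfl fun y _ => ?_
      rw [Finset.sum_mul]
      exact Finset.sum_congr rfl fun x _ => by ring
    rw [h3]
    ring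
  apply mul_left_cancel₀ (fac_ne (Fintype.card P))
  rw [h1, Finset.mul_sum]
  refine Finset.sum_congr rfl fun η _ => ?_
  rw [h2, mul_assoc, Finset.sum_mul]
  congr 1
  exact Finset.sum_congr rfl fun ρ _ => by ring

lemma S_eq (α δ ρ ν : Partition') (hα : size α = Fintype.card P) (hδ : size δ = Fintype.card Q)
    (hρ : size ρ = Fintype.card R) (hν : size ν = Fintype.card P + Fintype.card Q + Fintype.card R) :
    ∑ g : Equiv.Perm P, ∑ h : Equiv.Perm Q, ∑ k : Equiv.Perm R,
      Irr P α g * Irr Q δ h * Irr R ρ k * Irr (P ⊕ (Q ⊕ R)) ν (Equiv.sumCongr g (Equiv.sumCongr h k)) =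
    (Fintype.card P).factorial * ((Fintype.card Q).factorial * ((Fintype.card R).factorial *
      ∑ τ : Pn (Fintype.card (P ⊕ Q)), (lr α δ τ.1 : ℤ) * lr τ.1 ρ ν)) := by
  have e : ∀ (g : Equiv.Perm P) (h : Equiv.Perm Q) (k : Equiv.Perm R),
      Irr (P ⊕ (Q ⊕ R)) ν (Equiv.sumCongr g (Equiv.sumCongr h k)) =
      ∑ τ : Pn (Fintype.card (P ⊕ Q)), ∑ ρ' : Pn (Fintype.card R), (lr τ.1 ρ'.1 ν : ℤ) *
        (Irr (P ⊕ Q) τ.1 (Equiv.sumCongr g h) * Irr R ρ'.1 k) := by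
    intro g h k
    rw [← exp_lr ν (by rw [Fintype.card_sum, hν]), ← Irr_equiv (Equiv.sumAssoc P Q R)]
    congr 1
    ext x
    rcases x with x | x | x <;> simp [Equiv.permCongr_apply]
  have e2 : ∀ (g : Equiv.Perm P) (h : Equiv.Perm Q), ∑ k : Equiv.Perm R,
      Irr P α g * Irr Q δ h * Irr R ρ k * Irr (P ⊕ (Q ⊕ R)) ν (Equiv.sumCongr g (Equiv.sumCongr h k)) =
      ∑ τ : Pn (Fintype.card (P ⊕ Q)), ((Fintype.card R).factorial * (lr τ.1 ρ ν : ℤ)) *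
        (Irr P α g * Irr Q δ h * Irr (P ⊕ Q) τ.1 (Equiv.sumCongr g h)) := by
    intro g h
    simp only [e, Finset.mul_sum]
    rw [Finset.sum_comm]
    refine Finset.sum_congr rfl fun τ _ => ?_
    rw [Finset.sum_comm]
    have e3 : ∀ ρ' : Pn (Fintype.card R), ∑ k : Equiv.Perm R, Irr P α g * Irr Q δ h * Irr R ρ k *
        ((lr τ.1 ρ'.1 ν : ℤ) * (Irr (P ⊕ Q) τ.1 (Equiv.sumCongr g h) * Irr R ρ'.1 k)) =
        (Irr P α g * Irr Q δ h * (lr τ.1 ρ'.1 ν : ℤ) * Irr (P ⊕ Q) τ.1 (Equiv.sumCongr g h)) *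
          ((Fintype.card R).factorial * (if ρ = ρ'.1 then 1 else 0)) := by
      intro ρ'
      rw [← ortho ρ ρ'.1 hρ ρ'.2, Finset.mul_sum]
      exact Finset.sum_congr rfl fun k _ => by ring
    simp only [e3]
    refine (Finset.sum_eq_single (⟨ρ, hρ⟩ : Pn (Fintype.card R)) ?_ ?_).trans ?_
    · intro ρ' _ hne
      rw [if_neg (fun h => hne (Subtype.ext h.symm))]
      ring
    · exact fun h => absurd (Finset.mem_univ (α := Pn (Fintype.card R)) ⟨ρ, hρ⟩) h
    · rw [if_pos rfl]; ring
  simp only [e2]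
  have e4 : ∀ g : Equiv.Perm P, ∑ h : Equiv.Perm Q, ∑ τ : Pn (Fintype.card (P ⊕ Q)),
      ((Fintype.card R).factorial * (lr τ.1 ρ ν : ℤ)) *
        (Irr P α g * Irr Q δ h * Irr (P ⊕ Q) τ.1 (Equiv.sumCongr g h)) =
      ∑ τ : Pn (Fintype.card (P ⊕ Q)), ∑ h : Equiv.Perm Q, ((Fintype.card R).factorial * (lr τ.1 ρ ν : ℤ)) *
        (Irr P α g * Irr Q δ h * Irr (P ⊕ Q) τ.1 (Equiv.sumCongr g h)) := fun g => Finset.sum_comm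
  simp only [e4]
  rw [Finset.sum_comm]
  simp only [← Finset.mul_sum]
  simp only [Finset.mul_sum]
  refine Finset.sum_congr rfl fun τ _ => ?_
  have := lr_spec (P := P) (Q := Q) α δ τ.1 hα hδ (by rw [τ.2, Fintype.card_sum])
  simp only [← Finset.mul_sum]
  rw [this]
  ring

lemma lam6 {A B C D E G H K : Type} [Fintype A] [Fintype B] [Fintype C] [Fintype D] [Fintype E] [Fintype G]
    [Fintype H] [Fintype K] (x : A → B → ℤ) (y : D → E → ℤ) (z : B → D → C → ℤ)
    (a : A → G → ℤ) (b : B → H → ℤ) (d : D → H → ℤ) (e : E → K → ℤ) (c : C → H → ℤ) (v : G → H → K → ℤ)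
    (hz : ∀ i j h, b i h * d j h = ∑ k, z i j k * c k h) :
    ∑ g, ∑ h, ∑ k, (∑ i, ∑ j, x i j * (a i g * b j h)) * (∑ i, ∑ j, y i j * (d i h * e j k)) * v g h k =
    ∑ i, ∑ j, ∑ l, ∑ p, ∑ q, x i j * y p q * z j p l * ∑ g, ∑ h, ∑ k, a i g * c l h * e q k * v g h k := by
  have h1 : ∀ g h k, (∑ i, ∑ j, x i j * (a i g * b j h)) * (∑ i, ∑ j, y i j * (d i h * e j k)) * v g h k =
      ∑ i, ∑ j, ∑ l, ∑ p, ∑ q, x i j * y p q * z j p l * (a i g * c l h * e q k * v g h k) := by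
    intro g h k
    simp only [Finset.sum_mul]
    refine Finset.sum_congr rfl fun i _ => Finset.sum_congr rfl fun j _ => ?_
    rw [Finset.sum_comm' (s := (Finset.univ : Finset C)) (t := fun _ => (Finset.univ : Finset D))
      (t' := (Finset.univ : Finset D)) (s' := fun _ => (Finset.univ : Finset C)) (by simp)]
    rw [Finset.mul_sum, Finset.sum_mul]
    refine Finset.sum_congr rfl fun p _ => ?_
    rw [Finset.sum_comm, Finset.mul_sum, Finset.sum_mul]
    refine Finset.sum_congr rfl fun q _ => ?_
    have : x i j * (a i g * b j h) * (y p q * (d p h * e q k)) * v g h k =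
      (x i j * a i g * y p q * e q k * v g h k) * (b j h * d p h) := by ring
    rw [this, hz, Finset.mul_sum]
    exact Finset.sum_congr rfl fun l _ => by ring
  simp only [h1]
  simp only [Finset.mul_sum]
  have sw : ∀ (F : G → H → K → A → B → C → D → E → ℤ), ∑ g, ∑ h, ∑ k, ∑ i, ∑ j, ∑ l, ∑ p, ∑ q, F g h k i j l p q =
      ∑ i, ∑ j, ∑ l, ∑ p, ∑ q, ∑ g, ∑ h, ∑ k, F g h k i j l p q := by
    intro F
    simp only [← Fintype.sum_prod_type']
    rw [← Equiv.sum_comp (⟨fun t => (t.2.2.2.2.2.1, t.2.2.2.2.2.2.1, t.2.2.2.2.2.2.2, t.1, t.2.1, t.2.2.1, t.2.2.2.1, t.2.2.2.2.1),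
      fun t => (t.2.2.2.1, t.2.2.2.2.1, t.2.2.2.2.2.1, t.2.2.2.2.2.2.1, t.2.2.2.2.2.2.2, t.1, t.2.1, t.2.2.1),
      fun _ => rfl, fun _ => rfl⟩ : (A × B × C × D × E × G × H × K) ≃ (G × H × K × A × B × C × D × E))]
    rfl
  exact sw _

theorem bb_eq {n : ℕ} (l m nu : Partition')
    (hl : prt l n = 0) (hm : prt m n = 0) (hnu : prt nu n = 0)
    (sl : size l = Fintype.card P + Fintype.card Q) (sm : size m = Fintype.card Q + Fintype.card R)
    (snu : size nu = Fintype.card P + Fintype.card Q + Fintype.card R) :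
    bb n l m nu = ∑ α : Pn (Fintype.card P), ∑ β : Pn (Fintype.card Q), ∑ δ : Pn (Fintype.card Q),
      ∑ η : Pn (Fintype.card Q), ∑ ρ : Pn (Fintype.card R), ∑ τ : Pn (Fintype.card (P ⊕ Q)),
      lr α.1 β.1 l * lr η.1 ρ.1 m * kron β.1 η.1 δ.1 * lr α.1 δ.1 τ.1 * lr τ.1 ρ.1 nu := by
  have h := T_thm (P := P) (Q := Q) (R := R) l m nu hl hm hnu sl sm snu
  simp only [exp_lr l sl, exp_lr m sm] at h
  rw [lam6 (C := Pn (Fintype.card Q)) (fun (α : Pn (Fintype.card P)) (β : Pn (Fintype.card Q)) => (lr α.1 β.1 l : ℤ))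
    (fun (η : Pn (Fintype.card Q)) (ρ : Pn (Fintype.card R)) => (lr η.1 ρ.1 m : ℤ))
    (fun β η δ => (kron β.1 η.1 δ.1 : ℤ)) (fun α g => Irr P α.1 g) (fun β h => Irr Q β.1 h)
    (fun β h => Irr Q β.1 h) (fun ρ k => Irr R ρ.1 k) (fun δ h => Irr Q δ.1 h)
    (fun g h k => Irr (P ⊕ (Q ⊕ R)) nu (Equiv.sumCongr g (Equiv.sumCongr h k)))
    (fun β η h => exp_kron β.1 η.1 β.2 η.2 h)] at h
  simp only [fun (α : Pn (Fintype.card P)) (δ : Pn (Fintype.card Q)) (ρ : Pn (Fintype.card R)) =>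
    S_eq α.1 δ.1 ρ.1 nu α.2 δ.2 ρ.2 snu] at h
  have h' : (bb n l m nu : ℤ) = ∑ α : Pn (Fintype.card P), ∑ β : Pn (Fintype.card Q), ∑ δ : Pn (Fintype.card Q),
      ∑ η : Pn (Fintype.card Q), ∑ ρ : Pn (Fintype.card R), ∑ τ : Pn (Fintype.card (P ⊕ Q)),
      (lr α.1 β.1 l : ℤ) * lr η.1 ρ.1 m * kron β.1 η.1 δ.1 * lr α.1 δ.1 τ.1 * lr τ.1 ρ.1 nu := by
    apply mul_left_cancel₀ (fac_ne (Fintype.card R))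
    apply mul_left_cancel₀ (fac_ne (Fintype.card Q))
    apply mul_left_cancel₀ (fac_ne (Fintype.card P))
    rw [← h]
    simp only [Finset.mul_sum]
    refine Finset.sum_congr rfl fun α _ => Finset.sum_congr rfl fun β _ => Finset.sum_congr rfl fun δ _ =>
      Finset.sum_congr rfl fun η _ => Finset.sum_congr rfl fun ρ _ => Finset.sum_congr rfl fun τ _ => by ring
  exact_mod_cast h'

end Expand
end Agu

namespace Agu
open Partition'

lemma finsum_Pn (N : ℕ) (f : Partition' → ℕ) (h : ∀ x, size x ≠ N → f x = 0) :
    ∑ᶠ x, f x = ∑ τ : Pn N, f τ.1 := by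
  rw [← finsum_eq_sum_of_fintype]
  have h1 : ∑ᶠ x, f x = ∑ᶠ x ∈ {x : Partition' | size x = N}, f x := by
    refine finsum_congr fun x => ?_
    by_cases hx : size x = N
    · rw [finsum_eq_if]; exact (if_pos hx).symm
    · rw [h x hx, finsum_zero]
  rw [h1]
  exact (finsum_set_coe_eq_finsum_mem {x : Partition' | size x = N}).symm

lemma lr_ne {l m nu : Partition'} (h : size nu ≠ size l + size m) : lr l m nu = 0 := by
  unfold lr
  exact if_neg h

lemma kron_ne {l m nu : Partition'} (h : ¬ (size l = size nu ∧ size m = size nu)) : kron l m nu = 0 := by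
  unfold kron
  exact if_neg h

lemma term_zero (l m nu α β δ η ρ τ : Partition')
    (h : ¬ (size l = size α + size β ∧ size m = size η + size ρ ∧ size β = size δ ∧ size η = size δ ∧
      size τ = size α + size δ ∧ size nu = size τ + size ρ)) :
    lr α β l * lr η ρ m * kron β η δ * lr α δ τ * lr τ ρ nu = 0 := by
  by_contra hc
  apply h
  simp only [mul_eq_zero, not_or] at hc
  obtain ⟨⟨⟨⟨h1, h2⟩, h3⟩, h4⟩, h5⟩ := hc
  have e1 := not_imp_comm.1 lr_ne h1
  have e2 := not_imp_comm.1 lr_ne h2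
  have e3 := not_imp_comm.1 kron_ne h3
  have e4 := not_imp_comm.1 lr_ne h4
  have e5 := not_imp_comm.1 lr_ne h5
  exact ⟨e1, e2, e3.1, e3.2, e4, e5⟩

lemma aguiar_sum (l m nu : Partition') (p q r s : ℕ) (hs : s = p + q) (hl : size l = p + q) (hm : size m = q + r)
    (hnu : size nu = p + q + r) : aguiar l m nu = ∑ α : Pn p, ∑ β : Pn q, ∑ δ : Pn q,
      ∑ η : Pn q, ∑ ρ : Pn r, ∑ τ : Pn s,
      lr α.1 β.1 l * lr η.1 ρ.1 m * kron β.1 η.1 δ.1 * lr α.1 δ.1 τ.1 * lr τ.1 ρ.1 nu := by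
  have tz := term_zero l m nu
  rw [hl, hm, hnu] at tz
  unfold aguiar
  rw [finsum_Pn p]
  swap
  · intro α hα
    simp only [fun β δ η ρ τ => tz α β δ η ρ τ (by omega), finsum_zero]
  refine Finset.sum_congr rfl fun α _ => ?_
  have hα : size α.1 = p := α.2
  rw [finsum_Pn q]
  swap
  · intro β hβ
    simp only [fun δ η ρ τ => tz α.1 β δ η ρ τ (by omega), finsum_zero]
  refine Finset.sum_congr rfl fun β _ => ?_
  have hβ : size β.1 = q := β.2
  rw [finsum_Pn q]
  swap
  · intro δ hδ
    simp only [fun η ρ τ => tz α.1 β.1 δ η ρ τ (by omega), finsum_zero]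
  refine Finset.sum_congr rfl fun δ _ => ?_
  have hδ : size δ.1 = q := δ.2
  rw [finsum_Pn q]
  swap
  · intro η hη
    simp only [fun ρ τ => tz α.1 β.1 δ.1 η ρ τ (by omega), finsum_zero]
  refine Finset.sum_congr rfl fun η _ => ?_
  have hη : size η.1 = q := η.2
  rw [finsum_Pn r]
  swap
  · intro ρ hρ
    simp only [fun τ => tz α.1 β.1 δ.1 η.1 ρ τ (by omega), finsum_zero]
  refine Finset.sum_congr rfl fun ρ _ => ?_
  rw [finsum_Pn s]
  intro τ hτ
  exact tz _ _ _ _ _ _ (by omega)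

lemma Nm_zero {n : ℕ} (a b c : Fin n → ℤ) (h : ¬ ∃ p q r : ℕ, ∑ i, a i = p + q ∧ ∑ i, b i = q + r ∧
    ∑ i, c i = p + q + r) : Nm ![a, b, c] = 0 := by
  unfold Nm
  rw [Nat.card_eq_zero]
  left
  refine ⟨fun ⟨m, hm⟩ => h ?_⟩
  have hcomb : comb (fun y => m (Sum.inl y)) (fun y => m (Sum.inr (Sum.inl y)))
      (fun y => m (Sum.inr (Sum.inr y))) = m := by
    ext s
    rcases s with s | s | s <;> rfl
  have t0 : ∀ i, (mg m 0 i : ℤ) = a i := fun i => hm 0 i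
  have t1 : ∀ i, (mg m 1 i : ℤ) = b i := fun i => hm 1 i
  have t2 : ∀ i, (mg m 2 i : ℤ) = c i := fun i => hm 2 i
  have key : ∀ (Y : Type) [Fintype Y] (φ : Y → Fin n) (m : Y → ℕ),
      ∑ i, ∑ y, (if φ y = i then m y else 0) = ∑ y, m y := by
    intro Y _ φ m
    rw [Finset.sum_comm]
    refine Finset.sum_congr rfl fun y _ => ?_
    simp
  have ee := fun i => mg_comb (fun y => m (Sum.inl y)) (fun y => m (Sum.inr (Sum.inl y)))
          (fun y => m (Sum.inr (Sum.inr y))) i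
  rw [hcomb] at ee
  refine ⟨∑ y : Fin n × Fin n, m (Sum.inl y), ∑ y : Fin n × Fin n × Fin n, m (Sum.inr (Sum.inl y)),
    ∑ y : Fin n × Fin n, m (Sum.inr (Sum.inr y)), ?_, ?_, ?_⟩
  · rw [← Finset.sum_congr rfl fun i _ => t0 i]
    norm_cast
    simp only [fun i => (ee i).1, Finset.sum_add_distrib, key]
  · rw [← Finset.sum_congr rfl fun i _ => t1 i]
    norm_cast
    simp only [fun i => (ee i).2.1, Finset.sum_add_distrib, key]
  · rw [← Finset.sum_congr rfl fun i _ => t2 i]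
    norm_cast
    simp only [fun i => (ee i).2.2, Finset.sum_add_distrib, key, add_assoc]

lemma bb_zero {n : ℕ} (l m nu : Partition')
    (hl : prt l n = 0) (hm : prt m n = 0) (hnu : prt nu n = 0)
    (h : ¬ ∃ p q r : ℕ, size l = p + q ∧ size m = q + r ∧ size nu = p + q + r) : bb n l m nu = 0 := by
  have sz : ∀ l : Partition', prt l n = 0 → ∑ i : Fin n, ((prt l i : ℕ) : ℤ) = (size l : ℤ) := by
    intro l hl
    rw [size_eq l hl]; push_cast; rfl
  have hk : ∀ b, Antitone (wt3 n l m nu b) := by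
    intro b
    fin_cases b <;> exact fun i j hij => prt_anti _ hij
  have key : (bb n l m nu : ℤ) = 0 := by
    unfold bb
    rw [finrank_HT _ hk]
    have z : ∀ κ : Fin n → ℤ, alt κ (fun _ => (0 : ℤ)) = 0 := by intro κ; simp [alt]
    rw [← z (fun i : Fin n => (prt nu i : ℤ))]
    refine alt_congr (fun i : Fin n => (prt nu i : ℤ)) _ _ fun c hc => ?_
    rw [← z (fun i : Fin n => (prt m i : ℤ))]
    refine alt_congr (fun i : Fin n => (prt m i : ℤ)) _ _ fun b hb => ?_
    rw [← z (fun i : Fin n => (prt l i : ℤ))]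
    refine alt_congr (fun i : Fin n => (prt l i : ℤ)) _ _ fun a ha => ?_
    rw [sz _ hl] at ha
    rw [sz _ hm] at hb
    rw [sz _ hnu] at hc
    rw [Nm_zero a b c]
    · rfl
    · rintro ⟨p, q, r, h1, h2, h3⟩
      exact h ⟨p, q, r, by omega, by omega, by omega⟩
  exact_mod_cast key

theorem aguiar_eq {n : ℕ} (l m nu : Partition')
    (hl : prt l n = 0) (hm : prt m n = 0) (hnu : prt nu n = 0) : aguiar l m nu = bb n l m nu := by
  by_cases h : ∃ p q r : ℕ, size l = p + q ∧ size m = q + r ∧ size nu = p + q + r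
  · obtain ⟨p, q, r, h1, h2, h3⟩ := h
    have c1 : Fintype.card (Fin p) = p := Fintype.card_fin p
    have c2 : Fintype.card (Fin q) = q := Fintype.card_fin q
    have c3 : Fintype.card (Fin r) = r := Fintype.card_fin r
    rw [← c1, ← c2] at h1
    rw [← c2, ← c3] at h2
    rw [← c1, ← c2, ← c3] at h3
    exact (aguiar_sum l m nu _ _ _ _ Fintype.card_sum h1 h2 h3).trans
      (bb_eq (P := Fin p) (Q := Fin q) (R := Fin r) l m nu hl hm hnu h1 h2 h3).symm
  · rw [bb_zero l m nu hl hm hnu h]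
    unfold aguiar
    have tz := term_zero l m nu
    have : ∀ α β δ η ρ τ : Partition', lr α β l * lr η ρ m * kron β η δ * lr α δ τ * lr τ ρ nu = 0 := by
      intro α β δ η ρ τ
      refine tz α β δ η ρ τ fun hh => h ⟨size α, size β, size ρ, ?_, ?_, ?_⟩ <;> omega
    simp only [this, finsum_zero]

theorem main (α β γ : Partition') (h : ∀ d : ℕ, 0 < d → aguiar (d • α) (d • β) (d • γ) = 1) (l m nu : Partition') :
    ∃ N : ℕ, ∀ d : ℕ, N ≤ d → aguiar (l + d • α) (m + d • β) (nu + d • γ) =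
      aguiar (l + N • α) (m + N • β) (nu + N • γ) := by
  obtain ⟨n, hn⟩ : ∃ n, n = size l + size m + size nu + size α + size β + size γ := ⟨_, rfl⟩
  have hz : ∀ x : Partition', size x ≤ n → prt x n = 0 := by
    intro x hx
    have := prt_anti x hx
    rw [apply_size] at this; omega
  have zl := hz l (by omega)
  have zm := hz m (by omega)
  have znu := hz nu (by omega)
  have za := hz α (by omega)
  have zb := hz β (by omega)
  have zg := hz γ (by omega)
  have psm : ∀ (d : ℕ) (x : Partition') (i : ℕ), prt (d • x) i = d * prt x i := fun d x i => rfl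
  have pad : ∀ (d : ℕ) (y x : Partition') (i : ℕ), prt (y + d • x) i = prt y i + d * prt x i := fun d y x i => rfl
  set ω : Fin 3 → Fin n → ℤ := fun b i => ((wt3 n α β γ b i : ℕ) : ℤ) with hω
  set χ : Fin 3 → Fin n → ℤ := fun b i => ((wt3 n l m nu b i : ℕ) : ℤ) with hχ
  have e1 : ∀ d : ℕ, (fun b i => ((wt3 n (d • α) (d • β) (d • γ) b i : ℕ) : ℤ)) = d • ω := by
    intro d
    funext b i
    fin_cases b <;> simp [wt3, hω, psm]
  have e2 : ∀ d : ℕ, (fun b i => ((wt3 n (l + d • α) (m + d • β) (nu + d • γ) b i : ℕ) : ℤ)) = χ + d • ω := by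
    intro d
    funext b i
    fin_cases b <;> simp [wt3, hω, hχ, pad]
  have a1 : ∀ d : ℕ, aguiar (d • α) (d • β) (d • γ) = Module.finrank ℝ (HT (d • ω)) := by
    intro d
    rw [aguiar_eq (n := n) _ _ _ (by rw [psm, za, mul_zero]) (by rw [psm, zb, mul_zero])
      (by rw [psm, zg, mul_zero]), bb, e1]
  have a2 : ∀ d : ℕ, aguiar (l + d • α) (m + d • β) (nu + d • γ) = Module.finrank ℝ (HT (χ + d • ω)) := by
    intro d
    rw [aguiar_eq (n := n) _ _ _ (by rw [pad, zl, za, mul_zero, add_zero]) (by rw [pad, zm, zb, mul_zero, add_zero])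
      (by rw [pad, znu, zg, mul_zero, add_zero]), bb, e2]
  obtain ⟨N, hN⟩ := HT_stable ω χ fun d hd => by rw [← a1 d, h d hd]
  exact ⟨N, fun d hd => by rw [a2, a2, hN d hd]⟩

end Agu

open Partition' in
/-- If `a_{dα,dβ}^{dγ} = 1` for every positive integer `d`, then for every triple of
partitions `(λ,μ,ν)` the sequence `d ↦ a_{λ+dα,μ+dβ}^{ν+dγ}` is eventually constant. -/
theorem aguiar_stable_of_dilated_one (α β γ : Partition')
    (h : ∀ d : ℕ, 0 < d → aguiar (d • α) (d • β) (d • γ) = 1) :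
    ∀ l m nu : Partition', ∃ N : ℕ, ∀ d : ℕ, N ≤ d →
      aguiar (l + d • α) (m + d • β) (nu + d • γ) =
        aguiar (l + N • α) (m + N • β) (nu + N • γ) := fun l m nu =>
  Agu.main α β γ h l m nu
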